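/- Nicholson-type formula for Ferrers functions. Let ν, μ ∈ ℂ with μ ∉ ℤ and Re(ν−μ) > −1, and such that ν−μ+1 is not a nonpositive integer, and let x be a real number in (−1,1). Assume that the function w ↦ Q_ν^{−μ}(w) · (w−1)^{(μ−1)/2} · (w+1)^{−μ/2} · (1 − 2x² + w)^{μ−1/2} is absolutely integrable on (1, ∞) (note 1 − 2x² + w > 0 for w > 1). Then (𝖰_ν^{−μ}(x))² + (π²/4)(𝖯_ν^{−μ}(x))² = [√π e^{iπμ}] / [2^μ Γ(μ+1/2) (1−x²)^μ] × ∫_1^∞ Q_ν^{−μ}(w) · (w−1)^{(μ−1)/2} · (w+1)^{−μ/2} · (1 − 2x² + w)^{μ−1/2} dw. -/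

import Mathlib

open MeasureTheory Set

/-- The regularized Gauss hypergeometric function `₂F̃₁(a,b;c;z)`. -/
noncomputable def hyp2F1reg (a b c z : ℂ) : ℂ :=
  ∑' n : ℕ, (ascPochhammer ℂ n).eval a * (ascPochhammer ℂ n).eval b /
      (Complex.Gamma (c + n) * (n.factorial : ℂ)) * z ^ n

/-- The Jacobi function of the second kind `Q_γ^{(α,β)}(z)` for real `z > 1`. -/
noncomputable def jacobiQ (α β γ : ℂ) (z : ℝ) : ℂ :=
  (2 : ℂ) ^ (α + β + γ) * Complex.Gamma (α + γ + 1) * Complex.Gamma (β + γ + 1) *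
    ((z : ℂ) - 1) ^ (-α) * ((z : ℂ) + 1) ^ (-β - γ - 1) *
    hyp2F1reg (γ + 1) (β + γ + 1) (α + β + 2 * γ + 2) (2 / (1 + (z : ℂ)))

/-- The Jacobi function of the first kind `P_γ^{(α,β)}(z)` for real `z > 1`. -/
noncomputable def jacobiP (α β γ : ℂ) (z : ℝ) : ℂ :=
  Complex.Gamma (α + γ + 1) / Complex.Gamma (γ + 1) * (((z : ℂ) + 1) / 2) ^ γ *
    hyp2F1reg (-γ) (-β - γ) (α + 1) (((z : ℂ) - 1) / ((z : ℂ) + 1))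

/-- The Jacobi function of the first kind on the cut `𝖯_γ^{(α,β)}(x)`, `x ∈ (−1,1)`. -/
noncomputable def jacobiPcut (α β γ : ℂ) (x : ℝ) : ℂ :=
  Complex.Gamma (α + γ + 1) / Complex.Gamma (γ + 1) *
    hyp2F1reg (-γ) (α + β + γ + 1) (α + 1) ((1 - (x : ℂ)) / 2)

/-- The Gegenbauer function of the first kind `C_λ^α(z)` for real `z > 1`. -/
noncomputable def gegenbauerC (lam α : ℂ) (z : ℝ) : ℂ :=
  (Real.sqrt Real.pi : ℂ) * Complex.Gamma (lam + 2 * α) /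
      ((2 : ℂ) ^ (2 * α - 1) * Complex.Gamma α * Complex.Gamma (lam + 1)) *
    (((z : ℂ) + 1) / 2) ^ lam *
    hyp2F1reg (-lam) (1 / 2 - α - lam) (α + 1 / 2) (((z : ℂ) - 1) / ((z : ℂ) + 1))

/-- The Gegenbauer function of the first kind on the cut `𝖢_λ^α(x)`, `x ∈ (−1,1)`. -/
noncomputable def gegenbauerCcut (lam α : ℂ) (x : ℝ) : ℂ :=
  (Real.sqrt Real.pi : ℂ) * Complex.Gamma (lam + 2 * α) /
      ((2 : ℂ) ^ (2 * α - 1) * Complex.Gamma α * Complex.Gamma (lam + 1)) *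
    hyp2F1reg (-lam) (lam + 2 * α) (α + 1 / 2) ((1 - (x : ℂ)) / 2)

/-- The Gegenbauer function of the second kind `D_λ^α(z)` for real `z > 1`. -/
noncomputable def gegenbauerD (lam α : ℂ) (z : ℝ) : ℂ :=
  Complex.exp ((Real.pi : ℂ) * Complex.I * α) * (Complex.Gamma (lam + 2 * α) / Complex.Gamma α) *
    (2 * (z : ℂ)) ^ (-lam - 2 * α) *
    hyp2F1reg (lam / 2 + α) (lam / 2 + α + 1 / 2) (lam + α + 1) (1 / (z : ℂ) ^ 2)

/-- The associated Legendre function of the second kind `Q_ν^μ(z)` for real `z > 1`. -/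
noncomputable def legendreQ (ν μ : ℂ) (z : ℝ) : ℂ :=
  (Real.sqrt Real.pi : ℂ) * Complex.exp ((Real.pi : ℂ) * Complex.I * μ) *
    Complex.Gamma (ν + μ + 1) * ((z : ℂ) ^ 2 - 1) ^ (μ / 2) * (2 : ℂ) ^ (-ν - 1) *
    (z : ℂ) ^ (-ν - μ - 1) *
    hyp2F1reg ((ν + μ + 1) / 2) ((ν + μ + 2) / 2) (ν + 3 / 2) (1 / (z : ℂ) ^ 2)

/-- The Legendre function of the first kind `P_ν(z)` for real `z ≥ 1`. -/
noncomputable def legendreP (ν : ℂ) (z : ℝ) : ℂ :=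
  (((z : ℂ) + 1) / 2) ^ ν * hyp2F1reg (-ν) (-ν) 1 (((z : ℂ) - 1) / ((z : ℂ) + 1))

/-- The associated Legendre function of the first kind of order `−μ`, `P_ν^{−μ}(z)`, `z > 1`. -/
noncomputable def legendrePa (ν μ : ℂ) (z : ℝ) : ℂ :=
  (((z : ℂ) - 1) / ((z : ℂ) + 1)) ^ (μ / 2) * (((z : ℂ) + 1) / 2) ^ ν *
    hyp2F1reg (-ν) (μ - ν) (μ + 1) (((z : ℂ) - 1) / ((z : ℂ) + 1))

/-- The Ferrers function of the first kind of order `−μ`, `𝖯_ν^{−μ}(x)`, `x ∈ (−1,1)`. -/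
noncomputable def ferrersP (ν μ : ℂ) (x : ℝ) : ℂ :=
  ((1 - (x : ℂ)) / (1 + (x : ℂ))) ^ (μ / 2) * hyp2F1reg (-ν) (ν + 1) (1 + μ) ((1 - (x : ℂ)) / 2)

/-- The Ferrers function of the second kind of order `−μ`, `𝖰_ν^{−μ}(x)`, `x ∈ (−1,1)`. -/
noncomputable def ferrersQ (ν μ : ℂ) (x : ℝ) : ℂ :=
  -((Real.pi : ℂ) / (2 * Complex.sin ((Real.pi : ℂ) * μ))) *
    (Complex.cos ((Real.pi : ℂ) * (ν - μ)) *
        (Complex.Gamma (ν - μ + 1) / Complex.Gamma (ν + μ + 1)) *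
        ((1 + (x : ℂ)) / (1 - (x : ℂ))) ^ (-μ / 2) *
        hyp2F1reg (-ν) (ν + 1) (1 - μ) ((1 + (x : ℂ)) / 2) -
      Complex.cos ((Real.pi : ℂ) * ν) * ((1 - (x : ℂ)) / (1 + (x : ℂ))) ^ (-μ / 2) *
        hyp2F1reg (-ν) (ν + 1) (1 + μ) ((1 + (x : ℂ)) / 2))

namespace NF
open Filter Topology

/-- Pochhammer symbol. -/
noncomputable def poch (z : ℂ) (n : ℕ) : ℂ := (ascPochhammer ℂ n).eval z

lemma poch_zero (z : ℂ) : poch z 0 = 1 := by simp [poch]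

lemma poch_succ (z : ℂ) (n : ℕ) : poch z (n + 1) = poch z n * (z + n) := by
  simp [poch, ascPochhammer_succ_right, mul_comm]

lemma poch_eq_prod (z : ℂ) (n : ℕ) : poch z n = ∏ j ∈ Finset.range n, (z + j) := by
  induction n with
  | zero => simp [poch_zero]
  | succ n ih => rw [poch_succ, ih, Finset.prod_range_succ]

lemma poch_succ_left (z : ℂ) (n : ℕ) : poch z (n + 1) = z * poch (z + 1) n := by
  rw [poch_eq_prod, poch_eq_prod, Finset.prod_range_succ']
  simp only [Nat.cast_add, Nat.cast_one, Nat.cast_zero, add_zero]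
  rw [mul_comm]; congr 1
  apply Finset.prod_congr rfl; intros; ring

lemma eventually_add_ne (z : ℂ) : ∀ᶠ n : ℕ in atTop, z + (n : ℂ) ≠ 0 := by
  obtain ⟨m, hm⟩ := exists_nat_gt (-z.re)
  filter_upwards [eventually_ge_atTop m] with n hn h0
  have : (z + (n:ℂ)).re = 0 := by rw [h0]; simp
  simp at this
  have : (m:ℝ) ≤ n := by exact_mod_cast hn
  linarith

lemma tendsto_nat_div (z : ℂ) : Tendsto (fun n : ℕ => (n : ℂ) / (z + n)) atTop (𝓝 1) := by
  have h1 : Tendsto (fun n : ℕ => z / (n : ℂ) + 1) atTop (𝓝 (0 + 1)) :=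
    (tendsto_const_div_atTop_nhds_zero_nat z).add tendsto_const_nhds
  have h2 := h1.inv₀ (by norm_num)
  simp only [zero_add, inv_one] at h2
  refine h2.congr' ?_
  filter_upwards [eventually_ne_atTop 0, eventually_add_ne z] with n hn hz
  have : (n : ℂ) ≠ 0 := by exact_mod_cast hn
  field_simp

lemma poch_asymp (z : ℂ) : Tendsto (fun n : ℕ => poch z n / ((n : ℂ) ^ (z - 1) * n.factorial))
    atTop (𝓝 (Complex.Gamma z)⁻¹) := by
  by_cases hz : ∃ m : ℕ, z = -m
  · obtain ⟨m, rfl⟩ := hz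
    rw [Complex.Gamma_neg_nat_eq_zero, inv_zero]
    refine tendsto_const_nhds.congr' ?_
    filter_upwards [eventually_gt_atTop m] with n hn
    have : poch (-(m:ℂ)) n = 0 := by
      rw [poch_eq_prod]
      apply Finset.prod_eq_zero (Finset.mem_range.2 hn); simp
    rw [this, zero_div]
  · push Not at hz
    have h1 := ((Complex.GammaSeq_tendsto_Gamma z).inv₀ (Complex.Gamma_ne_zero hz)).mul
      (tendsto_nat_div z)
    rw [mul_one] at h1
    refine h1.congr' ?_
    filter_upwards [eventually_ne_atTop 0, eventually_add_ne z] with n hn hzn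
    have hn' : (n : ℂ) ≠ 0 := by exact_mod_cast hn
    rw [Complex.GammaSeq, ← poch_eq_prod, poch_succ, Complex.cpow_sub _ _ hn', Complex.cpow_one]
    have : (n:ℂ)^z ≠ 0 := by simp [Complex.cpow_eq_zero_iff, hn']
    have : (n.factorial : ℂ) ≠ 0 := by exact_mod_cast n.factorial_ne_zero
    field_simp

lemma Gamma_add_nat (z : ℂ) (hz : ∀ k : ℕ, z ≠ -k) (n : ℕ) :
    Complex.Gamma (z + n) = poch z n * Complex.Gamma z := by
  have := Complex.Gamma_add_nat_div_Gamma_eq (n := n) z hz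
  have h0 := Complex.Gamma_ne_zero hz
  rw [poch, ← this]; field_simp

lemma ne_neg_nat_of_re_pos {z : ℂ} (hz : 0 < z.re) (k : ℕ) : z ≠ -k := by
  rintro rfl
  simp at hz
  have : (0:ℝ) ≤ k := Nat.cast_nonneg k
  linarith

lemma Gamma_asymp_aux (m : ℕ) : ∀ z : ℂ, 0 < z.re + m →
    Tendsto (fun n : ℕ => Complex.Gamma (z + n) / ((n : ℂ) ^ (z - 1) * n.factorial))
    atTop (𝓝 1) := by
  induction m with
  | zero =>
    intro z hz
    have hz : 0 < z.re := by simpa using hz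
    have h0 := Complex.Gamma_ne_zero (ne_neg_nat_of_re_pos hz)
    have h1 := (poch_asymp z).mul_const (Complex.Gamma z)
    rw [inv_mul_cancel₀ h0] at h1
    refine h1.congr fun n => ?_
    rw [Gamma_add_nat z (ne_neg_nat_of_re_pos hz)]; ring
  | succ m ih =>
    intro z hz
    have h1 := (ih (z + 1) (by simp; push_cast at hz; linarith)).mul (tendsto_nat_div z)
    rw [mul_one] at h1
    refine h1.congr' ?_
    filter_upwards [eventually_ne_atTop 0, eventually_add_ne z] with n hn hzn
    have hn' : (n : ℂ) ≠ 0 := by exact_mod_cast hn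
    have e1 : Complex.Gamma (z + 1 + n) = (z + n) * Complex.Gamma (z + n) := by
      rw [← Complex.Gamma_add_one _ hzn]; congr 1; ring
    rw [e1, add_sub_cancel_right, Complex.cpow_sub _ _ hn', Complex.cpow_one]
    have : (n:ℂ)^z ≠ 0 := by simp [Complex.cpow_eq_zero_iff, hn']
    have : (n.factorial : ℂ) ≠ 0 := by exact_mod_cast n.factorial_ne_zero
    field_simp

lemma Gamma_asymp (z : ℂ) :
    Tendsto (fun n : ℕ => Complex.Gamma (z + n) / ((n : ℂ) ^ (z - 1) * n.factorial))
    atTop (𝓝 1) := by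
  obtain ⟨m, hm⟩ := exists_nat_gt (-z.re)
  exact Gamma_asymp_aux m z (by linarith)

/-- coefficients -/
noncomputable def hc (a b c : ℂ) (n : ℕ) : ℂ :=
  poch a n * poch b n / (Complex.Gamma (c + n) * (n.factorial : ℂ))

lemma hyp_eq (a b c z : ℂ) : hyp2F1reg a b c z = ∑' n, hc a b c n * z ^ n := rfl

lemma hc_asymp (a b c : ℂ) : Tendsto (fun n : ℕ => hc a b c n / (n : ℂ) ^ (a + b - c - 1))
    atTop (𝓝 ((Complex.Gamma a)⁻¹ * (Complex.Gamma b)⁻¹)) := by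
  have h := ((poch_asymp a).mul (poch_asymp b)).mul ((Gamma_asymp c).inv₀ one_ne_zero)
  rw [inv_one, mul_one] at h
  refine h.congr' ?_
  filter_upwards [eventually_ne_atTop 0] with n hn
  have hn' : (n : ℂ) ≠ 0 := by exact_mod_cast hn
  have h3 : (n.factorial : ℂ) ≠ 0 := by exact_mod_cast n.factorial_ne_zero
  have ha : (n:ℂ)^a ≠ 0 := by simp [Complex.cpow_eq_zero_iff, hn']
  have hb : (n:ℂ)^b ≠ 0 := by simp [Complex.cpow_eq_zero_iff, hn']
  have hcc : (n:ℂ)^c ≠ 0 := by simp [Complex.cpow_eq_zero_iff, hn']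
  simp only [hc, Complex.cpow_sub _ _ hn', Complex.cpow_add _ _ hn', Complex.cpow_one]
  by_cases hG : Complex.Gamma (c + n) = 0
  · simp [hG]
  field_simp

lemma bound_of_asymp {f : ℕ → ℂ} {e L : ℂ}
    (h : Tendsto (fun n : ℕ => f n / (n : ℂ) ^ e) atTop (𝓝 L)) :
    ∃ C : ℝ, 0 < C ∧ ∀ n, ‖f n‖ ≤ C * ((n : ℝ) + 1) ^ e.re := by
  obtain ⟨K, hK⟩ := (h.norm.bddAbove_range)
  have hK' : ∀ n, ‖f n / (n : ℂ) ^ e‖ ≤ K := fun n => hK ⟨n, rfl⟩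
  have hK0 : 0 ≤ K := (norm_nonneg _).trans (hK' 0)
  refine ⟨K * 2 ^ |e.re| + ‖f 0‖ + 1, by positivity, fun n => ?_⟩
  rcases Nat.eq_zero_or_pos n with rfl | hn
  · simp; nlinarith [norm_nonneg (f 0), show 0 ≤ K * 2 ^ |e.re| by positivity]
  have hnr : (0:ℝ) < n := by exact_mod_cast hn
  have hn1 : (1:ℝ) ≤ n := by exact_mod_cast hn
  have h1 := hK' n
  rw [norm_div, Complex.norm_natCast_cpow_of_pos hn, div_le_iff₀ (by positivity)] at h1
  have h2 : (n:ℝ) ^ e.re ≤ 2 ^ |e.re| * ((n:ℝ) + 1) ^ e.re := by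
    rcases le_total 0 e.re with he | he
    · have : (n:ℝ) ^ e.re ≤ ((n:ℝ) + 1) ^ e.re :=
        Real.rpow_le_rpow hnr.le (by linarith) he
      have h3 : (1:ℝ) ≤ 2 ^ |e.re| := Real.one_le_rpow (by norm_num) (abs_nonneg _)
      nlinarith [show 0 ≤ ((n:ℝ) + 1) ^ e.re by positivity]
    · rw [abs_of_nonpos he]
      have : (n:ℝ) ^ e.re ≤ (((n:ℝ) + 1) / 2) ^ e.re :=
        Real.rpow_le_rpow_of_nonpos (by positivity) (by linarith) he
      rw [Real.div_rpow (by positivity) (by norm_num)] at this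
      rw [Real.rpow_neg (by norm_num)]
      calc _ ≤ _ := this
        _ = _ := by ring
  calc ‖f n‖ ≤ _ := h1
    _ ≤ K * (2 ^ |e.re| * ((n:ℝ) + 1) ^ e.re) := by gcongr
    _ ≤ _ := by
      have : 0 ≤ ((n:ℝ) + 1) ^ e.re := by positivity
      nlinarith [norm_nonneg (f 0), mul_nonneg (norm_nonneg (f 0)) this]

lemma hc_bound (a b c : ℂ) : ∃ C : ℝ, 0 < C ∧ ∀ n, ‖hc a b c n‖ ≤
    C * ((n : ℝ) + 1) ^ ((a + b - c - 1).re) := bound_of_asymp (hc_asymp a b c)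

/-- polynomially bounded -/
def PB (f : ℕ → ℂ) : Prop := ∃ C : ℝ, ∃ k : ℕ, 0 ≤ C ∧ ∀ n, ‖f n‖ ≤ C * ((n : ℝ) + 1) ^ k

lemma hc_PB (a b c : ℂ) : PB (hc a b c) := by
  obtain ⟨C, hC, h⟩ := hc_bound a b c
  obtain ⟨k, hk⟩ := exists_nat_ge ((a + b - c - 1).re)
  refine ⟨C, k, hC.le, fun n => (h n).trans ?_⟩
  gcongr
  rw [← Real.rpow_natCast]
  exact Real.rpow_le_rpow_of_exponent_le (by linarith [Nat.cast_nonneg (α := ℝ) n]) hk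

lemma PB.deriv {f : ℕ → ℂ} (hf : PB f) : PB (fun n => ((n : ℂ) + 1) * f (n + 1)) := by
  obtain ⟨C, k, hC, h⟩ := hf
  refine ⟨C * 2 ^ k, k + 1, by positivity, fun n => ?_⟩
  have h1 := h (n + 1)
  have hn : (0:ℝ) ≤ n := Nat.cast_nonneg n
  rw [norm_mul]
  have : ‖(n : ℂ) + 1‖ = (n:ℝ) + 1 := by
    have : ((n:ℂ) + 1) = ((n + 1 : ℕ) : ℂ) := by push_cast; rfl
    rw [this, Complex.norm_natCast]; push_cast; rfl
  rw [this]
  calc ((n:ℝ) + 1) * ‖f (n + 1)‖ ≤ ((n:ℝ) + 1) * (C * (((n + 1 : ℕ):ℝ) + 1) ^ k) := by gcongr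
    _ ≤ ((n:ℝ) + 1) * (C * (2 * ((n:ℝ) + 1)) ^ k) := by gcongr; push_cast; linarith
    _ = _ := by rw [mul_pow]; ring

lemma summable_poly (k : ℕ) {r : ℝ} (hr0 : 0 ≤ r) (hr : r < 1) :
    Summable (fun n : ℕ => ((n:ℝ) + 1) ^ k * r ^ n) := by
  rcases hr0.eq_or_lt with rfl | hr0
  · refine summable_of_ne_finset_zero (s := {0}) fun n hn => ?_
    simp at hn; simp [hn]
  have h := summable_pow_mul_geometric_of_norm_lt_one (R := ℝ) k (r := r)
    (by rwa [Real.norm_of_nonneg hr0.le])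
  have h2 := ((summable_nat_add_iff 1).2 h).mul_right r⁻¹
  refine h2.congr fun n => ?_
  push_cast; rw [pow_succ]; field_simp

lemma PB.summable_norm {f : ℕ → ℂ} (hf : PB f) {r : ℝ} (hr0 : 0 ≤ r) (hr : r < 1) :
    Summable (fun n => ‖f n‖ * r ^ n) := by
  obtain ⟨C, k, hC, h⟩ := hf
  refine Summable.of_nonneg_of_le (fun n => by positivity) (fun n => ?_)
    ((summable_poly k hr0 hr).mul_left C)
  rw [← mul_assoc]
  gcongr; exact h n

lemma PB.summable {f : ℕ → ℂ} (hf : PB f) {z : ℂ} (hz : ‖z‖ < 1) :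
    Summable (fun n => f n * z ^ n) := by
  refine Summable.of_norm ?_
  simpa [norm_mul, norm_pow] using hf.summable_norm (norm_nonneg z) hz

lemma PB.hasDerivAt {f : ℕ → ℂ} (hf : PB f) {z : ℂ} (hz : ‖z‖ < 1) :
    HasDerivAt (fun z => ∑' n, f n * z ^ n) (∑' n : ℕ, (((n : ℂ) + 1) * f (n + 1)) * z ^ n) z := by
  obtain ⟨r, hzr, hr1⟩ := exists_between hz
  have hr0 : 0 ≤ r := (norm_nonneg z).trans hzr.le
  have hs0 : Summable (fun n : ℕ => ‖((n : ℂ) + 1) * f (n + 1)‖ * r ^ n) :=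
    hf.deriv.summable_norm hr0 hr1
  have hs1 : Summable (fun n : ℕ => ‖(n:ℂ) * f n‖ * r ^ (n - 1)) := by
    rw [← summable_nat_add_iff 1]
    refine hs0.congr fun n => ?_
    push_cast; simp
  have key := hasDerivAt_tsum_of_isPreconnected (𝕜 := ℂ) (t := Metric.ball (0:ℂ) r)
    (g := fun n z => f n * z ^ n) (g' := fun n z => f n * ((n:ℂ) * z ^ (n - 1))) (y₀ := z) (y := z)
    hs1 Metric.isOpen_ball (convex_ball (0:ℂ) r).isPreconnected
    (fun n y hy => by simpa using (hasDerivAt_pow n y).const_mul (f n))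
    (fun n y hy => by
      have hy' : ‖y‖ < r := by simpa using hy
      simp only [norm_mul, norm_pow]
      rw [show ‖f n‖ * (‖(n:ℂ)‖ * ‖y‖ ^ (n - 1)) = ‖(n:ℂ)‖ * ‖f n‖ * ‖y‖ ^ (n - 1) by ring]
      gcongr)
    (by simpa using hzr) (hf.summable hz) (by simpa using hzr)
  have hs2 : Summable (fun n : ℕ => f n * ((n:ℂ) * z ^ (n - 1))) := by
    rw [← summable_nat_add_iff 1]
    refine (hf.deriv.summable hz).congr fun n => ?_
    push_cast; ring
  rw [hs2.tsum_eq_zero_add] at key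
  have e : ∑' n : ℕ, (((n : ℂ) + 1) * f (n + 1)) * z ^ n = f 0 * (((0:ℕ):ℂ) * z ^ (0 - 1)) +
      ∑' n : ℕ, f (n + 1) * (((n + 1 : ℕ):ℂ) * z ^ (n + 1 - 1)) := by
    simp only [Nat.cast_zero, zero_mul, mul_zero, zero_add]
    refine tsum_congr fun n => ?_
    push_cast; ring
  rw [e]; exact key

end NF

namespace NF
open Filter Topology

lemma hc_succ_c (a b c : ℂ) (n : ℕ) : hc a b c n = (c + n) * hc a b (c + 1) n := by
  unfold hc
  have h := Complex.one_div_Gamma_eq_self_mul_one_div_Gamma_add_one (c + n)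
  rw [show c + n + 1 = c + 1 + n by ring] at h
  have e : ∀ p g q : ℂ, p / (g * q) = p * g⁻¹ / q := by intros; field_simp
  simp only [e]
  rw [h]; ring

lemma hc_succ_n (a b c : ℂ) (n : ℕ) :
    ((n : ℂ) + 1) * hc a b c (n + 1) = (a + n) * (b + n) * hc a b (c + 1) n := by
  unfold hc
  rw [poch_succ, poch_succ, Nat.factorial_succ]
  have h3 : (n.factorial : ℂ) ≠ 0 := by exact_mod_cast n.factorial_ne_zero
  have h4 : (n : ℂ) + 1 ≠ 0 := by exact_mod_cast n.succ_ne_zero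
  push_cast
  rw [show c + (n + 1) = c + 1 + (n:ℂ) by ring]
  field_simp

lemma hs_congr {f g : ℕ → ℂ} {s : ℂ} (h : HasSum f s) (e : ∀ n, g n = f n) : HasSum g s := by
  have : g = f := funext e
  rwa [this]

lemma hyp_hasSum (a b c : ℂ) {z : ℂ} (hz : ‖z‖ < 1) :
    HasSum (fun n => hc a b c n * z ^ n) (hyp2F1reg a b c z) :=
  ((hc_PB a b c).summable hz).hasSum

lemma hyp_deriv (a b c : ℂ) {z : ℂ} (hz : ‖z‖ < 1) :
    ∃ D, HasDerivAt (hyp2F1reg a b c) D z ∧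
      z * D = hyp2F1reg a b (c - 1) z - (c - 1) * hyp2F1reg a b c z ∧
      (1 - z) * D = (a + b - c) * hyp2F1reg a b c z +
        (c - a) * (c - b) * hyp2F1reg a b (c + 1) z := by
  have hD := (hc_PB a b c).hasDerivAt hz
  have hDs := ((hc_PB a b c).deriv.summable hz).hasSum
  refine ⟨_, hD, ?_, ?_⟩
  · have h1 : HasSum (fun n : ℕ => (n : ℂ) * hc a b c n * z ^ n)
        (z * ∑' n : ℕ, (((n : ℂ) + 1) * hc a b c (n + 1)) * z ^ n) := by
      rw [← hasSum_nat_add_iff' 1]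
      simp only [Finset.range_one, Finset.sum_singleton, Nat.cast_zero, zero_mul, sub_zero]
      refine hs_congr (hDs.mul_left z) ?_
      intro n; push_cast; ring
    have h2 := (hyp_hasSum a b (c - 1) hz).sub ((hyp_hasSum a b c hz).mul_left (c - 1))
    refine h1.unique (hs_congr h2 fun n => ?_)
    rw [hc_succ_c a b (c - 1)]
    rw [sub_add_cancel]; ring
  · have h1 : HasSum (fun n : ℕ => (n : ℂ) * hc a b c n * z ^ n)
        (z * ∑' n : ℕ, (((n : ℂ) + 1) * hc a b c (n + 1)) * z ^ n) := by
      rw [← hasSum_nat_add_iff' 1]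
      simp only [Finset.range_one, Finset.sum_singleton, Nat.cast_zero, zero_mul, sub_zero]
      refine hs_congr (hDs.mul_left z) ?_
      intro n; push_cast; ring
    have h2 := hDs.sub h1
    have h3 := ((hyp_hasSum a b c hz).mul_left (a + b - c)).add
      ((hyp_hasSum a b (c + 1) hz).mul_left ((c - a) * (c - b)))
    rw [sub_mul, one_mul]
    refine h2.unique (hs_congr h3 fun n => ?_)
    rw [hc_succ_n, hc_succ_c a b c]
    ring

lemma hyp_zero_half_rec (a b c : ℂ) (hab : a + b = 1) :
    hyp2F1reg a b (c - 1) (1 / 2) = (c - a) * (c - b) * hyp2F1reg a b (c + 1) (1 / 2) := by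
  obtain ⟨D, -, h1, h2⟩ := hyp_deriv a b c (z := 1 / 2) (by norm_num)
  have : (1 - 1 / 2 : ℂ) * D = 1 / 2 * D := by ring
  rw [this, h1, hab] at h2
  linear_combination h2

end NF

namespace NF
open Filter Topology

/-- derivative of ferrersP -/
noncomputable def ferPd (ν μ : ℂ) (x : ℝ) : ℂ :=
  -((1 - (x : ℂ)) / (1 + (x : ℂ))) ^ (μ / 2) *
    (μ * x / (1 - (x:ℂ)^2) * hyp2F1reg (-ν) (ν + 1) (1 + μ) ((1 - (x : ℂ)) / 2)
     + (1 + μ + ν) * (μ - ν) / (1 + x) * hyp2F1reg (-ν) (ν + 1) (1 + μ + 1) ((1 - (x : ℂ)) / 2))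

noncomputable def cA (x : ℝ) : ℂ := 2 * x / (1 - (x:ℂ)^2)
noncomputable def cB (ν μ : ℂ) (x : ℝ) : ℂ :=
  -(ν * (ν + 1) - μ ^ 2 / (1 - (x:ℂ)^2)) / (1 - (x:ℂ)^2)

lemma one_sub_ne {x : ℝ} (h1 : -1 < x) (h2 : x < 1) : (1 - (x:ℂ)) ≠ 0 := by
  intro h; have : ((1 - x : ℝ) : ℂ) = 0 := by push_cast; exact h
  rw [Complex.ofReal_eq_zero] at this; linarith
lemma one_add_ne {x : ℝ} (h1 : -1 < x) (h2 : x < 1) : (1 + (x:ℂ)) ≠ 0 := by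
  intro h; have : ((1 + x : ℝ) : ℂ) = 0 := by push_cast; exact h
  rw [Complex.ofReal_eq_zero] at this; linarith
lemma one_sub_sq_ne {x : ℝ} (h1 : -1 < x) (h2 : x < 1) : (1 - (x:ℂ)^2) ≠ 0 := by
  have := mul_ne_zero (one_sub_ne h1 h2) (one_add_ne h1 h2)
  intro h; apply this; linear_combination h

lemma fer_E_deriv (μ : ℂ) {x : ℝ} (h1 : -1 < x) (h2 : x < 1) :
    HasDerivAt (fun x : ℝ => ((1 - (x : ℂ)) / (1 + (x : ℂ))) ^ (μ / 2))
      (-μ / (1 - (x:ℂ)^2) * ((1 - (x : ℂ)) / (1 + (x : ℂ))) ^ (μ / 2)) x := by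
  have hm := one_sub_ne h1 h2
  have hp := one_add_ne h1 h2
  have hs := one_sub_sq_ne h1 h2
  have hq : ((1 - (x : ℂ)) / (1 + (x : ℂ))) ∈ Complex.slitPlane := by
    left
    have : ((1 - (x : ℂ)) / (1 + (x : ℂ))) = (((1 - x) / (1 + x) : ℝ) : ℂ) := by push_cast; rfl
    rw [this, Complex.ofReal_re]
    exact div_pos (by linarith) (by linarith)
  have hq0 := Complex.slitPlane_ne_zero hq
  have hd : HasDerivAt (fun z : ℂ => (1 - z) / (1 + z)) (-2 / (1 + (x:ℂ))^2) (x:ℂ) := by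
    have := ((hasDerivAt_const (x:ℂ) (1:ℂ)).sub (hasDerivAt_id (x:ℂ))).div
      ((hasDerivAt_const (x:ℂ) (1:ℂ)).add (hasDerivAt_id (x:ℂ))) hp
    refine this.congr_deriv ?_
    simp
    ring
  have := (hd.cpow_const (c := μ / 2) hq).comp_ofReal
  refine this.congr_deriv ?_
  rw [Complex.cpow_sub _ _ hq0, Complex.cpow_one]
  field_simp
  ring

lemma fer_F_deriv (ν c : ℂ) {x : ℝ} (h1 : -1 < x) (h2 : x < 1) :
    ∃ D, HasDerivAt (fun x : ℝ => hyp2F1reg (-ν) (ν + 1) c ((1 - (x : ℂ)) / 2)) D x ∧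
      (1 - (x:ℂ)) * D = -(hyp2F1reg (-ν) (ν + 1) (c - 1) ((1 - (x : ℂ)) / 2) -
        (c - 1) * hyp2F1reg (-ν) (ν + 1) c ((1 - (x : ℂ)) / 2)) ∧
      (1 + (x:ℂ)) * D = -((1 - c) * hyp2F1reg (-ν) (ν + 1) c ((1 - (x : ℂ)) / 2) +
        (c + ν) * (c - ν - 1) * hyp2F1reg (-ν) (ν + 1) (c + 1) ((1 - (x : ℂ)) / 2)) := by
  have hz : ‖(1 - (x : ℂ)) / 2‖ < 1 := by
    have : (1 - (x : ℂ)) / 2 = (((1 - x) / 2 : ℝ) : ℂ) := by push_cast; rfl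
    rw [this, Complex.norm_real, Real.norm_eq_abs, abs_lt]; constructor <;> linarith
  obtain ⟨D, hD, e1, e2⟩ := hyp_deriv (-ν) (ν + 1) c hz
  have hd : HasDerivAt (fun z : ℂ => (1 - z) / 2) (-1 / 2) (x:ℂ) := by
    have := ((hasDerivAt_const (x:ℂ) (1:ℂ)).sub (hasDerivAt_id (x:ℂ))).div_const 2
    exact this.congr_deriv (by simp)
  refine ⟨D * (-1/2), (HasDerivAt.comp (h₂ := hyp2F1reg (-ν) (ν + 1) c) (x:ℂ) hD hd).comp_ofReal, ?_, ?_⟩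
  · linear_combination (-1) * e1
  · linear_combination (-1) * e2

lemma ferP_deriv (ν μ : ℂ) {x : ℝ} (h1 : -1 < x) (h2 : x < 1) :
    HasDerivAt (fun x => ferrersP ν μ x) (ferPd ν μ x) x := by
  have hm := one_sub_ne h1 h2
  have hp := one_add_ne h1 h2
  have hs := one_sub_sq_ne h1 h2
  obtain ⟨D, hD, e1, e2⟩ := fer_F_deriv ν (1 + μ) h1 h2
  refine ((fer_E_deriv μ h1 h2).mul hD).congr_deriv ?_
  replace e2 := (eq_div_iff hp).2 ((mul_comm _ _).trans e2)
  rw [e2]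
  unfold ferPd
  have : (1 - (x:ℂ)^2) = (1 - x) * (1 + x) := by ring
  simp only [this]
  field_simp
  ring

lemma ferPd_deriv (ν μ : ℂ) {x : ℝ} (h1 : -1 < x) (h2 : x < 1) :
    HasDerivAt (fun x => ferPd ν μ x) (cA x * ferPd ν μ x + cB ν μ x * ferrersP ν μ x) x := by
  have hm := one_sub_ne h1 h2
  have hp := one_add_ne h1 h2
  have hs := one_sub_sq_ne h1 h2
  obtain ⟨D, hD, -, e2⟩ := fer_F_deriv ν (1 + μ) h1 h2
  obtain ⟨D', hD', e1, -⟩ := fer_F_deriv ν (1 + μ + 1) h1 h2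
  have hx : HasDerivAt (fun x : ℝ => (x : ℂ)) 1 x := Complex.ofRealCLM.hasDerivAt
  have hA : HasDerivAt (fun x : ℝ => μ * x / (1 - (x:ℂ)^2))
      (μ * (1 + x^2) / (1 - (x:ℂ)^2)^2) x := by
    refine ((hx.const_mul μ).div ((hx.fun_pow 2).const_sub 1) hs).congr_deriv ?_
    congr 1; push_cast; ring
  have hB : HasDerivAt (fun x : ℝ => (1 + μ + ν) * (μ - ν) / (1 + (x:ℂ)))
      (-(1 + μ + ν) * (μ - ν) / (1 + (x:ℂ))^2) x := by
    refine ((hasDerivAt_const x ((1 + μ + ν) * (μ - ν))).div (hx.const_add 1) hp).congr_deriv ?_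
    congr 1; ring
  refine ((fer_E_deriv μ h1 h2).neg.mul ((hA.mul hD).add (hB.mul hD'))).congr_deriv ?_
  replace e2 := (eq_div_iff hp).2 ((mul_comm _ _).trans e2)
  replace e1 := (eq_div_iff hm).2 ((mul_comm _ _).trans e1)
  rw [e2, e1]
  simp only [Pi.neg_apply, Pi.mul_apply, Pi.add_apply]
  unfold ferPd ferrersP cA cB
  have : (1 - (x:ℂ)^2) = (1 - x) * (1 + x) := by ring
  simp only [this, add_sub_cancel_right]
  field_simp
  ring

end NF

namespace NF
open Filter Topology

lemma norm_add_nat_ge {z : ℂ} {σ : ℝ} (hσ : 0 < σ) (hz : σ ≤ z.re) (j : ℕ) :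
    σ + j ≤ ‖z + j‖ := by
  refine le_trans ?_ (Complex.re_le_norm _)
  simp; exact hz

lemma poch_norm_ge {z : ℂ} {σ : ℝ} (hσ : 0 < σ) (hz : σ ≤ z.re) (n : ℕ) :
    ‖poch σ n‖ ≤ ‖poch z n‖ := by
  rw [poch_eq_prod, poch_eq_prod, norm_prod, norm_prod]
  refine Finset.prod_le_prod (fun _ _ => norm_nonneg _) fun j _ => ?_
  refine le_trans (le_of_eq ?_) (norm_add_nat_ge hσ hz j)
  have : (σ:ℂ) + j = ((σ + j : ℝ) : ℂ) := by push_cast; rfl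
  rw [this, Complex.norm_real, Real.norm_eq_abs, abs_of_pos]
  positivity

lemma poch_ne_zero {z : ℂ} (hz : 0 < z.re) (n : ℕ) : poch z n ≠ 0 := by
  rw [poch_eq_prod]
  refine Finset.prod_ne_zero_iff.2 fun j _ h => ?_
  exact ne_neg_nat_of_re_pos hz j (by linear_combination h)

lemma hc_mul_Gamma (a b : ℂ) {c : ℂ} (hc0 : 0 < c.re) (n : ℕ) :
    hc a b c n * Complex.Gamma c = poch a n * poch b n / (poch c n * n.factorial) := by
  unfold hc
  have h1 := Complex.Gamma_ne_zero_of_re_pos hc0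
  rw [Gamma_add_nat c (ne_neg_nat_of_re_pos hc0)]
  have h2 := poch_ne_zero hc0 n
  have h3 : (n.factorial : ℂ) ≠ 0 := by exact_mod_cast n.factorial_ne_zero
  field_simp

lemma hyp_mul_Gamma_tendsto (a b c z : ℂ) (σ : ℝ) (hσ : 0 < σ)
    (hs : Summable (fun n => ‖hc a b σ n‖ * ‖z‖ ^ n)) :
    Tendsto (fun M : ℕ => hyp2F1reg a b (c + M) z * Complex.Gamma (c + M)) atTop (𝓝 1) := by
  have hσ' : 0 < (σ : ℂ).re := by simpa using hσ
  have key : Tendsto (fun M : ℕ => ∑' n, hc a b (c + M) n * Complex.Gamma (c + M) * z ^ n) atTop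
      (𝓝 (∑' n : ℕ, if n = 0 then (1:ℂ) else 0)) := by
    obtain ⟨M0, hM0⟩ := exists_nat_gt (σ - c.re)
    refine tendsto_tsum_of_dominated_convergence
      (bound := fun n => ‖Complex.Gamma σ‖ * (‖hc a b σ n‖ * ‖z‖ ^ n)) (hs.mul_left _) ?_ ?_
    · intro n
      rcases n with _ | n
      · simp only [if_true]
        refine tendsto_const_nhds.congr' ?_
        filter_upwards [eventually_ge_atTop M0] with M hM
        have : 0 < (c + M).re := by
          simp
          have : (M0:ℝ) ≤ M := by exact_mod_cast hM
          linarith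
        rw [hc_mul_Gamma a b this]; simp [poch_zero]
      · simp only [Nat.add_eq_zero_iff, one_ne_zero, and_false, if_false]
        rw [tendsto_zero_iff_norm_tendsto_zero]
        have hlim : Tendsto (fun M : ℕ => ‖Complex.Gamma σ‖ * (‖hc a b σ (n+1)‖ * ‖z‖ ^ (n+1)) *
            σ * ‖(c + M)‖⁻¹) atTop (𝓝 0) := by
          have : Tendsto (fun M : ℕ => ‖(c + M)‖⁻¹) atTop (𝓝 0) := by
            apply tendsto_inv_atTop_zero.comp
            refine tendsto_atTop_mono (fun M => Complex.re_le_norm _) ?_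
            simp only [Complex.add_re, Complex.natCast_re]
            exact tendsto_atTop_add_const_left _ _ tendsto_natCast_atTop_atTop
          simpa using this.const_mul (‖Complex.Gamma σ‖ * (‖hc a b σ (n+1)‖ * ‖z‖ ^ (n+1)) * σ)
        refine squeeze_zero' (Eventually.of_forall fun _ => norm_nonneg _) ?_ hlim
        filter_upwards [eventually_ge_atTop M0] with M hM
        have hMr : σ ≤ (c + M).re := by
          simp
          have : (M0:ℝ) ≤ M := by exact_mod_cast hM
          linarith
        have hpos : 0 < (c + M).re := hσ.trans_le hMr
        have e1 := hc_mul_Gamma a b hpos (n+1)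
        have e2 := hc_mul_Gamma a b hσ' (n+1)
        have e3 : ‖Complex.Gamma σ‖ * (‖hc a b σ (n+1)‖ * ‖z‖ ^ (n+1)) =
          ‖hc a b σ (n+1) * Complex.Gamma σ‖ * ‖z‖ ^ (n+1) := by rw [norm_mul]; ring
        rw [e3, e1, e2, norm_mul, norm_pow, norm_div, norm_div, norm_mul (poch σ _),
          norm_mul (poch (c+M) _), poch_succ_left σ, poch_succ_left (c + M), norm_mul (σ:ℂ),
          norm_mul (c + M)]
        have h1 : ‖poch ((σ:ℂ) + 1) n‖ ≤ ‖poch (c + M + 1) n‖ := by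
          have := poch_norm_ge (z := c + M + 1) (σ := σ + 1) (by linarith) (by
            rw [Complex.add_re, Complex.one_re]; linarith) n
          simpa using this
        have h2 : 0 < ‖poch ((σ:ℂ) + 1) n‖ := norm_pos_iff.2 (poch_ne_zero (by simp; linarith) n)
        have h3 : 0 < ‖c + M‖ := lt_of_lt_of_le hpos (Complex.re_le_norm _)
        have h4 : 0 < ‖((n+1).factorial : ℂ)‖ := by
          rw [norm_pos_iff]; exact_mod_cast (n+1).factorial_ne_zero
        have h5 : ‖(σ:ℂ)‖ = σ := by rw [Complex.norm_real, Real.norm_eq_abs, abs_of_pos hσ]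
        rw [h5]
        have : ‖poch a (n + 1) * poch b (n + 1)‖ / (‖c + ↑M‖ * ‖poch (c + ↑M + 1) n‖ * ‖((n + 1).factorial:ℂ)‖) * ‖z‖ ^ (n + 1)
          ≤ ‖poch a (n + 1) * poch b (n + 1)‖ / (‖c + ↑M‖ * ‖poch ((σ:ℂ) + 1) n‖ * ‖((n + 1).factorial:ℂ)‖) * ‖z‖ ^ (n + 1) := by
          gcongr
        refine this.trans (le_of_eq ?_)
        field_simp
    · filter_upwards [eventually_ge_atTop M0] with M hM n
      have hMr : σ ≤ (c + M).re := by
        simp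
        have : (M0:ℝ) ≤ M := by exact_mod_cast hM
        linarith
      have hpos : 0 < (c + M).re := hσ.trans_le hMr
      have e1 := hc_mul_Gamma a b hpos n
      have e2 := hc_mul_Gamma a b hσ' n
      have e3 : ‖Complex.Gamma σ‖ * (‖hc a b σ n‖ * ‖z‖ ^ n) =
          ‖hc a b σ n * Complex.Gamma σ‖ * ‖z‖ ^ n := by rw [norm_mul]; ring
      rw [e3, e1, e2, norm_mul, norm_pow, norm_div, norm_div, norm_mul (poch σ _),
          norm_mul (poch (c+M) _)]
      have h1 := poch_norm_ge hσ hMr n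
      have h2 : 0 < ‖poch (σ:ℂ) n‖ := norm_pos_iff.2 (poch_ne_zero hσ' n)
      have h4 : 0 < ‖(n.factorial : ℂ)‖ := by
          rw [norm_pos_iff]; exact_mod_cast n.factorial_ne_zero
      gcongr
  rw [tsum_ite_eq] at key
  refine key.congr fun M => ?_
  rw [hyp_eq, ← tsum_mul_right]
  congr 1; funext n; ring

lemma poch_ratio (x1 x2 y1 y2 : ℂ) (h : x1 + x2 = y1 + y2) :
    Tendsto (fun N : ℕ => poch x1 N * poch x2 N / (Complex.Gamma (y1 + N) * Complex.Gamma (y2 + N)))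
      atTop (𝓝 ((Complex.Gamma x1)⁻¹ * (Complex.Gamma x2)⁻¹)) := by
  have h0 := ((poch_asymp x1).mul (poch_asymp x2)).mul
    (((Gamma_asymp y1).mul (Gamma_asymp y2)).inv₀ (by norm_num))
  norm_num at h0
  refine h0.congr' ?_
  filter_upwards [eventually_gt_atTop 0] with n hn
  have hn' : (n:ℂ) ≠ 0 := by exact_mod_cast hn.ne'
  have hf : (n.factorial : ℂ) ≠ 0 := by exact_mod_cast n.factorial_ne_zero
  have e1 : ∀ w : ℂ, (n:ℂ) ^ w ≠ 0 := fun w => by simp [Complex.cpow_eq_zero_iff, hn']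
  have e2 : (n:ℂ) ^ (x1 - 1) * (n:ℂ) ^ (x2 - 1) = (n:ℂ) ^ (y1 - 1) * (n:ℂ) ^ (y2 - 1) := by
    rw [← Complex.cpow_add _ _ hn', ← Complex.cpow_add _ _ hn']; congr 1; linear_combination h
  have a1 := e1 (x1 - 1); have a2 := e1 (x2 - 1); have a3 := e1 (y1 - 1); have a4 := e1 (y2 - 1)
  calc _ = poch x1 n * poch x2 n * (((n:ℂ) ^ (y1 - 1) * (n:ℂ) ^ (y2 - 1)) /
      ((n:ℂ) ^ (x1 - 1) * (n:ℂ) ^ (x2 - 1))) * (Complex.Gamma (y1 + n) * Complex.Gamma (y2 + n))⁻¹ := by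
        simp only [div_eq_mul_inv, mul_inv, inv_inv]
        field_simp
    _ = _ := by rw [e2, div_self (mul_ne_zero a3 a4), mul_one, div_eq_mul_inv]

lemma half_iter (ν c : ℂ) (N : ℕ) : hyp2F1reg (-ν) (ν + 1) c (1 / 2) =
    4 ^ N * poch ((c + 1 + ν) / 2) N * poch ((c - ν) / 2) N *
      hyp2F1reg (-ν) (ν + 1) (c + (2 * N : ℕ)) (1 / 2) := by
  induction N with
  | zero => simp [poch_zero]
  | succ N ih =>
    rw [ih, poch_succ, poch_succ]
    have := hyp_zero_half_rec (-ν) (ν + 1) (c + (2 * N : ℕ) + 1) (by ring)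
    rw [add_sub_cancel_right] at this
    rw [this]
    push_cast
    rw [show c + 2 * (N:ℂ) + 1 + 1 = c + 2 * (N + 1) by ring]
    ring

lemma half_value (ν c : ℂ) : hyp2F1reg (-ν) (ν + 1) c (1 / 2) =
    2 ^ (1 - c) * (Real.sqrt Real.pi : ℂ) *
      ((Complex.Gamma ((c + 1 + ν) / 2))⁻¹ * (Complex.Gamma ((c - ν) / 2))⁻¹) := by
  have hs : Summable (fun n => ‖hc (-ν) (ν + 1) ((1:ℝ):ℂ) n‖ * ‖(1/2:ℂ)‖ ^ n) :=
    (hc_PB _ _ _).summable_norm (by norm_num) (by norm_num)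
  have h1 := hyp_mul_Gamma_tendsto (-ν) (ν+1) c (1/2) 1 one_pos hs
  have h2 : Tendsto (fun N : ℕ => 2 * N) atTop atTop :=
    tendsto_id.const_mul_atTop' (by norm_num)
  have h3 := (h1.comp h2).mul (poch_ratio ((c + 1 + ν) / 2) ((c - ν) / 2) (c / 2) (c / 2 + 1 / 2)
    (by ring))
  have h4 := h3.const_mul (2 ^ (1 - c) * (Real.sqrt Real.pi : ℂ))
  rw [one_mul] at h4
  refine tendsto_nhds_unique (tendsto_const_nhds.congr' ?_) h4
  filter_upwards [eventually_gt_atTop 0, h2.eventually (h1.eventually (isOpen_ne.mem_nhds one_ne_zero))]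
    with N hN hne
  have hG : Complex.Gamma (c + (2 * N : ℕ)) ≠ 0 := right_ne_zero_of_mul hne
  have hd := Complex.Gamma_mul_Gamma_add_half (c / 2 + N)
  rw [show 2 * (c / 2 + N) = c + (2 * N : ℕ) by push_cast; ring] at hd
  have hd' : Complex.Gamma (c / 2 + N) * Complex.Gamma (c / 2 + 1 / 2 + N) =
     Complex.Gamma (c + (2 * N : ℕ)) * (2 ^ (1 - c) / 4 ^ N) * (Real.sqrt Real.pi : ℂ) := by
    rw [show c / 2 + 1 / 2 + N = c / 2 + N + 1 / 2 by ring, hd]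
    congr 2
    rw [show 1 - (c + (2 * N : ℕ)) = (1 - c) - ((2 * N : ℕ) : ℂ) by ring,
      Complex.cpow_sub _ _ two_ne_zero, Complex.cpow_natCast, pow_mul]
    norm_num
  rw [hd']
  have p1 : (2:ℂ) ^ (1 - c) ≠ 0 := by simp [Complex.cpow_eq_zero_iff]
  have p2 : (Real.sqrt Real.pi : ℂ) ≠ 0 := by
    rw [Ne, Complex.ofReal_eq_zero]; positivity
  rw [half_iter ν c N]
  simp only [Function.comp]
  field_simp

/-- Gauss sum, `a = b`. -/
noncomputable def gs (a c : ℂ) (n : ℕ) : ℂ := hc a a c n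

lemma hc_summable (a b c : ℂ) (h : (a + b - c).re < 0) : Summable (fun n => ‖hc a b c n‖) := by
  obtain ⟨C, hC, hb⟩ := hc_bound a b c
  refine Summable.of_nonneg_of_le (fun _ => norm_nonneg _) hb (Summable.mul_left _ ?_)
  have := (Real.summable_nat_rpow (p := (a + b - c - 1).re)).2 (by simp at h ⊢; linarith)
  have := (summable_nat_add_iff 1).2 this
  simpa using this

lemma gauss_rec (a c : ℂ) (h : 0 < (c - 2 * a).re) :
    (c - 2 * a) * hyp2F1reg a a c 1 = (c - a) ^ 2 * hyp2F1reg a a (c + 1) 1 := by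
  have h1 : Summable (hc a a c) := (hc_summable a a c (by simp at h ⊢; linarith)).of_norm
  have h2 : Summable (hc a a (c+1)) := (hc_summable a a (c+1) (by simp at h ⊢; linarith)).of_norm
  have hs : HasSum (fun n => (c - 2 * a) * hc a a c n - (c - a) ^ 2 * hc a a (c + 1) n)
      ((c - 2 * a) * hyp2F1reg a a c 1 - (c - a) ^ 2 * hyp2F1reg a a (c + 1) 1) := by
    have e1 : hyp2F1reg a a c 1 = ∑' n, hc a a c n := by rw [hyp_eq]; simp
    have e2 : hyp2F1reg a a (c+1) 1 = ∑' n, hc a a (c+1) n := by rw [hyp_eq]; simp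
    rw [e1, e2]
    exact (h1.hasSum.mul_left _).sub (h2.hasSum.mul_left _)
  have htel : ∀ N, ∑ n ∈ Finset.range N, ((c - 2 * a) * hc a a c n - (c - a) ^ 2 * hc a a (c + 1) n)
      = -((N : ℂ) * hc a a c N) := by
    intro N
    induction N with
    | zero => simp
    | succ N ih =>
      rw [Finset.sum_range_succ, ih]
      have := hc_succ_n a a c N
      push_cast
      rw [this, hc_succ_c a a c N]
      ring
  have hz : Tendsto (fun N : ℕ => -((N : ℂ) * hc a a c N)) atTop (𝓝 0) := by
    obtain ⟨C, hC, hb⟩ := hc_bound a a c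
    rw [← neg_zero]
    refine Tendsto.neg ?_
    have hlim : Tendsto (fun N : ℕ => C * ((N : ℝ) + 1) ^ (-(c - 2 * a).re)) atTop (𝓝 0) := by
      have := ((tendsto_rpow_neg_atTop h).comp
        (tendsto_atTop_add_const_right _ (1:ℝ) tendsto_natCast_atTop_atTop)).const_mul C
      simpa [Function.comp_def] using this
    refine squeeze_zero_norm (fun N => ?_) hlim
    have hN : (0:ℝ) < (N:ℝ) + 1 := by positivity
    calc ‖(N:ℂ) * hc a a c N‖ = N * ‖hc a a c N‖ := by rw [norm_mul, Complex.norm_natCast]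
      _ ≤ ((N:ℝ)+1) * (C * ((N:ℝ)+1) ^ ((a + a - c - 1).re)) := by
          gcongr
          · linarith
          · exact hb N
      _ = C * ((N : ℝ) + 1) ^ (-(c - 2 * a).re) := by
          rw [show -(c - 2 * a).re = (a + a - c - 1).re + 1 by simp; ring, Real.rpow_add hN,
            Real.rpow_one]; ring
  have := tendsto_nhds_unique hs.tendsto_sum_nat (hz.congr fun N => (htel N).symm)
  exact sub_eq_zero.1 this

lemma gauss_sum (a c : ℂ) (h : 0 < (c - 2 * a).re) :
    hyp2F1reg a a c 1 = Complex.Gamma (c - 2 * a) * (Complex.Gamma (c - a))⁻¹ ^ 2 := by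
  have hit : ∀ N : ℕ, poch (c - 2 * a) N * hyp2F1reg a a c 1 =
      poch (c - a) N ^ 2 * hyp2F1reg a a (c + N) 1 := by
    intro N
    induction N with
    | zero => simp [poch_zero]
    | succ N ih =>
      have := gauss_rec a (c + N) (by simp at h ⊢; linarith [Nat.cast_nonneg (α := ℝ) N])
      rw [poch_succ, poch_succ, mul_right_comm, ih]
      push_cast
      rw [show c + ((N:ℂ) + 1) = c + N + 1 by ring]
      linear_combination poch (c - a) N ^ 2 * this
  have hσ : ∃ σ : ℝ, 0 < σ ∧ (a + a - σ).re < 0 := ⟨|2 * a.re| + 1, by positivity, by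
    simp; have := le_abs_self (2 * a.re); rw [abs_mul] at this; simp at this; linarith⟩
  obtain ⟨σ, hσ, hσ2⟩ := hσ
  have hl := hyp_mul_Gamma_tendsto a a c 1 σ hσ (by simpa using hc_summable a a σ hσ2)
  have hr := poch_ratio (c - a) (c - a) (c - 2 * a) c (by ring)
  have hP := (hl.mul hr).const_mul (Complex.Gamma (c - 2 * a))
  have hgoal : Complex.Gamma (c - 2 * a) * (Complex.Gamma (c - a))⁻¹ ^ 2 =
     Complex.Gamma (c - 2 * a) * (1 * ((Complex.Gamma (c - a))⁻¹ * (Complex.Gamma (c - a))⁻¹)) := by ring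
  rw [hgoal]
  refine tendsto_nhds_unique (tendsto_const_nhds.congr' ?_) hP
  filter_upwards [hl.eventually (isOpen_ne.mem_nhds one_ne_zero)] with N hne
  have hG : Complex.Gamma (c + N) ≠ 0 := right_ne_zero_of_mul hne
  rw [Gamma_add_nat _ (ne_neg_nat_of_re_pos h)]
  have h1 := poch_ne_zero h N
  have h2 := Complex.Gamma_ne_zero_of_re_pos h
  field_simp
  linear_combination hit N

end NF

namespace NF
open Filter Topology

lemma sqpi_sq : (Real.sqrt Real.pi : ℂ) ^ 2 = Real.pi := by
  rw [← Complex.ofReal_pow, Real.sq_sqrt Real.pi_pos.le]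

lemma sqpi_ne : (Real.sqrt Real.pi : ℂ) ≠ 0 := by
  rw [Ne, Complex.ofReal_eq_zero]; positivity

lemma pi_ne : (Real.pi : ℂ) ≠ 0 := by
  rw [Ne, Complex.ofReal_eq_zero]; exact Real.pi_ne_zero

lemma refl_inv (z : ℂ) : (Complex.Gamma z)⁻¹ * (Complex.Gamma (1 - z))⁻¹ =
    Complex.sin (Real.pi * z) / Real.pi := by
  rw [← mul_inv, Complex.Gamma_mul_Gamma_one_sub, inv_div]

lemma dup (z : ℂ) : Complex.Gamma (2 * z) =
    Complex.Gamma z * Complex.Gamma (z + 1 / 2) * 2 ^ (2 * z - 1) / (Real.sqrt Real.pi : ℂ) := by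
  rw [Complex.Gamma_mul_Gamma_add_half]
  have := sqpi_ne
  field_simp
  rw [mul_assoc, ← Complex.cpow_add _ _ two_ne_zero]
  simp

noncomputable def qk (μ : ℂ) : ℂ := -((Real.pi : ℂ) / (2 * Complex.sin ((Real.pi : ℂ) * μ)))
noncomputable def qr (ν μ : ℂ) : ℂ := Complex.cos ((Real.pi : ℂ) * (ν - μ)) *
        (Complex.Gamma (ν - μ + 1) / Complex.Gamma (ν + μ + 1))

lemma ferQ_eq (ν μ : ℂ) {x : ℝ} (h1 : -1 < x) (h2 : x < 1) :
    ferrersQ ν μ x = qk μ * (qr ν μ * ferrersP ν (-μ) (-x) -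
      Complex.cos (Real.pi * ν) * ferrersP ν μ (-x)) := by
  unfold ferrersQ qk qr ferrersP
  have e : ((1 - (x : ℂ)) / (1 + (x : ℂ))) ^ (-μ / 2) = ((1 + (x : ℂ)) / (1 - (x : ℂ))) ^ (μ / 2) := by
    have : (1 - (x : ℂ)) / (1 + (x : ℂ)) = (((1 + x) / (1 - x) : ℝ) : ℂ)⁻¹ := by
      push_cast; rw [inv_div]
    rw [this, Complex.inv_cpow, neg_div, Complex.cpow_neg, inv_inv]
    · push_cast; rfl
    · rw [Complex.arg_ofReal_of_nonneg (div_nonneg (by linarith) (by linarith))]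
      exact Real.pi_pos.ne
  rw [e]
  push_cast
  simp only [sub_neg_eq_add, ← sub_eq_add_neg]
  ring

noncomputable def ferQd (ν μ : ℂ) (x : ℝ) : ℂ :=
  -qk μ * (qr ν μ * ferPd ν (-μ) (-x) - Complex.cos (Real.pi * ν) * ferPd ν μ (-x))

lemma deriv_neg_arg {f : ℝ → ℂ} {d : ℂ} {x : ℝ} (h : HasDerivAt f d (-x)) :
    HasDerivAt (fun t => f (-t)) (-d) x := by
  have := HasDerivAt.scomp (h := fun t : ℝ => -t) x h (hasDerivAt_neg x)
  simp only [neg_smul, one_smul] at this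
  exact this

lemma ferQ_deriv (ν μ : ℂ) {x : ℝ} (h1 : -1 < x) (h2 : x < 1) :
    HasDerivAt (fun x => ferrersQ ν μ x) (ferQd ν μ x) x := by
  have e : (fun x => ferrersQ ν μ x) =ᶠ[𝓝 x] (fun x => qk μ * (qr ν μ * ferrersP ν (-μ) (-x) -
      Complex.cos (Real.pi * ν) * ferrersP ν μ (-x))) := by
    filter_upwards [Ioo_mem_nhds h1 h2] with y hy
    exact ferQ_eq ν μ hy.1 hy.2
  refine HasDerivAt.congr_of_eventuallyEq ?_ e
  have a1 := deriv_neg_arg (ferP_deriv ν μ (x := -x) (by linarith) (by linarith))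
  have a2 := deriv_neg_arg (ferP_deriv ν (-μ) (x := -x) (by linarith) (by linarith))
  refine (((a2.const_mul (qr ν μ)).sub (a1.const_mul (Complex.cos (Real.pi * ν)))).const_mul
    (qk μ)).congr_deriv ?_
  unfold ferQd; ring

lemma ferQd_deriv (ν μ : ℂ) {x : ℝ} (h1 : -1 < x) (h2 : x < 1) :
    HasDerivAt (fun x => ferQd ν μ x) (cA x * ferQd ν μ x + cB ν μ x * ferrersQ ν μ x) x := by
  rw [ferQ_eq ν μ h1 h2]
  have a1 := deriv_neg_arg (ferPd_deriv ν μ (x := -x) (by linarith) (by linarith))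
  have a2 := deriv_neg_arg (ferPd_deriv ν (-μ) (x := -x) (by linarith) (by linarith))
  refine (((a2.const_mul (qr ν μ)).sub (a1.const_mul (Complex.cos (Real.pi * ν)))).const_mul
    (-qk μ)).congr_deriv ?_
  unfold ferQd
  have c1 : cA (-x) = - cA x := by unfold cA; push_cast; ring
  have c2 : cB ν μ (-x) = cB ν μ x := by unfold cB; push_cast; ring
  have c3 : cB ν (-μ) (-x) = cB ν μ x := by unfold cB; push_cast; ring
  rw [c1, c2, c3]; ring

lemma ferP_zero (ν μ : ℂ) : ferrersP ν μ 0 = hyp2F1reg (-ν) (ν + 1) (1 + μ) (1 / 2) := by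
  simp [ferrersP]

lemma ferPd_zero (ν μ : ℂ) : ferPd ν μ 0 = - hyp2F1reg (-ν) (ν + 1) μ (1 / 2) := by
  have := hyp_zero_half_rec (-ν) (ν + 1) (1 + μ) (by ring)
  rw [add_sub_cancel_left] at this
  rw [this]
  unfold ferPd
  simp only [Complex.ofReal_zero, sub_zero, add_zero, div_one, Complex.one_cpow]
  ring

section vals
variable (ν μ : ℂ)

noncomputable def A0 : ℂ := Complex.Gamma ((ν - μ + 1) / 2)
noncomputable def A1 : ℂ := Complex.Gamma ((ν - μ + 2) / 2)
noncomputable def r1 : ℂ := (Complex.Gamma ((ν + μ + 1) / 2))⁻¹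
noncomputable def r2 : ℂ := (Complex.Gamma ((ν + μ + 2) / 2))⁻¹

lemma rho_eq : Complex.Gamma (ν - μ + 1) / Complex.Gamma (ν + μ + 1) =
    (2 ^ (-μ)) ^ 2 * A0 ν μ * A1 ν μ * r1 ν μ * r2 ν μ := by
  have d1 := dup ((ν - μ + 1) / 2)
  have d2 := dup ((ν + μ + 1) / 2)
  rw [show 2 * ((ν - μ + 1) / 2) = ν - μ + 1 by ring,
    show (ν - μ + 1) / 2 + 1 / 2 = (ν - μ + 2) / 2 by ring] at d1
  rw [show 2 * ((ν + μ + 1) / 2) = ν + μ + 1 by ring,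
    show (ν + μ + 1) / 2 + 1 / 2 = (ν + μ + 2) / 2 by ring] at d2
  rw [d1, d2]
  unfold A0 A1 r1 r2
  have e : (2:ℂ) ^ (ν - μ + 1 - 1) = 2 ^ (ν + μ + 1 - 1) * (2 ^ (-μ)) ^ 2 := by
    rw [← Complex.cpow_nat_mul, ← Complex.cpow_add _ _ two_ne_zero]; congr 1; push_cast; ring
  rw [e]
  have h1 : (2:ℂ) ^ (ν + μ + 1 - 1) ≠ 0 := by simp [Complex.cpow_eq_zero_iff]
  have := sqpi_ne
  simp only [div_eq_mul_inv, mul_inv, inv_inv]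
  field_simp

lemma pP (h0 : A0 ν μ ≠ 0) : ferrersP ν μ 0 = 2 ^ (-μ) * (Real.sqrt Real.pi : ℂ) / Real.pi * r2 ν μ * A0 ν μ *
    Complex.cos (Real.pi * (ν - μ) / 2) := by
  rw [ferP_zero, half_value]
  have := refl_inv ((ν - μ + 1) / 2)
  rw [show Real.pi * ((ν - μ + 1) / 2) = Real.pi * (ν - μ) / 2 + Real.pi / 2 by ring,
    Complex.sin_add_pi_div_two] at this
  rw [show (1 + μ + 1 + ν) / 2 = (ν + μ + 2) / 2 by ring,
    show (1 + μ - ν) / 2 = 1 - (ν - μ + 1) / 2 by ring, show 1 - (1 + μ) = -μ by ring]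
  change (A0 ν μ)⁻¹ * _ = _ at this
  change _ * (r2 ν μ * _) = _
  rw [inv_mul_eq_iff_eq_mul₀ h0] at this
  rw [this]; ring

lemma pPd (h1 : A1 ν μ ≠ 0) : ferPd ν μ 0 = 2 * 2 ^ (-μ) * (Real.sqrt Real.pi : ℂ) / Real.pi * r1 ν μ * A1 ν μ *
    Complex.sin (Real.pi * (ν - μ) / 2) := by
  rw [ferPd_zero, half_value]
  have := refl_inv ((ν - μ + 2) / 2)
  rw [show Real.pi * ((ν - μ + 2) / 2) = Real.pi * (ν - μ) / 2 + Real.pi by ring,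
    Complex.sin_add_pi] at this
  rw [show (μ + 1 + ν) / 2 = (ν + μ + 1) / 2 by ring,
    show (μ - ν) / 2 = 1 - (ν - μ + 2) / 2 by ring, show 1 - μ = 1 + (-μ) by ring,
    Complex.cpow_add _ _ two_ne_zero, Complex.cpow_one]
  change (A1 ν μ)⁻¹ * _ = _ at this
  change -(_ * (r1 ν μ * _)) = _
  rw [inv_mul_eq_iff_eq_mul₀ h1] at this
  rw [this]; ring

lemma pPm (h1 : A1 ν μ ≠ 0) : (Complex.Gamma (ν - μ + 1) / Complex.Gamma (ν + μ + 1)) * ferrersP ν (-μ) 0 =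
    2 ^ (-μ) * (Real.sqrt Real.pi : ℂ) / Real.pi * r2 ν μ * A0 ν μ *
    Complex.cos (Real.pi * (ν + μ) / 2) := by
  rw [ferP_zero, half_value, rho_eq]
  have := refl_inv ((ν + μ + 1) / 2)
  rw [show Real.pi * ((ν + μ + 1) / 2) = Real.pi * (ν + μ) / 2 + Real.pi / 2 by ring,
    Complex.sin_add_pi_div_two] at this
  rw [show (1 + -μ + 1 + ν) / 2 = (ν - μ + 2) / 2 by ring,
    show (1 + -μ - ν) / 2 = 1 - (ν + μ + 1) / 2 by ring, show 1 - (1 + -μ) = -(-μ) by ring,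
    Complex.cpow_neg _ (-μ)]
  change r1 ν μ * _ = _ at this
  change _ * (_ * ((A1 ν μ)⁻¹ * _)) = _
  have h2 : (2:ℂ) ^ (-μ) ≠ 0 := by rw [Ne, Complex.cpow_eq_zero_iff]; simp
  calc _ = (2:ℂ) ^ (-μ) * (Real.sqrt Real.pi : ℂ) * A0 ν μ * r2 ν μ * (r1 ν μ * (Complex.Gamma (1 - (ν + μ + 1) / 2))⁻¹) := by
        field_simp
    _ = _ := by rw [this]; ring

lemma pPdm (h0 : A0 ν μ ≠ 0) : (Complex.Gamma (ν - μ + 1) / Complex.Gamma (ν + μ + 1)) * ferPd ν (-μ) 0 =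
    2 * 2 ^ (-μ) * (Real.sqrt Real.pi : ℂ) / Real.pi * r1 ν μ * A1 ν μ *
    Complex.sin (Real.pi * (ν + μ) / 2) := by
  rw [ferPd_zero, half_value, rho_eq]
  have := refl_inv ((ν + μ + 2) / 2)
  rw [show Real.pi * ((ν + μ + 2) / 2) = Real.pi * (ν + μ) / 2 + Real.pi by ring,
    Complex.sin_add_pi] at this
  rw [show (-μ + 1 + ν) / 2 = (ν - μ + 1) / 2 by ring,
    show (-μ - ν) / 2 = 1 - (ν + μ + 2) / 2 by ring, show 1 - -μ = 1 - (-μ) by ring,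
    Complex.cpow_sub _ _ two_ne_zero, Complex.cpow_one]
  change r2 ν μ * _ = _ at this
  change _ * -(_ * ((A0 ν μ)⁻¹ * _)) = _
  have h2 : (2:ℂ) ^ (-μ) ≠ 0 := by rw [Ne, Complex.cpow_eq_zero_iff]; simp
  calc _ = -2 * (2:ℂ) ^ (-μ) * (Real.sqrt Real.pi : ℂ) * A1 ν μ * r1 ν μ * (r2 ν μ * (Complex.Gamma (1 - (ν + μ + 2) / 2))⁻¹) := by
        field_simp
    _ = _ := by rw [this]; ring

lemma trig1 (α β : ℂ) : Complex.cos (2 * α) * Complex.cos β - Complex.cos (α + β) * Complex.cos α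
    = Complex.sin α * Complex.sin (β - α) := by
  rw [Complex.cos_two_mul, Complex.cos_add, Complex.sin_sub]
  have := Complex.sin_sq_add_cos_sq α
  linear_combination Complex.cos β * this

lemma trig2 (α β : ℂ) : Complex.cos (2 * α) * Complex.sin β - Complex.cos (α + β) * Complex.sin α
    = Complex.cos α * Complex.sin (β - α) := by
  rw [Complex.cos_two_mul, Complex.cos_add, Complex.sin_sub]
  have := Complex.sin_sq_add_cos_sq α
  linear_combination Complex.sin β * this

lemma qQ (h0 : A0 ν μ ≠ 0) (h1 : A1 ν μ ≠ 0) (hs : Complex.sin (Real.pi * μ) ≠ 0) : ferrersQ ν μ 0 = -(Real.sqrt Real.pi : ℂ) / 2 * 2 ^ (-μ) * A0 ν μ * r2 ν μ *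
    Complex.sin (Real.pi * (ν - μ) / 2) := by
  rw [ferQ_eq ν μ (by norm_num) (by norm_num), neg_zero]
  have e1 := pP ν μ h0
  have e2 := pPm ν μ h1
  unfold qk qr
  have t := trig1 (Real.pi * (ν - μ) / 2) (Real.pi * (ν + μ) / 2)
  rw [show 2 * (Real.pi * (ν - μ) / 2) = Real.pi * (ν - μ) by ring,
    show Real.pi * (ν - μ) / 2 + Real.pi * (ν + μ) / 2 = Real.pi * ν by ring,
    show Real.pi * (ν + μ) / 2 - Real.pi * (ν - μ) / 2 = Real.pi * μ by ring] at t
  rw [mul_assoc (Complex.cos _), e2, e1]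
  have := pi_ne
  calc _ = -(Real.pi / (2 * Complex.sin (Real.pi * μ))) * (2 ^ (-μ) * (Real.sqrt Real.pi : ℂ) / Real.pi * r2 ν μ * A0 ν μ) * (Complex.cos (Real.pi * (ν - μ)) * Complex.cos (Real.pi * (ν + μ) / 2) -
    Complex.cos (Real.pi * ν) * Complex.cos (Real.pi * (ν - μ) / 2)) := by ring
   _ = _ := by
    rw [t]; field_simp

lemma qQd (h0 : A0 ν μ ≠ 0) (h1 : A1 ν μ ≠ 0) (hs : Complex.sin (Real.pi * μ) ≠ 0) : ferQd ν μ 0 = (Real.sqrt Real.pi : ℂ) * 2 ^ (-μ) * A1 ν μ * r1 ν μ *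
    Complex.cos (Real.pi * (ν - μ) / 2) := by
  unfold ferQd
  rw [neg_zero]
  have e1 := pPd ν μ h1
  have e2 := pPdm ν μ h0
  unfold qk qr
  have t := trig2 (Real.pi * (ν - μ) / 2) (Real.pi * (ν + μ) / 2)
  rw [show 2 * (Real.pi * (ν - μ) / 2) = Real.pi * (ν - μ) by ring,
    show Real.pi * (ν - μ) / 2 + Real.pi * (ν + μ) / 2 = Real.pi * ν by ring,
    show Real.pi * (ν + μ) / 2 - Real.pi * (ν - μ) / 2 = Real.pi * μ by ring] at t
  rw [mul_assoc (Complex.cos _), e2, e1]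
  have := pi_ne
  calc _ = (Real.pi / (2 * Complex.sin (Real.pi * μ))) * (2 * 2 ^ (-μ) * (Real.sqrt Real.pi : ℂ) / Real.pi * r1 ν μ * A1 ν μ) * (Complex.cos (Real.pi * (ν - μ)) * Complex.sin (Real.pi * (ν + μ) / 2) -
    Complex.cos (Real.pi * ν) * Complex.sin (Real.pi * (ν - μ) / 2)) := by ring
   _ = _ := by
    rw [t]; field_simp

lemma f0_val (h0 : A0 ν μ ≠ 0) (h1 : A1 ν μ ≠ 0) (hs : Complex.sin (Real.pi * μ) ≠ 0) : ferrersQ ν μ 0 ^ 2 + (Real.pi : ℂ) ^ 2 / 4 * ferrersP ν μ 0 ^ 2 =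
    Real.pi / 4 * (2 ^ (-μ)) ^ 2 * A0 ν μ ^ 2 * r2 ν μ ^ 2 := by
  rw [qQ ν μ h0 h1 hs, pP ν μ h0]
  have := Complex.sin_sq_add_cos_sq (Real.pi * (ν - μ) / 2)
  have hp := pi_ne
  have := sqpi_sq
  field_simp
  rw [this]
  linear_combination (4 * Real.pi * r2 ν μ ^ 2 : ℂ) * ‹Complex.sin _ ^ 2 + _ = 1›

lemma h0_val (h0 : A0 ν μ ≠ 0) (h1 : A1 ν μ ≠ 0) (hs : Complex.sin (Real.pi * μ) ≠ 0) : ferrersQ ν μ 0 * ferQd ν μ 0 + (Real.pi : ℂ) ^ 2 / 4 * (ferrersP ν μ 0 * ferPd ν μ 0) = 0 := by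
  rw [qQ ν μ h0 h1 hs, pP ν μ h0, qQd ν μ h0 h1 hs, pPd ν μ h1]
  have hp := pi_ne
  field_simp
  ring

lemma g0_val (h0 : A0 ν μ ≠ 0) (h1 : A1 ν μ ≠ 0) (hs : Complex.sin (Real.pi * μ) ≠ 0) : ferQd ν μ 0 ^ 2 + (Real.pi : ℂ) ^ 2 / 4 * ferPd ν μ 0 ^ 2 =
    Real.pi * (2 ^ (-μ)) ^ 2 * A1 ν μ ^ 2 * r1 ν μ ^ 2 := by
  rw [qQd ν μ h0 h1 hs, pPd ν μ h1]
  have := Complex.sin_sq_add_cos_sq (Real.pi * (ν - μ) / 2)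
  have hp := pi_ne
  have := sqpi_sq
  field_simp
  rw [this]
  linear_combination (4 * Real.pi * r1 ν μ ^ 2 : ℂ) * ‹Complex.sin _ ^ 2 + _ = 1›

end vals

end NF

namespace NF
open Filter Topology MeasureTheory Set

noncomputable def V (ν μ k : ℂ) (w : ℝ) : ℂ :=
  (w:ℂ) ^ (-(ν - μ + 1)) * hyp2F1reg ((ν - μ + 1) / 2) ((ν - μ + 2) / 2) (ν + 3 / 2 + k)
    (1 / (w:ℂ) ^ 2)

noncomputable def U (ν μ : ℂ) (w : ℝ) : ℂ := V ν μ 0 w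

noncomputable def Lam (ν μ : ℂ) : ℂ :=
  (ν + 3 / 2 - (ν - μ + 1) / 2) * (ν + 3 / 2 - (ν - μ + 2) / 2)

noncomputable def Ud (ν μ : ℂ) (w : ℝ) : ℂ :=
  -(ν - μ + 1) * V ν μ 0 w / w - 2 / (w * ((w:ℂ) ^ 2 - 1)) * (-μ * V ν μ 0 w + Lam ν μ * V ν μ 1 w)

lemma inv_sq_norm {w : ℝ} (hw : 1 < w) : ‖1 / (w:ℂ) ^ 2‖ < 1 := by
  rw [norm_div, norm_one, norm_pow, Complex.norm_real, Real.norm_eq_abs, abs_of_pos (by linarith)]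
  rw [div_lt_one (by positivity)]
  nlinarith

lemma w_ne {w : ℝ} (hw : 1 < w) : (w:ℂ) ≠ 0 := by
  rw [Ne, Complex.ofReal_eq_zero]; linarith
lemma wsq_ne {w : ℝ} (hw : 1 < w) : (w:ℂ)^2 - 1 ≠ 0 := by
  have : (w:ℂ)^2 - 1 = ((w^2 - 1 : ℝ) : ℂ) := by push_cast; rfl
  rw [this, Ne, Complex.ofReal_eq_zero]; nlinarith
lemma w1_ne {w : ℝ} (hw : 1 < w) : (w:ℂ) - 1 ≠ 0 := by
  have : (w:ℂ) - 1 = ((w - 1 : ℝ) : ℂ) := by push_cast; rfl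
  rw [this, Ne, Complex.ofReal_eq_zero]; linarith
lemma w2_ne {w : ℝ} (hw : 1 < w) : (w:ℂ) + 1 ≠ 0 := by
  have : (w:ℂ) + 1 = ((w + 1 : ℝ) : ℂ) := by push_cast; rfl
  rw [this, Ne, Complex.ofReal_eq_zero]; linarith

lemma V_deriv (ν μ k : ℂ) {w : ℝ} (hw : 1 < w) :
    ∃ D, HasDerivAt (fun w => V ν μ k w) D w ∧
      w * D = -(ν - μ + 1) * V ν μ k w - 2 * (V ν μ (k - 1) w - (ν + 1 / 2 + k) * V ν μ k w) ∧
      ((w:ℂ)^2 - 1) * (w * D + (ν - μ + 1) * V ν μ k w) = - 2 *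
        ((-μ - k) * V ν μ k w + (ν + 3 / 2 + k - (ν - μ + 1) / 2) *
          (ν + 3 / 2 + k - (ν - μ + 2) / 2) * V ν μ (k + 1) w) := by
  have w0 := w_ne hw
  have w1 := wsq_ne hw
  obtain ⟨D, hD, e1, e2⟩ := hyp_deriv ((ν - μ + 1) / 2) ((ν - μ + 2) / 2) (ν + 3 / 2 + k)
    (inv_sq_norm hw)
  have hz : HasDerivAt (fun z : ℂ => 1 / z ^ 2) (-2 / (w:ℂ)^3) (w:ℂ) := by
    have := (hasDerivAt_const (w:ℂ) (1:ℂ)).div ((hasDerivAt_id (w:ℂ)).fun_pow 2) (pow_ne_zero 2 w0)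
    refine this.congr_deriv ?_
    simp only [id]
    field_simp
    simp
    ring
  have hsl : (w:ℂ) ∈ Complex.slitPlane := by left; simp; linarith
  have hp := (hasDerivAt_id (w:ℂ)).cpow_const (c := -(ν - μ + 1)) hsl
  have h := (hp.mul (HasDerivAt.comp (h₂ := hyp2F1reg ((ν - μ + 1) / 2) ((ν - μ + 2) / 2)
    (ν + 3 / 2 + k)) (w:ℂ) hD hz)).comp_ofReal
  refine ⟨_, h, ?_, ?_⟩
  all_goals
    simp only [id, Function.comp, mul_one]
    rw [Complex.cpow_sub _ _ w0, Complex.cpow_one]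
    unfold V
  · rw [show ν + 3 / 2 + (k - 1) = ν + 3 / 2 + k - 1 by ring]
    generalize (w:ℂ) ^ (-(ν - μ + 1)) = q
    generalize hyp2F1reg ((ν - μ + 1) / 2) ((ν - μ + 2) / 2) (ν + 3 / 2 + k - 1) (1 / (w:ℂ) ^ 2) = F at *
    generalize hyp2F1reg ((ν - μ + 1) / 2) ((ν - μ + 2) / 2) (ν + 3 / 2 + k) (1 / (w:ℂ) ^ 2) = G at *
    rw [show F = 1 / (w:ℂ)^2 * D + (ν + 3 / 2 + k - 1) * G by linear_combination -e1]
    field_simp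
    ring
  · rw [show ν + 3 / 2 + (k + 1) = ν + 3 / 2 + k + 1 by ring]
    generalize (w:ℂ) ^ (-(ν - μ + 1)) = q
    generalize hyp2F1reg ((ν - μ + 1) / 2) ((ν - μ + 2) / 2) (ν + 3 / 2 + k + 1) (1 / (w:ℂ) ^ 2) = F at *
    generalize hyp2F1reg ((ν - μ + 1) / 2) ((ν - μ + 2) / 2) (ν + 3 / 2 + k) (1 / (w:ℂ) ^ 2) = G at *
    have e3 : ((w:ℂ)^2 - 1) * D = (w:ℂ)^2 * ((-μ - k) * G + (ν + 3 / 2 + k - (ν - μ + 1) / 2) *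
          (ν + 3 / 2 + k - (ν - μ + 2) / 2) * F) := by
      field_simp at e2
      linear_combination e2 / 4
    field_simp
    linear_combination (-4 * q) * e3

lemma U_deriv (ν μ : ℂ) {w : ℝ} (hw : 1 < w) :
    HasDerivAt (fun w => U ν μ w) (Ud ν μ w) w := by
  obtain ⟨D, hD, -, e⟩ := V_deriv ν μ 0 hw
  refine hD.congr_deriv ?_
  have w0 := w_ne hw
  have w1 := wsq_ne hw
  unfold Ud Lam
  simp only [zero_add, sub_zero, add_zero] at e
  field_simp
  linear_combination 2 * e

lemma Ud_deriv (ν μ : ℂ) {w : ℝ} (hw : 1 < w) :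
    HasDerivAt (fun w => Ud ν μ w) (((ν - μ + 1) * (ν + μ) * U ν μ w - 2 * (1 - μ) * w * Ud ν μ w)
      / ((w:ℂ)^2 - 1)) w := by
  have w0 := w_ne hw
  have w1 := wsq_ne hw
  have h0 := U_deriv ν μ hw
  obtain ⟨D, hD, e, -⟩ := V_deriv ν μ 1 hw
  have hx : HasDerivAt (fun x : ℝ => (x : ℂ)) 1 w := Complex.ofRealCLM.hasDerivAt
  have h1 := ((h0.const_mul (-(ν - μ + 1))).fun_div hx w0).fun_sub
    (((hasDerivAt_const w (2:ℂ)).fun_div (hx.fun_mul ((hx.fun_pow 2).sub_const 1)) (mul_ne_zero w0 w1)).fun_mul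
      ((h0.const_mul (-μ)).fun_add (hD.const_mul (Lam ν μ))))
  refine h1.congr_deriv ?_
  rw [sub_self] at e
  have e' : D = (-(ν - μ + 1) * V ν μ 1 w - 2 * (V ν μ 0 w - (ν + 1 / 2 + 1) * V ν μ 1 w)) / w := by
    field_simp; linear_combination e
  rw [e']
  unfold Ud U Lam
  field_simp
  push_cast
  ring

end NF

namespace NF
open Filter Topology MeasureTheory Set

lemma sqrt_bound {w : ℝ} (h1 : 1 < w) (h2 : w ≤ 2) (n : ℕ) :
    (w - 1) ^ (1 / 2 : ℝ) * (1 / w ^ 2) ^ n ≤ ((n : ℝ) + 1) ^ (-(1 / 2) : ℝ) := by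
  have hn : (0:ℝ) ≤ n := Nat.cast_nonneg n
  have ht : 0 < w - 1 := by linarith
  have hw : 0 < w := by linarith
  have key : (w - 1) ^ (1 / 2 : ℝ) * ((n : ℝ) + 1) ^ (1 / 2 : ℝ) ≤ w ^ n := by
    rw [← Real.mul_rpow ht.le (by positivity), ← Real.sqrt_eq_rpow]
    refine Real.sqrt_le_iff.2 ⟨by positivity, ?_⟩
    have h3 := one_add_mul_le_pow (a := w - 1) (by linarith) n
    rw [add_sub_cancel] at h3
    have h4 : (1 + n * (w - 1)) ^ 2 ≤ (w ^ n) ^ 2 := by gcongr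
    have h5 : 0 ≤ n * (w - 1) := by positivity
    nlinarith
  have h6 : w ^ n ≤ (w ^ 2) ^ n := by
    gcongr; nlinarith
  rw [Real.rpow_neg (by positivity), one_div_pow, mul_one_div,
    ← one_div (((n:ℝ) + 1) ^ (1 / 2 : ℝ)), div_le_div_iff₀ (by positivity) (by positivity)]
  linarith

lemma norm_cpow_pos {x : ℝ} (hx : 0 < x) (p : ℂ) : ‖(x:ℂ) ^ p‖ = x ^ p.re :=
  Complex.norm_cpow_eq_rpow_re_of_pos hx p

lemma V_lim1 (ν μ k : ℂ) (hk : -(1/2) < (μ + k).re) :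
    Tendsto (fun w : ℝ => ((w - 1 : ℝ) : ℂ) ^ (1 / 2 : ℂ) * V ν μ k w) (𝓝[>] 1) (𝓝 0) := by
  set φ := hc ((ν - μ + 1) / 2) ((ν - μ + 2) / 2) (ν + 3 / 2 + k) with hφ
  obtain ⟨C, hC, hb⟩ := hc_bound ((ν - μ + 1) / 2) ((ν - μ + 2) / 2) (ν + 3 / 2 + k)
  rw [← hφ] at hb
  have hex : ((ν - μ + 1) / 2 + (ν - μ + 2) / 2 - (ν + 3 / 2 + k) - 1).re = -(μ + k).re - 1 := by
    rw [show (ν - μ + 1) / 2 + (ν - μ + 2) / 2 - (ν + 3 / 2 + k) - 1 = -(μ + k) - 1 by ring]; simp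
  rw [hex] at hb
  have hsum : Summable (fun n : ℕ => ‖φ n‖ * ((n : ℝ) + 1) ^ (-(1 / 2) : ℝ)) := by
    refine Summable.of_nonneg_of_le (fun n => by positivity) (fun n => ?_)
      (g := fun n => ‖φ n‖ * ((n : ℝ) + 1) ^ (-(1 / 2) : ℝ))
      (f := fun n : ℕ => C * ((n : ℝ) + 1) ^ (-(μ + k).re - 1 + -(1/2))) ?_
    · rw [Real.rpow_add (by positivity), ← mul_assoc]
      gcongr; exact hb n
    · refine Summable.mul_left _ ?_
      have := (Real.summable_nat_rpow (p := (-(μ + k).re - 1 + -(1/2)))).2 (by linarith)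
      simpa using (summable_nat_add_iff 1).2 this
  have hmem : ∀ᶠ w : ℝ in 𝓝[>] 1, 1 < w ∧ w ≤ 2 := by
    filter_upwards [Ioc_mem_nhdsGT (show (1:ℝ) < 2 by norm_num)] with w hw using ⟨hw.1, hw.2⟩
  have hg : Tendsto (fun w : ℝ => ∑' n, ‖φ n‖ * ((w - 1) ^ (1 / 2 : ℝ) * (1 / w ^ 2) ^ n)) (𝓝[>] 1)
      (𝓝 (∑' n : ℕ, (0:ℝ))) := by
    refine tendsto_tsum_of_dominated_convergence hsum ?_ ?_
    · intro n
      have : ContinuousAt (fun w : ℝ => ‖φ n‖ * ((w - 1) ^ (1 / 2 : ℝ) * (1 / w ^ 2) ^ n)) 1 := by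
        have h1 : ContinuousAt (fun w : ℝ => (w - 1) ^ (1 / 2 : ℝ)) 1 :=
          ContinuousAt.rpow_const (by fun_prop) (Or.inr (by norm_num))
        have h2 : ContinuousAt (fun w : ℝ => (1 / w ^ 2) ^ n) 1 := by
          refine ContinuousAt.pow ?_ _
          exact continuousAt_const.div (by fun_prop) (by norm_num)
        exact continuousAt_const.mul (h1.mul h2)
      have h0 := this.tendsto
      norm_num at h0
      have h3 := h0.mono_left (nhdsWithin_le_nhds (s := Ioi 1))
      simpa using h3
    · filter_upwards [hmem] with w hw n
      have : 0 ≤ w - 1 := by linarith [hw.1]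
      rw [Real.norm_of_nonneg (by positivity)]
      gcongr
      exact sqrt_bound hw.1 hw.2 n
  rw [tsum_zero] at hg
  have hc1 : Tendsto (fun w : ℝ => ‖(w:ℂ) ^ (-(ν - μ + 1))‖) (𝓝[>] 1) (𝓝 ‖((1:ℝ):ℂ) ^ (-(ν - μ + 1))‖) := by
    refine Tendsto.mono_left ?_ nhdsWithin_le_nhds
    refine (ContinuousAt.norm ?_).tendsto
    exact (Complex.continuous_ofReal.continuousAt).cpow continuousAt_const (by left; simp)
  have hmul := hc1.mul hg
  rw [mul_zero] at hmul
  refine squeeze_zero_norm' ?_ hmul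
  filter_upwards [hmem] with w hw
  have hz := inv_sq_norm hw.1
  have hw0 : 0 < w := by linarith [hw.1]
  have hn : ‖1 / (w:ℂ)^2‖ = 1 / w^2 := by
    rw [norm_div, norm_one, norm_pow, Complex.norm_real, Real.norm_of_nonneg hw0.le]
  have hw1 : 0 < w - 1 := by linarith [hw.1]
  unfold V
  rw [norm_mul, norm_mul, norm_cpow_pos hw1, hyp_eq, ← hφ]
  have hs := (hc_PB ((ν - μ + 1) / 2) ((ν - μ + 2) / 2) (ν + 3 / 2 + k)).summable_norm
    (norm_nonneg _) hz
  rw [← hφ] at hs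
  have hle : ‖∑' n, φ n * (1 / (w:ℂ)^2)^n‖ ≤ ∑' n, ‖φ n‖ * (1 / w^2)^n := by
    rw [hn] at hs
    refine (norm_tsum_le_tsum_norm ?_).trans (le_of_eq ?_)
    · simpa [norm_mul, norm_pow, hn] using hs
    · congr 1; funext n; rw [norm_mul, norm_pow, hn]
  have e2 : ∑' n, ‖φ n‖ * ((w - 1) ^ (1 / 2 : ℝ) * (1 / w ^ 2) ^ n) =
      (w - 1) ^ (1 / 2 : ℝ) * ∑' n, ‖φ n‖ * (1 / w^2)^n := by
    rw [← tsum_mul_left]; congr 1; funext n; ring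
  rw [e2]
  have e3 : ((1:ℂ)/2).re = 1/2 := by norm_num
  rw [e3]
  calc _ ≤ (w - 1) ^ (1 / 2 : ℝ) * (‖(w:ℂ) ^ (-(ν - μ + 1))‖ * ∑' n, ‖φ n‖ * (1 / w^2)^n) := by gcongr
    _ = _ := by ring

lemma V_inf (ν μ k : ℂ) : ∃ C : ℝ, 0 ≤ C ∧ ∀ w : ℝ, 2 ≤ w → ‖V ν μ k w‖ ≤ C * w ^ (-(ν - μ + 1)).re := by
  set φ := hc ((ν - μ + 1) / 2) ((ν - μ + 2) / 2) (ν + 3 / 2 + k) with hφ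
  have hs0 := (hc_PB ((ν - μ + 1) / 2) ((ν - μ + 2) / 2) (ν + 3 / 2 + k)).summable_norm
    (r := 1/4) (by norm_num) (by norm_num)
  rw [← hφ] at hs0
  refine ⟨∑' n, ‖φ n‖ * (1/4)^n, tsum_nonneg fun n => by positivity, fun w hw => ?_⟩
  have hw0 : 0 < w := by linarith
  have hn : ‖1 / (w:ℂ)^2‖ ≤ 1/4 := by
    rw [norm_div, norm_one, norm_pow, Complex.norm_real, Real.norm_of_nonneg hw0.le]
    apply one_div_le_one_div_of_le (by norm_num); nlinarith
  unfold V
  rw [norm_mul, norm_cpow_pos hw0, hyp_eq, ← hφ, mul_comm]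
  gcongr
  refine tsum_of_norm_bounded hs0.hasSum fun n => ?_
  rw [norm_mul, norm_pow]; gcongr

end NF

namespace NF
open Filter Topology MeasureTheory Set

lemma cpow_deriv {f : ℝ → ℝ} {f' x : ℝ} (hf : HasDerivAt f f' x) (hx : 0 < f x) (p : ℂ) :
    HasDerivAt (fun x => (f x : ℂ) ^ p) (p * f' / (f x) * (f x : ℂ) ^ p) x := by
  have hsl : (f x : ℂ) ∈ Complex.slitPlane := by left; simpa using hx
  have h0 := Complex.slitPlane_ne_zero hsl
  have h1 := hf.ofReal_comp
  have h2 := HasDerivAt.scomp (h := f) x ((hasDerivAt_id (f x : ℂ)).cpow_const (c := p) hsl).comp_ofReal hf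
  refine h2.congr_deriv ?_
  simp only [id, mul_one, Complex.real_smul]
  rw [Complex.cpow_sub _ _ h0, Complex.cpow_one]
  ring

noncomputable def Y (μ : ℂ) (s w : ℝ) : ℂ :=
  ((w - 1 : ℝ) : ℂ) ^ (-(1 / 2) : ℂ) * ((w + 1 : ℝ) : ℂ) ^ (-μ) *
    ((w + 1 - 2 * s : ℝ) : ℂ) ^ (μ - 1 / 2)

noncomputable def J (ν μ : ℂ) (j : ℕ) (s w : ℝ) : ℂ :=
  U ν μ w * Y μ s w / ((w + 1 - 2 * s : ℝ) : ℂ) ^ j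

lemma X_pos {s w : ℝ} (hs : s < 1) (hw : 1 < w) : 0 < w + 1 - 2 * s := by linarith

lemma Y_deriv (μ : ℂ) {s w : ℝ} (hs : s < 1) (hw : 1 < w) :
    HasDerivAt (fun w => Y μ s w) (Y μ s w * (-(1/2) / ((w - 1 : ℝ):ℂ) + -μ / ((w + 1 : ℝ):ℂ) +
      (μ - 1 / 2) / ((w + 1 - 2 * s : ℝ):ℂ))) w := by
  have a1 := cpow_deriv ((hasDerivAt_id w).sub_const 1) (show 0 < w - 1 by linarith) (-(1/2))
  have a2 := cpow_deriv ((hasDerivAt_id w).add_const 1) (show 0 < w + 1 by linarith) (-μ)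
  have a3 := cpow_deriv (((hasDerivAt_id w).add_const 1).sub_const (2*s)) (X_pos hs hw) (μ - 1/2)
  refine ((a1.mul a2).mul a3).congr_deriv ?_
  unfold Y
  simp only [id, Pi.mul_apply]
  push_cast
  ring

lemma Y_deriv_s (μ : ℂ) {s w : ℝ} (hs : s < 1) (hw : 1 < w) :
    HasDerivAt (fun s => Y μ s w) (Y μ s w * (-2 * (μ - 1 / 2) / ((w + 1 - 2 * s : ℝ):ℂ))) s := by
  have a3 := cpow_deriv (((hasDerivAt_id s).const_mul 2).const_sub (w+1)) (X_pos hs hw) (μ - 1/2)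
  refine (a3.const_mul (((w - 1 : ℝ) : ℂ) ^ (-(1 / 2) : ℂ) * ((w + 1 : ℝ) : ℂ) ^ (-μ))).congr_deriv ?_
  unfold Y
  simp only [id]
  push_cast
  ring

lemma J_deriv_s (ν μ : ℂ) (j : ℕ) {s w : ℝ} (hs : s < 1) (hw : 1 < w) :
    HasDerivAt (fun s => J ν μ j s w) (-2 * (μ - 1 / 2 - j) * J ν μ (j + 1) s w) s := by
  have hX : ((w + 1 - 2 * s : ℝ):ℂ) ≠ 0 := by
    rw [Ne, Complex.ofReal_eq_zero]; exact (X_pos hs hw).ne'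
  have hx : HasDerivAt (fun s : ℝ => ((w + 1 - 2 * s : ℝ):ℂ)) (((-(2 * 1) : ℝ)):ℂ) s :=
    (((hasDerivAt_id s).const_mul 2).const_sub (w+1)).ofReal_comp
  have := ((Y_deriv_s μ hs hw).const_mul (U ν μ w)).fun_div (hx.fun_pow j) (pow_ne_zero _ hX)
  refine this.congr_deriv ?_
  unfold J
  generalize ((w + 1 - 2 * s : ℝ):ℂ) = X at *
  rcases j with _ | j
  · simp; ring
  · field_simp
    push_cast
    ring

noncomputable def al1 (ν μ s : ℂ) : ℂ := -2*(2*μ-1)*(s-(1-s)) - 2*(1-s)*((ν - μ + 1) * (ν + μ))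
  - (2*μ-1)*((2*μ-4)*s+3*(1-s)) - (2*μ-3)*(1-s)
noncomputable def al2 (μ s : ℂ) : ℂ := 4*(2*μ-1)*s*(1-s) + (2*μ-1)*(4*μ-10)*s*(1-s)
  + (2*μ-3)*(1-s)*((2*μ-4)*s+3*(1-s))
noncomputable def al3 (μ s : ℂ) : ℂ := -(2*μ-3)*(1-s)*(4*μ-10)*s*(1-s)

noncomputable def Bc (ν μ : ℂ) (s w : ℝ) : ℂ :=
  Y μ s w * ((w - 1 : ℝ):ℂ) * ((w + 1 : ℝ):ℂ) / ((w + 1 - 2 * s : ℝ) : ℂ) ^ 2 *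
   (((w - 1 : ℝ):ℂ) * ((w + 1 - 2 * s : ℝ) : ℂ) * Ud ν μ w -
     ((μ + 1 / 2) * ((w + 1 - 2 * s : ℝ) : ℂ) + (μ - 3 / 2) * ((w - 1 : ℝ):ℂ)) * U ν μ w)

lemma Bc_deriv (ν μ : ℂ) {s w : ℝ} (hs : s < 1) (hw : 1 < w) :
    HasDerivAt (fun w => Bc ν μ s w) ((ν - μ + 1) * (ν + μ) * J ν μ 0 s w + al1 ν μ s * J ν μ 1 s w
      + al2 μ s * J ν μ 2 s w + al3 μ s * J ν μ 3 s w) w := by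
  have hX : ((w + 1 - 2 * s : ℝ):ℂ) ≠ 0 := by
    rw [Ne, Complex.ofReal_eq_zero]; exact (X_pos hs hw).ne'
  have hX' := hX
  push_cast at hX'
  have w1 := w1_ne hw
  have w2 := w2_ne hw
  have w3 := wsq_ne hw
  have x1 : HasDerivAt (fun w : ℝ => ((w - 1 : ℝ):ℂ)) ((1:ℝ):ℂ) w := ((hasDerivAt_id w).sub_const 1).ofReal_comp
  have x2 : HasDerivAt (fun w : ℝ => ((w + 1 : ℝ):ℂ)) ((1:ℝ):ℂ) w := ((hasDerivAt_id w).add_const 1).ofReal_comp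
  have x3 : HasDerivAt (fun w : ℝ => ((w + 1 - 2 * s : ℝ):ℂ)) ((1:ℝ):ℂ) w := (((hasDerivAt_id w).add_const 1).sub_const (2*s)).ofReal_comp
  have := ((((Y_deriv μ hs hw).fun_mul x1).fun_mul x2).fun_div (x3.fun_pow 2) (pow_ne_zero _ hX)).fun_mul
    (((x1.fun_mul x3).fun_mul (Ud_deriv ν μ hw)).fun_sub
      (((x3.const_mul (μ + 1 / 2)).fun_add (x1.const_mul (μ - 3 / 2))).fun_mul (U_deriv ν μ hw)))
  refine this.congr_deriv ?_
  unfold J al1 al2 al3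
  generalize Y μ s w = y
  generalize U ν μ w = u
  generalize Ud ν μ w = v
  push_cast
  obtain ⟨X, hXX⟩ : ∃ X : ℂ, X = (w:ℂ) + 1 - 2 * s := ⟨_, rfl⟩
  obtain ⟨P, hP⟩ : ∃ P : ℂ, P = (w:ℂ) - 1 := ⟨_, rfl⟩
  have hs' : (s:ℂ) = (P + 2 - X) / 2 := by rw [hXX, hP]; ring
  have hw' : (w:ℂ) = P + 1 := by rw [hP]; ring
  rw [← hXX] at hX'
  rw [← hP] at w1
  have w2' : P + 2 ≠ 0 := by rw [hP]; convert w2 using 1; ring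
  clear hX w3 this x1 x2 x3
  rw [hs', hw']
  clear hXX hP hs' hw' w2
  have e1 : P + 1 - 1 = P := by ring
  have e2 : P + 1 + 1 = P + 2 := by ring
  have e3 : P + 2 - 2 * ((P + 2 - X) / 2) = X := by ring
  have e4 : (P + 1)^2 - 1 = P * (P + 2) := by ring
  simp only [e1, e2, e3, e4, pow_zero, div_one, mul_one, one_mul, pow_one]
  field_simp
  ring

end NF

namespace NF
open Filter Topology MeasureTheory Set

lemma rpow_le_sum {r r0 r1 : ℝ} (h0 : 0 < r0) (h1 : r0 ≤ r) (h2 : r ≤ r1) (p : ℝ) :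
    r ^ p ≤ r0 ^ p + r1 ^ p := by
  rcases le_total 0 p with hp | hp
  · have := Real.rpow_le_rpow (by linarith) h2 hp
    have := Real.rpow_nonneg h0.le p
    linarith
  · have := Real.rpow_le_rpow_of_nonpos h0 h1 hp
    have := Real.rpow_nonneg (show 0 ≤ r1 by linarith) p
    linarith

lemma J_norm (ν μ : ℂ) (j : ℕ) {s w : ℝ} (hs : s < 1) (hw : 1 < w) :
    ‖J ν μ j s w‖ = ‖U ν μ w‖ * ((w - 1) ^ (-(1/2) : ℝ) * (w + 1) ^ (-μ.re) *
      (w + 1 - 2 * s) ^ (μ.re - 1 / 2)) / (w + 1 - 2 * s) ^ j := by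
  unfold J Y
  rw [norm_div, norm_mul, norm_mul, norm_mul, norm_cpow_pos (by linarith), norm_cpow_pos (by linarith),
    norm_cpow_pos (X_pos hs hw), norm_pow, Complex.norm_real, Real.norm_of_nonneg (X_pos hs hw).le]
  simp

lemma J_bound (ν μ : ℂ) (j : ℕ) {s0 hi : ℝ} (h0 : 0 ≤ s0) (h1 : s0 < 1) (hi0 : 0 ≤ hi) (hi1 : hi < 1) :
    ∃ C : ℝ, 0 ≤ C ∧ ∀ s w, -1 ≤ s → s ≤ hi → 1 < w → ‖J ν μ j s w‖ ≤ C * ‖J ν μ 0 s0 w‖ := by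
  refine ⟨(((1 - hi) / 2) ^ (μ.re - 1/2) + (2 / (1 - s0)) ^ (μ.re - 1/2)) * ((2 * (1 - hi)) ^ j)⁻¹, ?_, ?_⟩
  · have : 0 < 1 - hi := by linarith
    have : 0 < 1 - s0 := by linarith
    positivity
  intro s w hs1 hs2 hw
  rw [J_norm ν μ j (by linarith) hw, J_norm ν μ 0 h1 hw]
  have hX := X_pos (show s < 1 by linarith) hw
  have hX0 := X_pos h1 hw
  set X := w + 1 - 2 * s with hXd
  set X0 := w + 1 - 2 * s0 with hX0d
  have e1 : X ^ (μ.re - 1/2) = (X / X0) ^ (μ.re - 1/2) * X0 ^ (μ.re - 1/2) := by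
    rw [← Real.mul_rpow (by positivity) (by positivity), div_mul_cancel₀ _ hX0.ne']
  have e2 : (X / X0) ^ (μ.re - 1/2) ≤ ((1 - hi) / 2) ^ (μ.re - 1/2) + (2 / (1 - s0)) ^ (μ.re - 1/2) := by
    apply rpow_le_sum (by linarith)
    · rw [div_le_div_iff₀ (by norm_num) hX0]
      nlinarith
    · rw [div_le_div_iff₀ hX0 (by linarith)]
      nlinarith
  have e3 : (X ^ j)⁻¹ ≤ ((2 * (1 - hi)) ^ j)⁻¹ := by
    apply inv_anti₀ (by have : 0 < 1 - hi := by linarith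
                        positivity)
    apply pow_le_pow_left₀ (by linarith)
    linarith
  rw [pow_zero, div_one, div_eq_mul_inv, e1]
  have n1 : 0 ≤ (w - 1) ^ (-(1/2):ℝ) := Real.rpow_nonneg (by linarith) _
  have n2 : 0 ≤ (w + 1) ^ (-μ.re) := Real.rpow_nonneg (by linarith) _
  have n3 : 0 ≤ X0 ^ (μ.re - 1/2) := Real.rpow_nonneg hX0.le _
  have n4 : 0 ≤ (X / X0) ^ (μ.re - 1/2) := Real.rpow_nonneg (by positivity) _
  calc _ = ((X / X0) ^ (μ.re - 1/2) * (X ^ j)⁻¹) * (‖U ν μ w‖ * ((w - 1) ^ (-(1/2) : ℝ) * (w + 1) ^ (-μ.re) * X0 ^ (μ.re - 1 / 2))) := by ring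
    _ ≤ _ := by
      apply mul_le_mul_of_nonneg_right
      · apply mul_le_mul e2 e3 (by positivity) (by linarith)
      · positivity

lemma J_contOn (ν μ : ℂ) (j : ℕ) {s : ℝ} (hs : s < 1) : ContinuousOn (fun w => J ν μ j s w) (Ioi 1) := by
  intro w hw
  apply ContinuousAt.continuousWithinAt
  have hX : ((w + 1 - 2 * s : ℝ):ℂ) ≠ 0 := by
    rw [Ne, Complex.ofReal_eq_zero]; exact (X_pos hs hw).ne'
  unfold J
  refine ((U_deriv ν μ hw).continuousAt.mul (Y_deriv μ hs hw).continuousAt).div ?_ (pow_ne_zero _ hX)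
  fun_prop

lemma J_int (ν μ : ℂ) (j : ℕ) {s0 s : ℝ} (h0 : 0 ≤ s0) (h1 : s0 < 1) (hs : -1 ≤ s) (hs1 : s < 1)
    (hJ : IntegrableOn (fun w => J ν μ 0 s0 w) (Ioi 1)) : IntegrableOn (fun w => J ν μ j s w) (Ioi 1) := by
  obtain ⟨C, hC, hb⟩ := J_bound ν μ j h0 h1 (le_max_right s 0) (max_lt hs1 one_pos)
  refine Integrable.mono' (hJ.norm.const_mul C) ((J_contOn ν μ j hs1).aestronglyMeasurable measurableSet_Ioi) ?_
  filter_upwards [ae_restrict_mem measurableSet_Ioi] with w hw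
  exact hb s w hs (le_max_left _ _) hw

noncomputable def II (ν μ : ℂ) (j : ℕ) (s : ℝ) : ℂ := ∫ w in Ioi (1:ℝ), J ν μ j s w

lemma II_deriv (ν μ : ℂ) (j : ℕ) {s0 s : ℝ} (h0 : 0 ≤ s0) (h1 : s0 < 1) (hs : -1 < s) (hs1 : s < 1)
    (hJ : IntegrableOn (fun w => J ν μ 0 s0 w) (Ioi 1)) :
    HasDerivAt (fun s => II ν μ j s) (-2 * (μ - 1 / 2 - j) * II ν μ (j + 1) s) s := by
  set hi := max ((s + 1) / 2) 0
  obtain ⟨C, hC, hb⟩ := J_bound ν μ (j+1) h0 h1 (le_max_right ((s+1)/2) 0) (max_lt (by linarith) one_pos)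
  have hmem : Ioo (-1) ((s+1)/2) ∈ 𝓝 s := Ioo_mem_nhds hs (by linarith)
  have := (hasDerivAt_integral_of_dominated_loc_of_deriv_le (μ := volume.restrict (Ioi (1:ℝ)))
    (F := fun s w => J ν μ j s w) (F' := fun s w => -2 * (μ - 1 / 2 - j) * J ν μ (j+1) s w)
    (bound := fun w => ‖-2 * (μ - 1 / 2 - j)‖ * (C * ‖J ν μ 0 s0 w‖)) (x₀ := s) hmem ?_ ?_ ?_ ?_ ?_ ?_).2
  · refine this.congr_deriv ?_
    rw [integral_const_mul]; rfl
  · filter_upwards [hmem] with t ht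
    exact (J_contOn ν μ j (by linarith [ht.2])).aestronglyMeasurable measurableSet_Ioi
  · exact J_int ν μ j h0 h1 hs.le hs1 hJ
  · exact ((J_int ν μ (j+1) h0 h1 hs.le hs1 hJ).const_mul _).aestronglyMeasurable
  · filter_upwards [ae_restrict_mem measurableSet_Ioi] with w hw t ht
    rw [norm_mul]
    exact mul_le_mul_of_nonneg_left (hb t w ht.1.le (ht.2.le.trans (le_max_left _ _)) hw) (norm_nonneg _)
  · exact (hJ.norm.const_mul C).const_mul _
  · filter_upwards [ae_restrict_mem measurableSet_Ioi] with w hw t ht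
    exact J_deriv_s ν μ j (by linarith [ht.2]) hw

end NF

namespace NF
open Filter Topology MeasureTheory Set

noncomputable def EE (μ : ℂ) (s w : ℝ) : ℂ :=
  ((w + 1 : ℝ) : ℂ) ^ (-μ) * ((w + 1 - 2 * s : ℝ) : ℂ) ^ (μ - 1 / 2) * ((w + 1 : ℝ):ℂ) /
    ((w + 1 - 2 * s : ℝ) : ℂ) ^ 2
noncomputable def g0 (ν μ : ℂ) (s w : ℝ) : ℂ :=
  ((w + 1 - 2 * s : ℝ) : ℂ) * (-(ν - μ + 1) * ((w - 1 : ℝ):ℂ) / w + 2 * μ / (w * ((w + 1 : ℝ):ℂ))) -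
    ((μ + 1 / 2) * ((w + 1 - 2 * s : ℝ) : ℂ) + (μ - 3 / 2) * ((w - 1 : ℝ):ℂ))
noncomputable def g1 (ν μ : ℂ) (s w : ℝ) : ℂ :=
  - ((w + 1 - 2 * s : ℝ) : ℂ) * 2 * Lam ν μ / (w * ((w + 1 : ℝ):ℂ))

lemma Bc_split (ν μ : ℂ) {s w : ℝ} (hw : 1 < w) :
    Bc ν μ s w = EE μ s w * (g0 ν μ s w * (((w-1:ℝ):ℂ)^(1/2:ℂ)*V ν μ 0 w) +
      g1 ν μ s w * (((w-1:ℝ):ℂ)^(1/2:ℂ)*V ν μ 1 w)) := by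
  have w0 := w_ne hw
  have w1 := w1_ne hw
  have w2 := w2_ne hw
  have e : ((w-1:ℝ):ℂ)^(1/2:ℂ) = ((w - 1 : ℝ) : ℂ) ^ (-(1 / 2) : ℂ) * ((w-1:ℝ):ℂ) := by
    rw [show (1/2:ℂ) = -(1/2) + 1 by norm_num, Complex.cpow_add _ _ (by push_cast; exact w1), Complex.cpow_one]
    norm_num
  rw [e]
  unfold Bc EE g0 g1 Y Ud U
  generalize ((w - 1 : ℝ) : ℂ) ^ (-(1 / 2) : ℂ) = q
  generalize ((w + 1 - 2 * s : ℝ) : ℂ) ^ (μ - 1 / 2) = p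
  generalize ((w + 1 : ℝ) : ℂ) ^ (-μ) = r
  generalize ((w + 1 - 2 * s : ℝ) : ℂ) = X
  push_cast
  rw [show (w:ℂ)^2 - 1 = (w - 1) * (w + 1) by ring]
  generalize V ν μ 0 w = v0
  generalize V ν μ 1 w = v1
  have key : ((w:ℂ) - 1) * (2 / (↑w * ((↑w - 1) * (↑w + 1)))) = 2 / (w * (w + 1)) := by
    field_simp
  generalize (2 / ((w:ℂ) * ((↑w - 1) * (↑w + 1)))) = k at *
  have e2 : 2 * μ / ((w:ℂ) * (w + 1)) = 2 / (w * (w + 1)) * μ := by ring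
  have e3 : - X * 2 * Lam ν μ / ((w:ℂ) * (w + 1)) = -X * (2 / (w * (w + 1))) * Lam ν μ := by ring
  rw [e2, e3, ← key]
  ring

lemma Bc_one (ν μ : ℂ) (s : ℝ) : Bc ν μ s 1 = 0 := by
  unfold Bc; simp

lemma Bc_lim1 (ν μ : ℂ) {s : ℝ} (hs : s < 1) (hμ : -(1/2) < μ.re) :
    Tendsto (fun w => Bc ν μ s w) (𝓝[>] 1) (𝓝 0) := by
  have t0 := V_lim1 ν μ 0 (by simpa using hμ)
  have t1 := V_lim1 ν μ 1 (by simp; linarith)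
  have hX : (((1:ℝ) + 1 - 2 * s : ℝ):ℂ) ≠ 0 := by
    rw [Ne, Complex.ofReal_eq_zero]; linarith
  have hXs : (((1:ℝ) + 1 - 2 * s : ℝ):ℂ) ∈ Complex.slitPlane := by
    left; rw [Complex.ofReal_re]; linarith
  have h2s : (((1:ℝ) + 1 : ℝ):ℂ) ∈ Complex.slitPlane := by
    left; rw [Complex.ofReal_re]; norm_num
  have h1 : ((1:ℝ):ℂ) ≠ 0 := by norm_num
  have h2 : ((1:ℝ):ℂ) * (((1:ℝ) + 1 : ℝ):ℂ) ≠ 0 := by norm_num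
  have cX : ContinuousAt (fun w : ℝ => ((w + 1 - 2 * s : ℝ):ℂ)) 1 := by fun_prop
  have c1 : ContinuousAt (fun w : ℝ => ((w + 1 : ℝ):ℂ)) 1 := by fun_prop
  have c2 : ContinuousAt (fun w : ℝ => ((w - 1 : ℝ):ℂ)) 1 := by fun_prop
  have c3 : ContinuousAt (fun w : ℝ => (w:ℂ)) 1 := by fun_prop
  have cE : ContinuousAt (fun w => EE μ s w) 1 := by
    unfold EE
    exact (((c1.cpow continuousAt_const h2s).mul (cX.cpow continuousAt_const hXs)).mul c1).div (cX.pow 2) (pow_ne_zero _ hX)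
  have cg0 : ContinuousAt (fun w => g0 ν μ s w) 1 := by
    unfold g0
    exact (cX.mul (((continuousAt_const.mul c2).div c3 h1).add (continuousAt_const.div (c3.mul c1) h2))).sub
      ((continuousAt_const.mul cX).add (continuousAt_const.mul c2))
  have cg1 : ContinuousAt (fun w => g1 ν μ s w) 1 := by
    unfold g1
    exact ((cX.neg.mul continuousAt_const).mul continuousAt_const).div (c3.mul c1) h2
  have key := (cE.tendsto.mono_left (nhdsWithin_le_nhds (s := Ioi 1))).mul
    (((cg0.tendsto.mono_left (nhdsWithin_le_nhds (s := Ioi 1))).mul t0).add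
     ((cg1.tendsto.mono_left (nhdsWithin_le_nhds (s := Ioi 1))).mul t1))
  simp only [mul_zero, add_zero] at key
  refine key.congr' ?_
  filter_upwards [self_mem_nhdsWithin] with w hw
  exact (Bc_split ν μ hw).symm

lemma Bc_inf (ν μ : ℂ) {s : ℝ} (hs0 : -1 ≤ s) (hs : s < 1) (ha : 0 < (ν - μ + 1).re) :
    Tendsto (fun w => Bc ν μ s w) atTop (𝓝 0) := by
  obtain ⟨C0, hC0, b0⟩ := V_inf ν μ 0
  obtain ⟨C1, hC1, b1⟩ := V_inf ν μ 1
  set hi := max s 0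
  have hi1 : hi < 1 := max_lt hs one_pos
  have hi2 : s ≤ hi := le_max_left _ _
  have hi3 : 0 ≤ hi := le_max_right _ _
  set D := (1 - hi) ^ (μ.re - 5/2) + 2 ^ (μ.re - 5/2)
  set M := 2 * (‖ν - μ + 1‖ + 2 * ‖μ‖) + 2 * ‖μ + 1/2‖ + ‖μ - 3/2‖
  set N := 4 * ‖Lam ν μ‖
  have hD : 0 ≤ D := by
    have : 0 < 1 - hi := by linarith
    positivity
  have tw : Tendsto (fun w : ℝ => D * (M * C0 + N * C1) * w ^ (-(ν - μ + 1)).re) atTop (𝓝 0) := by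
    have := (tendsto_rpow_neg_atTop ha).const_mul (D * (M * C0 + N * C1))
    simpa using this
  refine squeeze_zero_norm' ?_ tw
  filter_upwards [eventually_ge_atTop 2] with w hw
  have hw1 : 1 < w := by linarith
  rw [Bc_split ν μ hw1]
  have hX := X_pos hs hw1
  have hq : ‖((w-1:ℝ):ℂ)^(1/2:ℂ)‖ ≤ (w+1)^(1/2:ℝ) := by
    rw [norm_cpow_pos (by linarith)]
    norm_num
    exact Real.rpow_le_rpow (by linarith) (by linarith) (by norm_num)
  have hX2 : w + 1 - 2 * s ≤ 2 * (w + 1) := by linarith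
  have hE : ‖EE μ s w‖ ≤ D * (w+1)^(-(3/2):ℝ) := by
    unfold EE
    rw [norm_div, norm_mul, norm_mul, norm_cpow_pos (by linarith), norm_cpow_pos hX, norm_pow,
      Complex.norm_real, Complex.norm_real, Real.norm_of_nonneg hX.le, Real.norm_of_nonneg (by linarith)]
    have : (w + 1) ^ (-μ).re * (w + 1 - 2 * s) ^ (μ - 1 / 2).re * (w + 1) / (w + 1 - 2 * s) ^ 2
      = ((w + 1 - 2 * s)/(w+1)) ^ (μ.re - 5/2) * (w+1)^(-(3/2):ℝ) := by
      rw [Real.div_rpow hX.le (by linarith), ← Real.rpow_natCast (w+1-2*s) 2]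
      have e1 : (μ - 1/2).re = (μ.re - 5/2) + 2 := by simp; norm_num; ring
      have e2 : -(3/2:ℝ) = (μ.re - 5/2) + (-μ).re + 1 := by rw [Complex.neg_re]; ring
      rw [e1, e2, Real.rpow_add hX, Real.rpow_add (by linarith), Real.rpow_add (by linarith), Real.rpow_one]
      have := (Real.rpow_pos_of_pos hX 2).ne'
      have := (Real.rpow_pos_of_pos (show 0 < w + 1 by linarith) (μ.re - 5/2)).ne'
      push_cast
      field_simp
    rw [this]
    apply mul_le_mul_of_nonneg_right _ (Real.rpow_nonneg (by linarith) _)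
    apply rpow_le_sum (by linarith)
    · rw [le_div_iff₀ (by linarith)]; nlinarith
    · rw [div_le_iff₀ (by linarith)]; linarith
  have hwn : ‖(w:ℂ)‖ = w := by rw [Complex.norm_real, Real.norm_of_nonneg (by linarith)]
  have hXn : ‖((w + 1 - 2 * s : ℝ):ℂ)‖ ≤ 2 * (w + 1) := by
    rw [Complex.norm_real, Real.norm_of_nonneg hX.le]; exact hX2
  have h1n : ‖((w + 1 : ℝ):ℂ)‖ = w + 1 := by rw [Complex.norm_real, Real.norm_of_nonneg (by linarith)]
  have h2n : ‖((w - 1 : ℝ):ℂ)‖ = w - 1 := by rw [Complex.norm_real, Real.norm_of_nonneg (by linarith)]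
  have hg0 : ‖g0 ν μ s w‖ ≤ M * (w + 1) := by
    unfold g0
    refine (norm_sub_le _ _).trans ?_
    have i1 : ‖-(ν - μ + 1) * ((w - 1 : ℝ):ℂ) / w‖ ≤ ‖ν - μ + 1‖ := by
      rw [norm_div, norm_mul, norm_neg, h2n, hwn, div_le_iff₀ (by linarith)]
      exact mul_le_mul_of_nonneg_left (by linarith) (norm_nonneg _)
    have i2 : ‖2 * μ / (w * ((w + 1 : ℝ):ℂ))‖ ≤ 2 * ‖μ‖ := by
      rw [norm_div, norm_mul, norm_mul, h1n, hwn, div_le_iff₀ (by nlinarith)]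
      norm_num
      have := norm_nonneg μ
      nlinarith [show 1 ≤ w * (w + 1) by nlinarith]
    have i3 := (norm_add_le (-(ν - μ + 1) * ((w - 1 : ℝ):ℂ) / w) (2 * μ / (w * ((w + 1 : ℝ):ℂ)))).trans (add_le_add i1 i2)
    have i4 : ‖(μ + 1 / 2) * ((w + 1 - 2 * s : ℝ) : ℂ) + (μ - 3 / 2) * ((w - 1 : ℝ):ℂ)‖ ≤
      ‖μ + 1/2‖ * (2 * (w+1)) + ‖μ - 3/2‖ * (w+1) := by
      refine (norm_add_le _ _).trans (add_le_add ?_ ?_)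
      · rw [norm_mul]; exact mul_le_mul_of_nonneg_left hXn (norm_nonneg _)
      · rw [norm_mul, h2n]; exact mul_le_mul_of_nonneg_left (by linarith) (norm_nonneg _)
    have i5 : ‖((w + 1 - 2 * s : ℝ) : ℂ) * (-(ν - μ + 1) * ((w - 1 : ℝ):ℂ) / w + 2 * μ / (w * ((w + 1 : ℝ):ℂ)))‖
        ≤ 2 * (w+1) * (‖ν - μ + 1‖ + 2 * ‖μ‖) := by
      rw [norm_mul]
      exact mul_le_mul hXn i3 (norm_nonneg _) (by linarith)
    refine (add_le_add i5 i4).trans (le_of_eq ?_)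
    simp only [M]; ring
  have hg1 : ‖g1 ν μ s w‖ ≤ N * (w + 1) := by
    unfold g1
    rw [norm_div, norm_mul, norm_mul, norm_mul, norm_neg, hwn, h1n, div_le_iff₀ (by nlinarith)]
    simp only [N, Complex.norm_ofNat]
    have := norm_nonneg (Lam ν μ)
    have h5 : ‖((w + 1 - 2 * s : ℝ):ℂ)‖ * 2 * ‖Lam ν μ‖ ≤ 2 * (w + 1) * 2 * ‖Lam ν μ‖ := by gcongr
    refine h5.trans ?_
    have : 1 ≤ w * (w + 1) := by nlinarith
    have h6 : 0 ≤ 4 * (w+1) * ‖Lam ν μ‖ := by positivity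
    nlinarith
  have hw1p : 0 < w + 1 := by linarith
  have B0 := b0 w hw
  have B1 := b1 w hw
  have hp : 0 ≤ w ^ (-(ν - μ + 1)).re := Real.rpow_nonneg (by linarith) _
  generalize w ^ (-(ν - μ + 1)).re = T at *
  have hM : 0 ≤ M := by positivity
  have hN : 0 ≤ N := by positivity
  have hqq : (w+1)^(-(3/2):ℝ) * ((w + 1) * (w+1)^(1/2:ℝ)) = 1 := by
    nth_rewrite 2 [← Real.rpow_one (w+1)]
    rw [← Real.rpow_add hw1p, ← Real.rpow_add hw1p]; norm_num
  have hqp : 0 ≤ (w+1)^(1/2:ℝ) := by positivity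
  have hep : 0 ≤ (w+1)^(-(3/2):ℝ) := by positivity
  calc _ ≤ (D * (w+1)^(-(3/2):ℝ)) * ((M * (w+1)) * ((w+1)^(1/2:ℝ) * (C0 * T)) + (N * (w+1)) * ((w+1)^(1/2:ℝ) * (C1 * T))) := by
        rw [norm_mul]
        apply mul_le_mul hE _ (norm_nonneg _) (by positivity)
        refine (norm_add_le _ _).trans ?_
        rw [norm_mul, norm_mul, norm_mul, norm_mul]
        gcongr
    _ = D * (M * C0 + N * C1) * T * ((w+1)^(-(3/2):ℝ) * ((w + 1) * (w+1)^(1/2:ℝ))) := by ring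
    _ = _ := by rw [hqq, mul_one]

lemma cert (ν μ : ℂ) {s0 s : ℝ} (h0 : 0 ≤ s0) (h1 : s0 < 1) (hs0 : -1 ≤ s) (hs : s < 1)
    (ha : 0 < (ν - μ + 1).re) (hμ : -(1/2) < μ.re)
    (hJ : IntegrableOn (fun w => J ν μ 0 s0 w) (Ioi 1)) :
    (ν - μ + 1) * (ν + μ) * II ν μ 0 s + al1 ν μ s * II ν μ 1 s
      + al2 μ s * II ν μ 2 s + al3 μ s * II ν μ 3 s = 0 := by
  have i0 := (J_int ν μ 0 h0 h1 hs0 hs hJ).const_mul ((ν - μ + 1) * (ν + μ))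
  have i1 := (J_int ν μ 1 h0 h1 hs0 hs hJ).const_mul (al1 ν μ s)
  have i2 := (J_int ν μ 2 h0 h1 hs0 hs hJ).const_mul (al2 μ s)
  have i3 := (J_int ν μ 3 h0 h1 hs0 hs hJ).const_mul (al3 μ s)
  have key := integral_Ioi_of_hasDerivAt_of_tendsto (f := fun w => Bc ν μ s w) (a := (1:ℝ)) (m := 0)
    (f' := fun w => (ν - μ + 1) * (ν + μ) * J ν μ 0 s w + al1 ν μ s * J ν μ 1 s w
      + al2 μ s * J ν μ 2 s w + al3 μ s * J ν μ 3 s w) ?_ (fun w hw => Bc_deriv ν μ hs hw)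
      (((i0.add i1).add i2).add i3) (Bc_inf ν μ hs0 hs ha)
  · rw [Bc_one, sub_zero] at key
    rw [← key]
    unfold II
    rw [← integral_const_mul, ← integral_const_mul, ← integral_const_mul, ← integral_const_mul]
    have a1 := integral_add i0 i1
    have a2 := integral_add (i0.add i1) i2
    have a3 := integral_add ((i0.add i1).add i2) i3
    simp only [Pi.add_apply] at a2 a3
    rw [a3, a2, a1]
  · rw [← Ioi_insert, continuousWithinAt_insert_self]
    show Tendsto _ _ (𝓝 (Bc ν μ s 1))
    rw [Bc_one]
    exact Bc_lim1 ν μ hs hμ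

end NF

namespace NF
open Filter Topology MeasureTheory Set

lemma norm_real_lt {r : ℝ} (h0 : 0 ≤ r) (h1 : r < 1) : ‖(r:ℂ)‖ < 1 := by
  rw [Complex.norm_real, Real.norm_of_nonneg h0]; exact h1

lemma hyp_zero_val (a b c : ℂ) : hyp2F1reg a b c 0 = hc a b c 0 := by
  rw [hyp_eq, tsum_eq_single 0]
  · simp
  · intro n hn; simp [hn]

lemma binom (p : ℂ) {r : ℝ} (h0 : 0 ≤ r) (h1 : r < 1) :
    hyp2F1reg p 1 1 (r:ℂ) = ((1 - r : ℝ) : ℂ) ^ (-p) := by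
  have hd : ∀ t ∈ Icc 0 r, HasDerivAt (fun t : ℝ => ((1 - t : ℝ):ℂ) ^ p * hyp2F1reg p 1 1 (t:ℂ)) 0 t := by
    intro t ht
    have ht1 : t < 1 := by linarith [ht.2]
    obtain ⟨D, hD, -, e⟩ := hyp_deriv p 1 1 (norm_real_lt ht.1 ht1)
    have a1 := cpow_deriv ((hasDerivAt_id t).const_sub 1) (show 0 < 1 - t by linarith) p
    refine (a1.fun_mul hD.comp_ofReal).congr_deriv ?_
    have hne : (1:ℂ) - t ≠ 0 := by
      have : (1:ℂ) - t = ((1 - t : ℝ):ℂ) := by push_cast; rfl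
      rw [this, Ne, Complex.ofReal_eq_zero]; linarith
    simp only [id]
    push_cast
    have e' : D = p * hyp2F1reg p 1 1 t / (1 - t) := by
      rw [eq_div_iff hne, mul_comm, e]; ring
    rw [e']
    field_simp
    ring
  have hcst := constant_of_has_deriv_right_zero (f := fun t : ℝ => ((1 - t : ℝ):ℂ) ^ p * hyp2F1reg p 1 1 (t:ℂ))
    (a := 0) (b := r) (fun t ht => (hd t ht).continuousAt.continuousWithinAt)
    (fun t ht => (hd t ⟨ht.1, ht.2.le⟩).hasDerivWithinAt) r ⟨h0, le_refl _⟩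
  simp only [sub_zero, Complex.ofReal_one, Complex.one_cpow, Complex.ofReal_zero, one_mul, hyp_zero_val] at hcst
  have : hc p 1 1 0 = 1 := by simp [hc, poch_zero]
  rw [this] at hcst
  have hne : ((1 - r : ℝ):ℂ) ≠ 0 := by rw [Ne, Complex.ofReal_eq_zero]; linarith
  rw [Complex.cpow_neg]
  exact eq_inv_of_mul_eq_one_right hcst

lemma hc_real {σ : ℝ} (hσ : 0 < σ) (n : ℕ) : ((‖hc σ 1 1 n‖ : ℝ) : ℂ) = hc σ 1 1 n := by
  have hp : ∀ τ : ℝ, 0 < τ → ∃ q : ℝ, 0 ≤ q ∧ poch τ n = q := by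
    intro τ hτ
    induction n with
    | zero => exact ⟨1, zero_le_one, by simp [poch_zero]⟩
    | succ n ih =>
      obtain ⟨q, h1, h2⟩ := ih
      refine ⟨q * (τ + n), by positivity, ?_⟩
      rw [poch_succ, h2]; push_cast; ring
  obtain ⟨q, hq, e⟩ := hp σ hσ
  obtain ⟨q1, hq1, e1⟩ := hp 1 one_pos
  have e2 : hc σ 1 1 n = ((q * q1 / (n.factorial * n.factorial) : ℝ) : ℂ) := by
    unfold hc
    rw [e]
    push_cast at e1
    rw [e1, show (1:ℂ) + n = n + 1 by ring, Complex.Gamma_nat_eq_factorial]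
    push_cast
    rfl
  rw [e2, Complex.norm_real, Real.norm_of_nonneg (by positivity)]

lemma norm_hc_sum {σ : ℝ} (hσ : 0 < σ) {r : ℝ} (h0 : 0 ≤ r) (h1 : r < 1) :
    HasSum (fun n => ‖hc σ 1 1 n‖ * r ^ n) ((1 - r) ^ (-σ)) := by
  have h := hyp_hasSum σ 1 1 (norm_real_lt h0 h1)
  rw [binom _ h0 h1] at h
  have e : ((1 - r : ℝ):ℂ) ^ (-(σ:ℂ)) = (((1-r) ^ (-σ) : ℝ) : ℂ) := by
    rw [Complex.ofReal_cpow (by linarith)]; push_cast; rfl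
  rw [e] at h
  rw [← Complex.hasSum_ofReal]
  refine hs_congr h (fun n => ?_)
  push_cast
  rw [hc_real hσ]

lemma hyp_lower (a b c μ : ℂ) (hab : a + b - c = -μ) (hμ : μ.re < 0)
    (hL : (Complex.Gamma a)⁻¹ * (Complex.Gamma b)⁻¹ ≠ 0) :
    ∃ L : ℝ, 0 < L ∧ ∀ᶠ r : ℝ in 𝓝[<] (1:ℝ), L * (1 - r) ^ μ.re ≤ ‖hyp2F1reg a b c (r:ℂ)‖ := by
  have A1 := hc_asymp a b c
  have A2 := hc_asymp (-μ) 1 1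
  set σ : ℝ := -μ.re with hσd
  have hσ : 0 < σ := by simp only [hσd]; linarith
  have A3 := hc_asymp σ 1 1
  rw [hab] at A1
  rw [show -μ + 1 - 1 - 1 = -μ - 1 by ring, Complex.Gamma_one, inv_one, mul_one] at A2
  rw [show (σ:ℂ) + 1 - 1 - 1 = σ - 1 by ring, Complex.Gamma_one, inv_one, mul_one] at A3
  have hG : Complex.Gamma (-μ) ≠ 0 := Complex.Gamma_ne_zero_of_re_pos (by simpa using hμ)
  have hG3 : Complex.Gamma σ ≠ 0 := Complex.Gamma_ne_zero_of_re_pos (by simpa using hσ)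
  set lam := (Complex.Gamma a)⁻¹ * (Complex.Gamma b)⁻¹ * Complex.Gamma (-μ) with hlam
  have hlam0 : 0 < ‖lam‖ := norm_pos_iff.2 (mul_ne_zero hL hG)
  have A4 := A1.sub (A2.const_mul lam)
  have e0 : (Complex.Gamma a)⁻¹ * (Complex.Gamma b)⁻¹ - lam * (Complex.Gamma (-μ))⁻¹ = 0 := by
    rw [hlam]; field_simp; ring
  rw [e0] at A4
  have A5 := (A4.norm).mul (A3.norm.inv₀ (norm_ne_zero_iff.2 (inv_ne_zero hG3)))
  rw [norm_zero, zero_mul] at A5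
  obtain ⟨N, hN⟩ := ((A5.eventually (gt_mem_nhds (show 0 < ‖lam‖/4 by positivity))).and (eventually_gt_atTop 0)).exists_forall_of_atTop
  set ε : ℕ → ℂ := fun n => hc a b c n - lam * hc (-μ) 1 1 n with hε
  have A3e : ∀ᶠ n : ℕ in atTop, hc (σ:ℂ) 1 1 n / (n:ℂ) ^ ((σ:ℂ) - 1) ≠ 0 := A3.eventually_ne (inv_ne_zero hG3)
  obtain ⟨N', hN'⟩ := A3e.exists_forall_of_atTop
  set M := max N N'
  have hb : ∀ n, ‖ε n‖ ≤ ‖lam‖/4 * ‖hc σ 1 1 n‖ + (if n ∈ Finset.range M then ‖ε n‖ else 0) := by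
    intro n
    split_ifs with hn
    · have : 0 ≤ ‖lam‖/4 * ‖hc σ 1 1 n‖ := by positivity
      linarith
    · rw [Finset.mem_range, not_lt] at hn
      obtain ⟨h1, h2⟩ := hN n ((le_max_left _ _).trans hn)
      have h3 := hN' n ((le_max_right _ _).trans hn)
      have hn0 : (0:ℝ) < n := by exact_mod_cast h2
      have hcast : (n:ℂ) = ((n:ℝ):ℂ) := by simp
      have h4 : ‖(n:ℂ)^(-μ - 1)‖ = ‖(n:ℂ)^((σ:ℂ)-1)‖ := by
        rw [hcast, norm_cpow_pos hn0, norm_cpow_pos hn0]; simp [hσd]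
      have h5 : 0 < ‖(n:ℂ)^((σ:ℂ)-1)‖ := by
        rw [hcast, norm_cpow_pos hn0]; positivity
      rw [mul_div, ← sub_div, norm_div, norm_div, h4] at h1
      have h6 : 0 < ‖hc σ 1 1 n‖ := by
        rw [norm_pos_iff]; intro h; apply h3; rw [h, zero_div]
      have h7 : ‖hc a b c n - lam * hc (-μ) 1 1 n‖ / ‖hc σ 1 1 n‖ < ‖lam‖/4 := by
        refine lt_of_eq_of_lt ?_ h1
        field_simp
      rw [div_lt_iff₀ h6] at h7
      rw [add_zero]; exact h7.le
  set K := ∑ n ∈ Finset.range M, ‖ε n‖ with hK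
  have hK0 : 0 ≤ K := Finset.sum_nonneg fun _ _ => norm_nonneg _
  have hbig : ∀ᶠ r : ℝ in 𝓝[<] (1:ℝ), K ≤ ‖lam‖/4 * (1 - r) ^ μ.re := by
    have t1 : Tendsto (fun r : ℝ => 1 - r) (𝓝[<] 1) (𝓝[>] 0) := by
      apply tendsto_nhdsWithin_of_tendsto_nhds_of_eventually_within
      · have : Tendsto (fun r : ℝ => 1 - r) (𝓝 1) (𝓝 (1 - 1)) := (continuous_const.sub continuous_id).tendsto 1
        rw [sub_self] at this
        exact this.mono_left nhdsWithin_le_nhds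
      · filter_upwards [self_mem_nhdsWithin] with r hr
        simpa using hr
    have t2 := ((tendsto_rpow_neg_nhdsGT_zero hμ).comp t1).const_mul_atTop (show 0 < ‖lam‖/4 by positivity)
    exact t2.eventually_ge_atTop K
  refine ⟨‖lam‖/2, by positivity, ?_⟩
  have h01 : ∀ᶠ r : ℝ in 𝓝[<] (1:ℝ), 0 ≤ r := by
    filter_upwards [Ioo_mem_nhdsLT (show (0:ℝ) < 1 by norm_num)] with r hr using hr.1.le
  filter_upwards [hbig, h01, self_mem_nhdsWithin] with r hr h0 h1
  have h1 : r < 1 := h1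
  have S1 := hyp_hasSum a b c (norm_real_lt h0 h1)
  have S2 := (hyp_hasSum (-μ) 1 1 (norm_real_lt h0 h1)).mul_left lam
  rw [binom _ h0 h1, neg_neg] at S2
  have S3 := S1.sub S2
  have S4 := ((norm_hc_sum hσ h0 h1).mul_left (‖lam‖/4))
  have S5 : HasSum (fun n => if n ∈ Finset.range M then ‖ε n‖ else 0) K := by
    have := hasSum_sum_of_ne_finset_zero (L := SummationFilter.unconditional ℕ) (f := fun n => if n ∈ Finset.range M then ‖ε n‖ else 0) (s := Finset.range M)
      (fun n hn => by simp only [hn, if_false])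
    convert this using 1
    apply Finset.sum_congr rfl
    intro n hn
    simp only [hn, if_true]
  have hle : ‖hyp2F1reg a b c r - lam * ((1 - r : ℝ):ℂ) ^ μ‖ ≤ ‖lam‖/4 * (1 - r) ^ (-σ) + K := by
    refine S3.norm_le_of_bounded (S4.add S5) (fun n => ?_)
    rw [← mul_assoc, ← sub_mul, norm_mul, norm_pow, Complex.norm_real, Real.norm_of_nonneg h0]
    have hrn : r ^ n ≤ 1 := pow_le_one₀ h0 h1.le
    have hrn0 : 0 ≤ r ^ n := by positivity
    have := hb n
    have h8 : 0 ≤ (if n ∈ Finset.range M then ‖ε n‖ else 0) := by split_ifs <;> positivity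
    calc _ ≤ (‖lam‖/4 * ‖hc σ 1 1 n‖ + (if n ∈ Finset.range M then ‖ε n‖ else 0)) * r ^ n :=
          mul_le_mul_of_nonneg_right this hrn0
      _ ≤ _ := by nlinarith
  have hn1 : ‖lam * ((1 - r : ℝ):ℂ) ^ μ‖ = ‖lam‖ * (1 - r) ^ μ.re := by
    rw [norm_mul, norm_cpow_pos (by linarith)]
  rw [show -σ = μ.re by simp [hσd]] at hle
  have := norm_sub_norm_le (lam * ((1 - r : ℝ):ℂ) ^ μ) (hyp2F1reg a b c r)
  rw [norm_sub_rev] at this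
  rw [hn1] at this
  linarith

lemma re_mu (ν μ : ℂ) (ha : 0 < (ν - μ + 1).re) {s0 : ℝ} (h1 : s0 < 1)
    (hJ : IntegrableOn (fun w => J ν μ 0 s0 w) (Ioi 1)) : -(1/2) < μ.re := by
  by_contra hcon
  rw [not_lt] at hcon
  have hG : (Complex.Gamma ((ν - μ + 1)/2))⁻¹ * (Complex.Gamma ((ν - μ + 2)/2))⁻¹ ≠ 0 := by
    apply mul_ne_zero <;> apply inv_ne_zero <;> apply Complex.Gamma_ne_zero_of_re_pos
    · have : ((ν - μ + 1)/2).re = (ν - μ + 1).re / 2 := by simp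
      rw [this]; linarith
    · have : ((ν - μ + 2)/2).re = (ν - μ + 1).re / 2 + 1/2 := by simp; ring
      rw [this]; linarith
  obtain ⟨L, hL, hev⟩ := hyp_lower ((ν - μ + 1)/2) ((ν - μ + 2)/2) (ν + 3/2) μ (by ring) (by linarith) hG
  have t1 : Tendsto (fun w : ℝ => 1 / w ^ 2) (𝓝[>] 1) (𝓝[<] 1) := by
    apply tendsto_nhdsWithin_of_tendsto_nhds_of_eventually_within
    · have : ContinuousAt (fun w : ℝ => 1 / w ^ 2) 1 := by
        apply ContinuousAt.div <;> first | fun_prop | norm_num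
      have := this.tendsto
      norm_num at this
      simpa using this.mono_left nhdsWithin_le_nhds
    · filter_upwards [self_mem_nhdsWithin] with w hw
      have hw : 1 < w := hw
      show 1 / w ^ 2 < 1
      rw [div_lt_one (by positivity)]; nlinarith
  have hev2 := t1.eventually hev
  set g : ℝ → ℝ := fun w => w ^ (-(ν - μ + 1)).re * (w + 1) ^ (-μ.re) * (w + 1 - 2 * s0) ^ (μ.re - 1/2) with hg
  have hgc : ContinuousAt g 1 := by
    apply ContinuousAt.mul
    · apply ContinuousAt.mul
      · exact continuousAt_id.rpow_const (Or.inl (by norm_num))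
      · exact ContinuousAt.rpow_const (by fun_prop) (Or.inl (by norm_num))
    · exact ContinuousAt.rpow_const (by fun_prop) (Or.inl (by norm_num; intro h; linarith))
  have hg1 : 0 < g 1 := by
    have : 0 < (1:ℝ) + 1 - 2 * s0 := by linarith
    simp only [hg]; positivity
  have hev3 : ∀ᶠ w in 𝓝[>] (1:ℝ), g 1 / 2 < g w :=
    (hgc.tendsto.mono_left nhdsWithin_le_nhds).eventually (lt_mem_nhds (by linarith))
  set c := g 1 / 2 * L * 2 ^ (-(1/2):ℝ) with hc'
  have hc0 : 0 < c := by positivity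
  have hlow : ∀ᶠ w in 𝓝[>] (1:ℝ), c * (w - 1)⁻¹ ≤ ‖J ν μ 0 s0 w‖ := by
    filter_upwards [hev2, hev3, self_mem_nhdsWithin] with w h2 h3 hw
    have hw : 1 < w := hw
    rw [J_norm ν μ 0 h1 hw]
    unfold U V
    rw [norm_mul, norm_cpow_pos (by linarith), pow_zero, div_one]
    have e1 : (((1 / w ^ 2 : ℝ)):ℂ) = 1 / (w:ℂ)^2 := by push_cast; rfl
    rw [e1] at h2
    rw [add_zero]
    have p1 : 0 < 1 - 1 / w ^ 2 := by
      have : 1 / w ^ 2 < 1 := by rw [div_lt_one (by positivity)]; nlinarith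
      linarith
    have p2 : 1 - 1 / w ^ 2 ≤ 1 := by
      have : 0 < 1 / w ^ 2 := by positivity
      linarith
    have p3 : 1 - 1 / w ^ 2 ≤ 2 * (w - 1) := by
      have e : 1 - 1 / w ^ 2 = (w^2 - 1) / w ^ 2 := by field_simp
      rw [e, div_le_iff₀ (by positivity)]
      nlinarith [mul_pos (sub_pos.2 hw) (sub_pos.2 hw), sq_nonneg w, mul_pos (mul_pos (sub_pos.2 hw) (sub_pos.2 hw)) (show 0 < w by linarith)]
    have q1 : (1 - 1 / w ^ 2) ^ (-(1/2):ℝ) ≤ (1 - 1 / w ^ 2) ^ μ.re :=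
      Real.rpow_le_rpow_of_exponent_ge p1 p2 hcon
    have q2 : (2 * (w - 1)) ^ (-(1/2):ℝ) ≤ (1 - 1 / w ^ 2) ^ (-(1/2):ℝ) :=
      Real.rpow_le_rpow_of_nonpos p1 p3 (by norm_num)
    have hw1 : 0 < w - 1 := by linarith
    rw [Real.mul_rpow (by norm_num) hw1.le] at q2
    have q3 : (w - 1)⁻¹ = (w - 1) ^ (-(1/2):ℝ) * (w - 1) ^ (-(1/2):ℝ) := by
      rw [← Real.rpow_add hw1, ← Real.rpow_neg_one]; norm_num
    have q4 : L * (2 ^ (-(1/2):ℝ) * (w - 1) ^ (-(1/2):ℝ)) ≤ ‖hyp2F1reg ((ν - μ + 1)/2) ((ν - μ + 2)/2) (ν + 3/2) (1 / (w:ℂ)^2)‖ := by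
      refine le_trans ?_ h2
      exact mul_le_mul_of_nonneg_left (q2.trans q1) hL.le
    have hwp : 0 ≤ (w - 1) ^ (-(1/2):ℝ) := by positivity
    calc c * (w - 1)⁻¹ = (g 1 / 2) * (L * (2 ^ (-(1/2):ℝ) * (w - 1) ^ (-(1/2):ℝ))) * (w - 1) ^ (-(1/2):ℝ) := by
          rw [q3, hc']; ring
      _ ≤ g w * ‖hyp2F1reg ((ν - μ + 1)/2) ((ν - μ + 2)/2) (ν + 3/2) (1 / (w:ℂ)^2)‖ * (w - 1) ^ (-(1/2):ℝ) := by
          apply mul_le_mul_of_nonneg_right _ hwp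
          exact mul_le_mul h3.le q4 (by positivity) (by linarith)
      _ = _ := by simp only [hg]; ring
  rw [eventually_nhdsWithin_iff, Metric.eventually_nhds_iff] at hlow
  obtain ⟨η, hη, hball⟩ := hlow
  set b := 1 + η / 2
  have hI : IntegrableOn (fun w : ℝ => (w - 1)⁻¹) (Ioc 1 b) := by
    have hJ' := (hJ.mono_set (show Ioc 1 b ⊆ Ioi 1 from fun y hy => hy.1)).norm.const_mul c⁻¹
    refine Integrable.mono' hJ' (by fun_prop) ?_
    filter_upwards [ae_restrict_mem measurableSet_Ioc] with w hw
    have := hball (y := w) (by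
      rw [Real.dist_eq, abs_of_pos (by linarith [hw.1])]
      have := hw.2
      simp only [b] at this; linarith) hw.1
    rw [Real.norm_of_nonneg (inv_nonneg.2 (by linarith [hw.1]))]
    rw [inv_mul_eq_div, le_div_iff₀ hc0, mul_comm]
    exact this
  have hb1 : 1 < b := by simp only [b]; linarith
  have hII : IntervalIntegrable (fun w : ℝ => (w - 1)⁻¹) volume 1 b := by
    rw [intervalIntegrable_iff_integrableOn_Ioc_of_le hb1.le]; exact hI
  rw [intervalIntegrable_sub_inv_iff] at hII
  rcases hII with h | h
  · exact hb1.ne h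
  · exact h left_mem_uIcc

end NF

namespace NF
open Filter Topology MeasureTheory Set

lemma cpow_exp {x : ℝ} (hx : 0 < x) (p : ℂ) : (x:ℂ) ^ p = Complex.exp ((Real.log x : ℂ) * p) := by
  rw [Complex.cpow_def_of_ne_zero (by rw [Ne, Complex.ofReal_eq_zero]; exact hx.ne'), Complex.ofReal_log hx.le]

noncomputable def q (w : ℝ) : ℂ := ((w - 1 : ℝ):ℂ) ^ (-(1/2):ℂ) * ((w + 1 : ℝ):ℂ) ^ (-(1/2):ℂ)

lemma q_eq {w : ℝ} (hw : 1 < w) : q w = Complex.exp ((Real.log (w^2 - 1) : ℂ) * (-(1/2))) := by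
  unfold q
  rw [cpow_exp (by linarith), cpow_exp (by linarith), ← Complex.exp_add, show w^2 - 1 = (w-1)*(w+1) by ring,
    Real.log_mul (by linarith) (by linarith)]
  push_cast
  ring_nf

lemma sub_img : Set.image (fun t : ℝ => t ^ (-(1/2):ℝ)) (Ioo 0 1) = Ioi 1 := by
  ext w
  constructor
  · rintro ⟨t, ht, rfl⟩
    exact Real.one_lt_rpow_of_pos_of_lt_one_of_neg ht.1 ht.2 (by norm_num)
  · intro hw
    have hw : 1 < w := hw
    refine ⟨w ^ (-2:ℝ), ⟨by positivity, Real.rpow_lt_one_of_one_lt_of_neg hw (by norm_num)⟩, ?_⟩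
    simp only
    rw [← Real.rpow_mul (by linarith)]; norm_num

lemma sub_inj : InjOn (fun t : ℝ => t ^ (-(1/2):ℝ)) (Ioo 0 1) := by
  intro s hs t ht h
  simp only at h
  have : (s ^ (-(1/2):ℝ)) ^ (-2:ℝ) = (t ^ (-(1/2):ℝ)) ^ (-2:ℝ) := by rw [h]
  rw [← Real.rpow_mul hs.1.le, ← Real.rpow_mul ht.1.le] at this
  norm_num at this
  exact this

lemma sub_deriv : ∀ t ∈ Ioo (0:ℝ) 1, HasDerivWithinAt (fun t : ℝ => t ^ (-(1/2):ℝ)) (-(1/2) * t ^ (-(1/2) - 1:ℝ)) (Ioo 0 1) t := by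
  intro t ht
  exact (Real.hasDerivAt_rpow_const (Or.inl ht.1.ne')).hasDerivWithinAt

lemma sub_eq (p : ℂ) {t : ℝ} (ht : t ∈ Ioo (0:ℝ) 1) :
    |-(1/2) * t ^ (-(1/2) - 1:ℝ)| • (((t ^ (-(1/2):ℝ) : ℝ) : ℂ) ^ (-p) * q (t ^ (-(1/2):ℝ))) =
      (1/2) * ((t:ℂ) ^ (p/2 - 1) * (1 - (t:ℂ)) ^ ((1/2:ℂ) - 1)) := by
  obtain ⟨h0, h1⟩ := ht
  have hw : 1 < t ^ (-(1/2):ℝ) := Real.one_lt_rpow_of_pos_of_lt_one_of_neg h0 h1 (by norm_num)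
  have e1 : |-(1/2) * t ^ (-(1/2) - 1:ℝ)| = 1/2 * Real.exp (Real.log t * (-(3/2))) := by
    rw [abs_mul, abs_of_neg (by norm_num), abs_of_pos (by positivity), Real.rpow_def_of_pos h0]
    norm_num
  have e2 : (t ^ (-(1/2):ℝ))^2 - 1 = (1 - t) / t := by
    rw [← Real.rpow_natCast, ← Real.rpow_mul h0.le]
    norm_num
    rw [Real.rpow_neg_one]
    field_simp
  have e3 : (1:ℂ) - t = ((1 - t : ℝ):ℂ) := by push_cast; rfl
  rw [e1, q_eq hw, cpow_exp (by linarith), e2, e3, cpow_exp h0, cpow_exp (by linarith),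
    Real.log_div (by linarith) h0.ne', Real.log_rpow h0, Complex.real_smul]
  push_cast
  rw [mul_assoc, ← Complex.exp_add, ← Complex.exp_add, ← Complex.exp_add]
  congr 2
  ring

lemma beta_int {p : ℂ} (hp : 0 < p.re) : IntegrableOn (fun w : ℝ => (w:ℂ) ^ (-p) * q w) (Ioi 1) ∧
    ∫ w in Ioi (1:ℝ), (w:ℂ) ^ (-p) * q w = 1/2 * (Real.sqrt Real.pi) * Complex.Gamma (p/2) / Complex.Gamma ((p+1)/2) := by
  have hp2 : 0 < (p/2).re := by simpa using hp
  have hconv := Complex.betaIntegral_convergent hp2 (show 0 < (1/2:ℂ).re by norm_num)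
  rw [intervalIntegrable_iff_integrableOn_Ioc_of_le zero_le_one, integrableOn_Ioc_iff_integrableOn_Ioo] at hconv
  constructor
  · rw [← sub_img, integrableOn_image_iff_integrableOn_abs_deriv_smul measurableSet_Ioo sub_deriv sub_inj]
    refine (hconv.const_mul (1/2)).congr ?_
    filter_upwards [ae_restrict_mem measurableSet_Ioo] with t ht
    exact (sub_eq p ht).symm
  · rw [← sub_img, integral_image_eq_integral_abs_deriv_smul measurableSet_Ioo sub_deriv sub_inj]
    rw [setIntegral_congr_fun measurableSet_Ioo (fun t ht => sub_eq p ht), integral_const_mul]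
    have hb : ∫ t in Ioo (0:ℝ) 1, ((t:ℂ) ^ (p/2 - 1) * (1 - (t:ℂ)) ^ ((1/2:ℂ) - 1)) = Complex.betaIntegral (p/2) (1/2) := by
      unfold Complex.betaIntegral
      rw [intervalIntegral.integral_of_le zero_le_one, integral_Ioc_eq_integral_Ioo]
    rw [hb]
    have hG := Complex.Gamma_mul_Gamma_eq_betaIntegral hp2 (show 0 < (1/2:ℂ).re by norm_num)
    have hne : Complex.Gamma (p/2 + 1/2) ≠ 0 := Complex.Gamma_ne_zero_of_re_pos (by simp; linarith)
    have hh : Complex.Gamma (1/2) = (Real.sqrt Real.pi : ℂ) := by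
      rw [Complex.Gamma_one_half_eq, Real.sqrt_eq_rpow, Complex.ofReal_cpow Real.pi_pos.le]
      push_cast; rfl
    rw [show (p+1)/2 = p/2 + 1/2 by ring, eq_div_iff hne, mul_assoc, mul_comm (Complex.betaIntegral _ _), ← hG, hh]
    ring

end NF

namespace NF
open Filter Topology MeasureTheory Set

lemma q_one_add {w : ℝ} (hw : 1 < w) : ‖(1:ℂ) / ((w+1:ℝ):ℂ)‖ ≤ 1 := by
  rw [norm_div, norm_one, Complex.norm_real, Real.norm_of_nonneg (by linarith), div_le_one (by linarith)]
  linarith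

lemma beta_int1 {p : ℂ} (hp : 0 < p.re) :
    IntegrableOn (fun w : ℝ => (w:ℂ) ^ (-p) * q w / ((w+1:ℝ):ℂ)) (Ioi 1) ∧
    ∫ w in Ioi (1:ℝ), (w:ℂ) ^ (-p) * q w / ((w+1:ℝ):ℂ) =
      p * ((∫ w in Ioi (1:ℝ), (w:ℂ) ^ (-p) * q w) - ∫ w in Ioi (1:ℝ), (w:ℂ) ^ (-(p+1)) * q w) := by
  have i0 := (beta_int hp).1
  have i1 := (beta_int (p := p + 1) (by simp; linarith)).1
  have i2 : IntegrableOn (fun w : ℝ => (w:ℂ) ^ (-p) * q w / ((w+1:ℝ):ℂ)) (Ioi 1) := by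
    refine Integrable.mono i0 ?_ ?_
    · have hm : AEStronglyMeasurable (fun w : ℝ => (1:ℂ) / ((w+1:ℝ):ℂ)) (volume.restrict (Ioi 1)) := by
        apply ContinuousOn.aestronglyMeasurable _ measurableSet_Ioi
        intro w hw
        apply ContinuousAt.continuousWithinAt
        apply ContinuousAt.div <;> first | fun_prop | skip
        rw [Ne, Complex.ofReal_eq_zero]
        have : 1 < w := hw
        linarith
      refine (i0.aestronglyMeasurable.mul hm).congr ?_
      filter_upwards with w
      simp [div_eq_mul_inv]
    · filter_upwards [ae_restrict_mem measurableSet_Ioi] with w hw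
      rw [div_eq_mul_one_div, norm_mul]
      exact mul_le_of_le_one_right (norm_nonneg _) (q_one_add hw)
  refine ⟨i2, ?_⟩
  set G : ℝ → ℂ := fun w => (w:ℂ) ^ (-p) * (((w - 1 : ℝ):ℂ) ^ (1/2:ℂ) * ((w + 1 : ℝ):ℂ) ^ (-(1/2):ℂ)) with hG
  have hd : ∀ w ∈ Ioi (1:ℝ), HasDerivAt G (-p * ((w:ℂ) ^ (-p) * q w - (w:ℂ) ^ (-(p+1)) * q w) +
      (w:ℂ) ^ (-p) * q w / ((w+1:ℝ):ℂ)) w := by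
    intro w hw
    have hw : 1 < w := hw
    have a0 := cpow_deriv (hasDerivAt_id w) (show 0 < w by linarith) (-p)
    have a1 := cpow_deriv ((hasDerivAt_id w).sub_const 1) (show 0 < w - 1 by linarith) (1/2)
    have a2 := cpow_deriv ((hasDerivAt_id w).add_const 1) (show 0 < w + 1 by linarith) (-(1/2))
    refine (a0.fun_mul (a1.fun_mul a2)).congr_deriv ?_
    have w0 := w_ne hw
    have w1 := w1_ne hw
    have w2 := w2_ne hw
    have e : ((w-1:ℝ):ℂ)^(1/2:ℂ) = ((w - 1 : ℝ) : ℂ) ^ (-(1 / 2) : ℂ) * ((w-1:ℝ):ℂ) := by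
      rw [show (1/2:ℂ) = -(1/2) + 1 by norm_num, Complex.cpow_add _ _ (by push_cast; exact w1), Complex.cpow_one]
      norm_num
    have e' : (w:ℂ) ^ (-(p+1)) = (w:ℂ) ^ (-p) / w := by
      rw [neg_add, ← sub_eq_add_neg, Complex.cpow_sub _ _ w0, Complex.cpow_one]
    unfold q
    simp only [id]
    rw [e, e']
    push_cast
    field_simp
    ring
  have hinf : Tendsto G atTop (𝓝 0) := by
    refine squeeze_zero_norm' ?_ (tendsto_rpow_neg_atTop hp)
    filter_upwards [eventually_gt_atTop 1] with w hw
    simp only [hG]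
    rw [norm_mul, norm_mul, norm_cpow_pos (by linarith), norm_cpow_pos (by linarith), norm_cpow_pos (by linarith)]
    have : (w - 1) ^ (1/2:ℂ).re * (w + 1) ^ (-(1/2):ℂ).re ≤ 1 := by
      have e1 : (1/2:ℂ).re = 1/2 := by norm_num
      have e2 : (-(1/2):ℂ).re = -(1/2) := by norm_num
      rw [e1, e2, Real.rpow_neg (by linarith), mul_inv_le_iff₀ (Real.rpow_pos_of_pos (by linarith) _), one_mul]
      exact Real.rpow_le_rpow (by linarith) (by linarith) (by norm_num)
    rw [Complex.neg_re]
    exact mul_le_of_le_one_right (Real.rpow_nonneg (by linarith) _) this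
  have hc1 : ContinuousWithinAt G (Ici 1) 1 := by
    apply ContinuousAt.continuousWithinAt
    apply ContinuousAt.mul
    · exact ContinuousAt.cpow (by fun_prop) continuousAt_const (by left; norm_num)
    · apply ContinuousAt.mul
      · have := (Complex.continuous_ofReal_cpow_const (y := (1/2:ℂ)) (by norm_num)).comp (continuous_id.sub (continuous_const (y := (1:ℝ))))
        exact this.continuousAt
      · exact ContinuousAt.cpow (by fun_prop) continuousAt_const (by left; rw [Complex.ofReal_re]; norm_num)
  have key := integral_Ioi_of_hasDerivAt_of_tendsto hc1 hd (((i0.sub i1).const_mul (-p)).add i2) hinf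
  have hG1 : G 1 = 0 := by simp [hG]
  rw [hG1, sub_zero] at key
  have a1 := integral_add ((i0.sub i1).const_mul (-p)) i2
  simp only [Pi.sub_apply] at a1
  rw [a1, integral_const_mul] at key
  have a2 := integral_sub i0 i1
  rw [a2] at key
  linear_combination key

end NF

namespace NF
open Filter Topology MeasureTheory Set

noncomputable def bb (p : ℂ) : ℂ := 1/2 * (Real.sqrt Real.pi) * Complex.Gamma (p/2) / Complex.Gamma ((p+1)/2)

lemma w_pow_eq (ν μ : ℂ) (n : ℕ) {w : ℝ} (hw : 1 < w) :
    (w:ℂ) ^ (-(ν - μ + 1)) * (1 / (w:ℂ)^2) ^ n = (w:ℂ) ^ (-(ν - μ + 1 + 2 * n)) := by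
  have w0 := w_ne hw
  rw [show -(ν - μ + 1 + 2 * (n:ℂ)) = -(ν - μ + 1) + -(2 * (n:ℂ)) by ring, Complex.cpow_add _ _ w0, Complex.cpow_neg _ (2 * (n:ℂ)), show (2 * (n:ℂ)) = ((2 * n : ℕ) : ℂ) by push_cast; rfl,
    Complex.cpow_natCast, pow_mul]
  simp

lemma U_hasSum (ν μ : ℂ) {w : ℝ} (hw : 1 < w) :
    HasSum (fun n : ℕ => hc ((ν - μ + 1)/2) ((ν - μ + 2)/2) (ν + 3/2) n * (w:ℂ) ^ (-(ν - μ + 1 + 2 * n))) (U ν μ w) := by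
  have := (hyp_hasSum ((ν - μ + 1)/2) ((ν - μ + 2)/2) (ν + 3/2) (inv_sq_norm hw)).mul_left ((w:ℂ) ^ (-(ν - μ + 1)))
  unfold U V
  rw [add_zero]
  refine hs_congr this (fun n => ?_)
  rw [← w_pow_eq ν μ n hw]; ring

lemma J0_eq (ν μ : ℂ) {w : ℝ} (hw : 1 < w) : J ν μ 0 0 w = U ν μ w * q w := by
  unfold J Y q
  rw [mul_zero, sub_zero, pow_zero, div_one]
  have w2 : ((w + 1 : ℝ):ℂ) ≠ 0 := by push_cast; exact w2_ne hw
  rw [mul_assoc, ← Complex.cpow_add _ _ w2]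
  congr 3; ring_nf

lemma J1_eq (ν μ : ℂ) {w : ℝ} (hw : 1 < w) : J ν μ 1 0 w = U ν μ w * q w / ((w + 1 : ℝ):ℂ) := by
  rw [← J0_eq ν μ hw]
  unfold J
  rw [mul_zero, sub_zero, pow_zero, div_one, pow_one]

lemma norm_term {p : ℂ} {w : ℝ} (hw : 1 < w) :
    ((‖(w:ℂ) ^ (-p) * q w‖ : ℝ) : ℂ) = (w:ℂ) ^ (-(p.re:ℂ)) * q w := by
  have e : q w = ((Real.exp (Real.log (w^2 - 1) * (-(1/2))) : ℝ) : ℂ) := by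
    rw [q_eq hw]; push_cast; rfl
  rw [norm_mul, norm_cpow_pos (by linarith), e, Complex.norm_real, Real.norm_of_nonneg (Real.exp_pos _).le]
  push_cast
  rw [Complex.ofReal_cpow (by linarith)]
  simp

lemma norm_int {p : ℂ} (hp : 0 < p.re) : ∫ w in Ioi (1:ℝ), ‖(w:ℂ) ^ (-p) * q w‖ = ‖bb (p.re : ℂ)‖ := by
  have h := (beta_int (p := (p.re:ℂ)) (by simpa using hp)).2
  rw [← setIntegral_congr_fun measurableSet_Ioi (fun w hw => norm_term (p := p) hw), integral_complex_ofReal] at h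
  have h2 : ((∫ w in Ioi (1:ℝ), ‖(w:ℂ) ^ (-p) * q w‖ : ℝ) : ℂ) = bb (p.re:ℂ) := h
  have h3 : 0 ≤ ∫ w in Ioi (1:ℝ), ‖(w:ℂ) ^ (-p) * q w‖ := integral_nonneg (fun _ => norm_nonneg _)
  rw [← h2, Complex.norm_real, Real.norm_of_nonneg h3]

lemma bb_eq {a : ℂ} (ha : 0 < a.re) (n : ℕ) :
    bb (2 * a + 2 * n) = 1/2 * (Real.sqrt Real.pi) * Complex.Gamma a * hc a 1 (a + 1/2) n := by
  unfold bb hc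
  have h1 : poch 1 n = n.factorial := by
    have := Gamma_add_nat 1 (ne_neg_nat_of_re_pos (by simp)) n
    rw [add_comm, Complex.Gamma_nat_eq_factorial, Complex.Gamma_one, mul_one] at this
    exact this.symm
  rw [show (2 * a + 2 * n)/2 = a + n by ring, show (2 * a + 2 * n + 1)/2 = a + 1/2 + n by ring,
    Gamma_add_nat a (ne_neg_nat_of_re_pos ha) n, h1]
  have h3 : (n.factorial : ℂ) ≠ 0 := by exact_mod_cast n.factorial_ne_zero
  field_simp

lemma sum_norms (ν μ : ℂ) (ha : 0 < (ν - μ + 1).re) (hμ : -(1/2) < μ.re) :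
    Summable (fun n : ℕ => ‖hc ((ν - μ + 1)/2) ((ν - μ + 2)/2) (ν + 3/2) n‖ * ‖bb ((ν - μ + 1 + 2 * n : ℂ).re : ℂ)‖) := by
  obtain ⟨C1, hC1, b1⟩ := hc_bound ((ν - μ + 1)/2) ((ν - μ + 2)/2) (ν + 3/2)
  set α : ℝ := (ν - μ + 1).re / 2 with hα
  have hα0 : 0 < (α:ℂ).re := by rw [Complex.ofReal_re]; simp only [hα]; linarith
  obtain ⟨C2, hC2, b2⟩ := hc_bound (α:ℂ) 1 (α + 1/2)
  set D := ‖1/2 * (Real.sqrt Real.pi : ℂ) * Complex.Gamma α‖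
  have e1 : ((ν - μ + 1)/2 + (ν - μ + 2)/2 - (ν + 3/2) - 1).re = -μ.re - 1 := by
    rw [show (ν - μ + 1)/2 + (ν - μ + 2)/2 - (ν + 3/2) - 1 = -μ - 1 by ring]; simp
  have e2 : ((α:ℂ) + 1 - (α + 1/2) - 1).re = -(1/2) := by
    rw [show (α:ℂ) + 1 - (α + 1/2) - 1 = -(1/2) by ring]; norm_num
  rw [e1] at b1
  rw [e2] at b2
  have hs : Summable (fun n : ℕ => C1 * (D * C2) * ((n:ℝ) + 1) ^ (-μ.re - 3/2)) := by
    apply Summable.mul_left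
    have := (Real.summable_nat_rpow (p := -μ.re - 3/2)).2 (by linarith)
    have := (summable_nat_add_iff 1).2 this
    simpa using this
  refine Summable.of_nonneg_of_le (fun n => by positivity) (fun n => ?_) hs
  have e3 : ((ν - μ + 1 + 2 * n : ℂ).re : ℂ) = 2 * (α:ℂ) + 2 * n := by
    rw [Complex.add_re, hα]
    simp
    ring
  rw [e3, bb_eq hα0, norm_mul]
  have h0 : (0:ℝ) < n + 1 := by positivity
  calc _ ≤ (C1 * ((n:ℝ)+1) ^ (-μ.re - 1)) * (D * (C2 * ((n:ℝ)+1)^(-(1/2):ℝ))) := by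
        gcongr
        · exact b1 n
        · exact b2 n
    _ = _ := by
      rw [show -μ.re - 3/2 = (-μ.re - 1) + (-(1/2)) by ring, Real.rpow_add h0]; ring

lemma p_re_pos {ν μ : ℂ} (ha : 0 < (ν - μ + 1).re) (n : ℕ) : 0 < (ν - μ + 1 + 2 * n : ℂ).re := by
  rw [Complex.add_re]
  have : (2 * (n:ℂ)).re = 2 * n := by simp
  rw [this]; positivity

lemma II0_hasSum (ν μ : ℂ) (ha : 0 < (ν - μ + 1).re) (hμ : -(1/2) < μ.re) :
    HasSum (fun n : ℕ => hc ((ν - μ + 1)/2) ((ν - μ + 2)/2) (ν + 3/2) n * bb (ν - μ + 1 + 2 * n)) (II ν μ 0 0) := by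
  have h := hasSum_integral_of_summable_integral_norm (μ := volume.restrict (Ioi (1:ℝ)))
    (F := fun (n : ℕ) (w : ℝ) => hc ((ν - μ + 1)/2) ((ν - μ + 2)/2) (ν + 3/2) n * ((w:ℂ) ^ (-(ν - μ + 1 + 2 * n)) * q w))
    (fun n => (beta_int (p_re_pos ha n)).1.const_mul _) ?_
  · have e : II ν μ 0 0 = ∫ w in Ioi (1:ℝ), ∑' n : ℕ, hc ((ν - μ + 1)/2) ((ν - μ + 2)/2) (ν + 3/2) n * ((w:ℂ) ^ (-(ν - μ + 1 + 2 * n)) * q w) := by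
      unfold II
      apply setIntegral_congr_fun measurableSet_Ioi
      intro w hw
      simp only
      rw [J0_eq ν μ hw, ← ((U_hasSum ν μ hw).mul_right (q w)).tsum_eq]
      simp only [mul_assoc]
    rw [e]
    refine hs_congr h (fun n => ?_)
    rw [integral_const_mul, (beta_int (p_re_pos ha n)).2]
    rfl
  · refine (sum_norms ν μ ha hμ).congr (fun n => ?_)
    simp only [norm_mul (hc _ _ _ _)]
    rw [integral_const_mul, norm_int (p_re_pos ha n)]

lemma II1_hasSum (ν μ : ℂ) (ha : 0 < (ν - μ + 1).re) (hμ : -(1/2) < μ.re) :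
    HasSum (fun n : ℕ => hc ((ν - μ + 1)/2) ((ν - μ + 2)/2) (ν + 3/2) n *
      ((ν - μ + 1 + 2 * n) * (bb (ν - μ + 1 + 2 * n) - bb (ν - μ + 1 + 2 * n + 1)))) (II ν μ 1 0) := by
  have h := hasSum_integral_of_summable_integral_norm (μ := volume.restrict (Ioi (1:ℝ)))
    (F := fun (n : ℕ) (w : ℝ) => hc ((ν - μ + 1)/2) ((ν - μ + 2)/2) (ν + 3/2) n * ((w:ℂ) ^ (-(ν - μ + 1 + 2 * n)) * q w / ((w+1:ℝ):ℂ)))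
    (fun n => (beta_int1 (p_re_pos ha n)).1.const_mul _) ?_
  · have e : II ν μ 1 0 = ∫ w in Ioi (1:ℝ), ∑' n : ℕ, hc ((ν - μ + 1)/2) ((ν - μ + 2)/2) (ν + 3/2) n * ((w:ℂ) ^ (-(ν - μ + 1 + 2 * n)) * q w / ((w+1:ℝ):ℂ)) := by
      unfold II
      apply setIntegral_congr_fun measurableSet_Ioi
      intro w hw
      simp only
      rw [J1_eq ν μ hw, ← (((U_hasSum ν μ hw).mul_right (q w)).div_const _).tsum_eq]
      simp only [mul_assoc, mul_div_assoc]
    rw [e]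
    refine hs_congr h (fun n => ?_)
    have hp1 : 0 < (ν - μ + 1 + 2 * n + 1 : ℂ).re := by
      have := p_re_pos ha n
      rw [Complex.add_re, Complex.one_re]; linarith
    rw [integral_const_mul, (beta_int1 (p_re_pos ha n)).2, (beta_int (p_re_pos ha n)).2, (beta_int hp1).2]
    rfl
  · refine Summable.of_nonneg_of_le (fun n => integral_nonneg (fun _ => norm_nonneg _)) (fun n => ?_) (sum_norms ν μ ha hμ)
    simp only [norm_mul (hc _ _ _ _)]
    rw [integral_const_mul, ← norm_int (p_re_pos ha n)]
    apply mul_le_mul_of_nonneg_left _ (norm_nonneg _)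
    apply setIntegral_mono_on (beta_int1 (p_re_pos ha n)).1.norm (beta_int (p_re_pos ha n)).1.norm measurableSet_Ioi
    intro w hw
    rw [div_eq_mul_one_div, norm_mul]
    exact mul_le_of_le_one_right (norm_nonneg _) (q_one_add hw)

end NF

namespace NF
open Filter Topology MeasureTheory Set

noncomputable def kk (a : ℂ) (n : ℕ) : ℂ :=
  (Complex.Gamma (a + 1/2 + n) / Complex.Gamma (a + n)) ^ 2 / (a + n)

lemma half_re {a : ℂ} (ha : 0 < a.re) : 0 < (a + 1/2).re := by
  rw [Complex.add_re]; norm_num; linarith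

lemma addn_ne {a : ℂ} (ha : 0 < a.re) (n : ℕ) : a + n ≠ 0 := by
  intro h
  have := congrArg Complex.re h
  simp at this
  have h2 : (0:ℝ) ≤ n := Nat.cast_nonneg n
  linarith

lemma kk_succ {a : ℂ} (ha : 0 < a.re) (n : ℕ) :
    kk a (n+1) = kk a n * (1 + 1 / (4 * ((a + n) * (a + n + 1)))) := by
  unfold kk
  have h1 := addn_ne ha n
  have h2 := addn_ne (half_re ha) n
  have h3 : a + n + 1 ≠ 0 := by have := addn_ne ha (n+1); push_cast at this; rwa [add_assoc]
  have g1 : Complex.Gamma (a + n) ≠ 0 := Complex.Gamma_ne_zero_of_re_pos (by simp; positivity)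
  push_cast
  rw [← add_assoc, ← add_assoc, Complex.Gamma_add_one _ h1, Complex.Gamma_add_one _ h2]
  field_simp
  ring

lemma kk_tendsto {a : ℂ} (ha : 0 < a.re) : Tendsto (kk a) atTop (𝓝 1) := by
  have h1 := Gamma_asymp (a + 1/2)
  have h2 := Gamma_asymp a
  have h3 := ((h1.div h2 one_ne_zero).pow 2).mul (tendsto_nat_div a)
  simp only [div_one, one_pow, mul_one] at h3
  refine h3.congr' ?_
  filter_upwards [eventually_ge_atTop 1] with n hn
  have n0 : (n:ℂ) ≠ 0 := by exact_mod_cast (by omega : n ≠ 0)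
  have f0 : (n.factorial:ℂ) ≠ 0 := by exact_mod_cast n.factorial_ne_zero
  have g1 : Complex.Gamma (a + n) ≠ 0 := Complex.Gamma_ne_zero_of_re_pos (by simp; positivity)
  have hs : ((n:ℂ) ^ (1/2 : ℂ))^2 = n := by
    rw [← Complex.cpow_nat_mul]; norm_num
  have p0 : (n:ℂ) ^ (a - 1) ≠ 0 := by simp [Complex.cpow_eq_zero_iff, n0]
  have q0 : (n:ℂ) ^ (1/2 : ℂ) ≠ 0 := by simp [Complex.cpow_eq_zero_iff, n0]
  have e : (n:ℂ) ^ (a + 1/2 - 1) = (n:ℂ)^(a-1) * (n:ℂ) ^ (1/2 : ℂ) := by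
    rw [← Complex.cpow_add _ _ n0]; ring_nf
  have h1 := addn_ne ha n
  unfold kk
  simp only [Pi.div_apply]
  rw [e]
  generalize (n:ℂ) ^ (a - 1) = P at *
  generalize (n:ℂ) ^ (1/2 : ℂ) = S at *
  generalize Complex.Gamma (a + 1/2 + n) = G at *
  rw [show G / (P * S * (n.factorial:ℂ)) / (Complex.Gamma (a + n) / (P * (n.factorial:ℂ))) = (G / Complex.Gamma (a+n)) / S by field_simp]
  rw [div_pow _ S, hs]
  field_simp

lemma kk_bound {a : ℂ} (ha : 0 < a.re) : ∃ K : ℝ, 0 ≤ K ∧ ∀ n : ℕ, ‖(a + n) * (1 - kk a n)‖ ≤ K * (1 + ‖a‖ / a.re) := by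
  obtain ⟨K, hK⟩ := (Metric.isBounded_range_of_tendsto _ (kk_tendsto ha)).exists_norm_le
  have hK' : ∀ n, ‖kk a n‖ ≤ K := fun n => hK _ ⟨n, rfl⟩
  have K0 : 0 ≤ K := (norm_nonneg _).trans (hK' 0)
  set α := a.re with hα
  have key : ∀ N m : ℕ, ‖kk a (N + m) - kk a N‖ ≤ K * (1/(α + N) - 1/(α + N + m)) := by
    intro N m
    induction m with
    | zero => simp
    | succ m ih =>
      have e : kk a (N + (m+1)) - kk a N = (kk a (N+m) - kk a N) + kk a (N+m) * (1 / (4 * ((a + (N+m:ℕ)) * (a + (N+m:ℕ) + 1)))) := by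
        rw [← add_assoc, kk_succ ha]; ring
      rw [e]
      refine (norm_add_le _ _).trans ?_
      have p1 : 0 < α + N + m := by positivity
      have p2 : 0 < α + N + m + 1 := by positivity
      have n1 : α + N + m ≤ ‖a + (N+m:ℕ)‖ := by
        refine le_trans (le_of_eq ?_) (Complex.re_le_norm _)
        simp [hα]; ring
      have n2 : α + N + m + 1 ≤ ‖a + (N+m:ℕ) + 1‖ := by
        refine le_trans (le_of_eq ?_) (Complex.re_le_norm _)
        simp [hα]; ring
      have b : ‖kk a (N+m) * (1 / (4 * ((a + (N+m:ℕ)) * (a + (N+m:ℕ) + 1))))‖ ≤ K * (1/((α + N + m) * (α + N + m + 1))) := by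
        rw [norm_mul]
        apply mul_le_mul (hK' _) _ (norm_nonneg _) K0
        rw [norm_div, norm_one, norm_mul, norm_mul]
        apply one_div_le_one_div_of_le (by positivity)
        have : (α + N + m) * (α + N + m + 1) ≤ ‖a + (N+m:ℕ)‖ * ‖a + (N+m:ℕ) + 1‖ := by gcongr
        have h4 : ‖(4:ℂ)‖ = 4 := by norm_num
        rw [h4]
        nlinarith [mul_pos p1 p2]
      have e2 : 1/((α + N + m) * (α + N + m + 1)) = 1/(α + N + m) - 1/(α + N + m + 1) := by
        field_simp; ring
      rw [e2] at b
      refine (add_le_add ih b).trans (le_of_eq ?_)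
      push_cast
      ring
  refine ⟨K, K0, fun n => ?_⟩
  have p1 : 0 < α + n := by positivity
  have hn : ‖1 - kk a n‖ ≤ K * (1/(α + n)) := by
    have t : Tendsto (fun m => ‖kk a (n + m) - kk a n‖) atTop (𝓝 ‖1 - kk a n‖) := by
      have := (kk_tendsto ha).comp (tendsto_add_atTop_nat n)
      have := (this.sub_const (kk a n)).norm
      refine this.congr (fun m => ?_)
      simp [add_comm]
    refine le_of_tendsto t (Eventually.of_forall fun m => (key n m).trans ?_)
    gcongr
    have : 0 ≤ 1 / (α + n + m) := by positivity
    linarith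
  rw [norm_mul]
  have : ‖a + n‖ ≤ ‖a‖ + n := (norm_add_le _ _).trans (by simp)
  calc ‖a + n‖ * ‖1 - kk a n‖ ≤ (‖a‖ + n) * (K * (1/(α + n))) := by gcongr
    _ = K * (n / (α + n) + ‖a‖ / (α + n)) := by ring
    _ ≤ K * (1 + ‖a‖ / α) := by
      gcongr
      · rw [div_le_one p1]; linarith
      · linarith [(Nat.cast_nonneg n : (0:ℝ) ≤ n)]

lemma nt_tendsto (a c : ℂ) (h : 0 < (c - 2 * a).re) : Tendsto (fun n : ℕ => (n:ℂ) * hc a a c n) atTop (𝓝 0) := by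
  obtain ⟨C, hC, b⟩ := hc_bound a a c
  have e : (a + a - c - 1).re = -(c - 2*a).re - 1 := by simp; ring
  rw [e] at b
  have t : Tendsto (fun n : ℕ => C * ((n:ℝ)+1) ^ (-(c - 2*a).re)) atTop (𝓝 0) := by
    have t1 := (tendsto_rpow_neg_atTop h).comp (tendsto_natCast_atTop_atTop (R := ℝ))
    have := ((tendsto_add_atTop_iff_nat 1).2 t1).const_mul C
    simpa [Function.comp_def] using this
  refine squeeze_zero_norm (fun n => ?_) t
  rw [norm_mul]
  have p : (0:ℝ) < n + 1 := by positivity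
  have hn : ‖(n:ℂ)‖ = n := by simp
  calc _ ≤ ((n:ℝ)+1) * (C * ((n:ℝ)+1) ^ (-(c - 2*a).re - 1)) := by
        rw [hn]; gcongr
        · linarith
        · exact b n
    _ = _ := by
      rw [Real.rpow_sub p, Real.rpow_one]; field_simp

lemma tel1 (a c : ℂ) (N : ℕ) : (1 - (c - 2*a)) * ∑ n ∈ Finset.range N, (a + n) * hc a a c n =
    N * (N + c - 1) * hc a a c N + ((1 - (c - 2*a)) * a - a^2) * ∑ n ∈ Finset.range N, hc a a c n := by
  induction N with
  | zero => simp
  | succ N ih =>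
    rw [Finset.sum_range_succ, Finset.sum_range_succ, mul_add, ih]
    have h1 := hc_succ_n a a c N
    have h2 := hc_succ_c a a c N
    push_cast
    linear_combination (-(N + c)) * h1 + (a + N)^2 * h2

lemma tel2 (b c : ℂ) (N : ℕ) : (1 - (c + 1 - 2*b)) * ∑ n ∈ Finset.range N, (c + n) * hc b b (c+1) n =
    N * (N + c) * hc b b (c+1) N + ((1 - (c + 1 - 2*b)) * c - b^2) * ∑ n ∈ Finset.range N, hc b b (c+1) n := by
  induction N with
  | zero => simp
  | succ N ih =>
    rw [Finset.sum_range_succ, Finset.sum_range_succ, mul_add, ih]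
    have h1 := hc_succ_n b b (c+1) N
    have h2 := hc_succ_c b b (c+1) N
    push_cast
    linear_combination (-(N + c + 1)) * h1 + (b + N)^2 * h2

end NF

namespace NF
open Filter Topology MeasureTheory Set

lemma hyp_one_hasSum (a c : ℂ) (h : 0 < (c - 2 * a).re) :
    HasSum (fun n : ℕ => hc a a c n) (hyp2F1reg a a c 1) := by
  have hs := (hc_summable a a c (by
    have : (a + a - c).re = -(c - 2*a).re := by simp; ring
    rw [this]; linarith)).of_norm
  have e : hyp2F1reg a a c 1 = ∑' n, hc a a c n := by
    unfold hyp2F1reg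
    refine tsum_congr (fun n => ?_)
    rw [one_pow, mul_one]; rfl
  rw [e]; exact hs.hasSum

lemma bb_a {a : ℂ} (n : ℕ) : bb (2 * a + 2 * n) =
    1/2 * (Real.sqrt Real.pi) * Complex.Gamma (a + n) / Complex.Gamma (a + 1/2 + n) := by
  unfold bb
  rw [show (2 * a + 2 * n)/2 = a + n by ring, show (2 * a + 2 * n + 1)/2 = a + 1/2 + n by ring]

lemma bb_b {a : ℂ} (n : ℕ) : bb (2 * a + 2 * n + 1) =
    1/2 * (Real.sqrt Real.pi) * Complex.Gamma (a + 1/2 + n) / Complex.Gamma (a + n + 1) := by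
  unfold bb
  rw [show (2 * a + 2 * n + 1)/2 = a + 1/2 + n by ring, show (2 * a + 2 * n + 1 + 1)/2 = a + n + 1 by ring]

lemma term0 {a c : ℂ} (ha : 0 < a.re) (n : ℕ) : hc a (a + 1/2) c n * bb (2 * a + 2 * n) =
    1/2 * (Real.sqrt Real.pi) * (Complex.Gamma a / Complex.Gamma (a + 1/2)) * hc a a c n := by
  rw [bb_a, Gamma_add_nat a (ne_neg_nat_of_re_pos ha), Gamma_add_nat (a+1/2) (ne_neg_nat_of_re_pos (half_re ha))]
  have h2 := poch_ne_zero (half_re ha) n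
  have g2 := Complex.Gamma_ne_zero_of_re_pos (half_re ha)
  unfold hc
  generalize Complex.Gamma (c + n) = G
  generalize (n.factorial : ℂ) = f
  generalize poch (a + 1/2) n = P at *
  generalize Complex.Gamma (a + 1/2) = G2 at *
  field_simp

lemma term1 {a c : ℂ} (ha : 0 < a.re) (n : ℕ) :
    hc a (a + 1/2) c n * ((2 * a + 2 * n) * (bb (2 * a + 2 * n) - bb (2 * a + 2 * n + 1))) =
    (Real.sqrt Real.pi) * ((Complex.Gamma a / Complex.Gamma (a + 1/2)) * ((a + n) * hc a a c n)
      - (Complex.Gamma (a + 1/2) / Complex.Gamma a) * ((c + n) * hc (a + 1/2) (a + 1/2) (c + 1) n)) := by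
  rw [bb_a, bb_b, Complex.Gamma_add_one _ (addn_ne ha n), Gamma_add_nat a (ne_neg_nat_of_re_pos ha),
    Gamma_add_nat (a+1/2) (ne_neg_nat_of_re_pos (half_re ha)), ← hc_succ_c]
  have h1 := poch_ne_zero ha n
  have g1 := Complex.Gamma_ne_zero_of_re_pos ha
  have h2 := poch_ne_zero (half_re ha) n
  have g2 := Complex.Gamma_ne_zero_of_re_pos (half_re ha)
  have h3 := addn_ne ha n
  unfold hc
  rw [div_eq_mul_inv _ (Complex.Gamma (c + n) * _), div_eq_mul_inv _ (Complex.Gamma (c + n) * _), div_eq_mul_inv _ (Complex.Gamma (c + n) * _)]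
  generalize (Complex.Gamma (c + n) * (n.factorial : ℂ))⁻¹ = f
  generalize poch (a + 1/2) n = P at *
  generalize Complex.Gamma (a + 1/2) = G at *
  field_simp

lemma bdry_eq {a c : ℂ} (ha : 0 < a.re) (n : ℕ) :
    (Complex.Gamma a / Complex.Gamma (a + 1/2)) * (n * (n + c - 1) * hc a a c n)
      - (Complex.Gamma (a + 1/2) / Complex.Gamma a) * (n * (n + c) * hc (a + 1/2) (a + 1/2) (c + 1) n)
    = (Complex.Gamma a / Complex.Gamma (a + 1/2)) * ((n * hc a a c n) * ((c - 1 - a) + (a + n) * (1 - kk a n))) := by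
  have e : (n:ℂ) * (n + c) * hc (a + 1/2) (a + 1/2) (c + 1) n = n * hc (a+1/2) (a+1/2) c n := by
    rw [hc_succ_c (a+1/2) (a+1/2) c]; ring
  rw [e]
  have h1 := poch_ne_zero ha n
  have g1 := Complex.Gamma_ne_zero_of_re_pos ha
  have h2 := poch_ne_zero (half_re ha) n
  have g2 := Complex.Gamma_ne_zero_of_re_pos (half_re ha)
  have h3 := addn_ne ha n
  have e2 : (a + n) * kk a n = (Complex.Gamma (a + 1/2) * poch (a + 1/2) n / (Complex.Gamma a * poch a n))^2 := by
    unfold kk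
    rw [Gamma_add_nat a (ne_neg_nat_of_re_pos ha), Gamma_add_nat (a+1/2) (ne_neg_nat_of_re_pos (half_re ha))]
    field_simp
  rw [mul_sub (a + n : ℂ), e2]
  unfold hc
  rw [div_eq_mul_inv _ (Complex.Gamma (c + n) * _), div_eq_mul_inv _ (Complex.Gamma (c + n) * _)]
  generalize (Complex.Gamma (c + n) * (n.factorial : ℂ))⁻¹ = f
  generalize poch (a + 1/2) n = P at *
  generalize Complex.Gamma (a + 1/2) = G at *
  field_simp
  ring

lemma bdry_tendsto {a c : ℂ} (ha : 0 < a.re) (h : 0 < (c - 2 * a).re) : Tendsto (fun n : ℕ => 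
    (Complex.Gamma a / Complex.Gamma (a + 1/2)) * (n * (n + c - 1) * hc a a c n)
      - (Complex.Gamma (a + 1/2) / Complex.Gamma a) * (n * (n + c) * hc (a + 1/2) (a + 1/2) (c + 1) n)) atTop (𝓝 0) := by
  simp_rw [bdry_eq ha]
  rw [← mul_zero (Complex.Gamma a / Complex.Gamma (a + 1/2))]
  apply Tendsto.const_mul
  obtain ⟨K, hK0, hK⟩ := kk_bound ha
  have hb : IsBoundedUnder (· ≤ ·) atTop (norm ∘ fun n : ℕ => ((c - 1 - a) + (a + n) * (1 - kk a n))) := by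
    refine isBoundedUnder_of ⟨‖c - 1 - a‖ + K * (1 + ‖a‖ / a.re), fun n => ?_⟩
    exact (norm_add_le _ _).trans (by gcongr; exact hK n)
  exact NormedField.tendsto_zero_smul_of_tendsto_zero_of_bounded (nt_tendsto a c h) hb

lemma lin_sum {a c S1 S2 S : ℂ} (ha : 0 < a.re) (h : 0 < (c - 2 * a).re)
    (h1 : HasSum (fun n : ℕ => hc a a c n) S1)
    (h2 : HasSum (fun n : ℕ => hc (a+1/2) (a+1/2) (c+1) n) S2)
    (h3 : HasSum (fun n : ℕ => (Real.sqrt Real.pi : ℂ) * ((Complex.Gamma a / Complex.Gamma (a + 1/2)) * ((a + n) * hc a a c n)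
      - (Complex.Gamma (a + 1/2) / Complex.Gamma a) * ((c + n) * hc (a + 1/2) (a + 1/2) (c + 1) n))) S) :
    (1 - (c - 2*a)) * S = (Real.sqrt Real.pi : ℂ) * ((Complex.Gamma a / Complex.Gamma (a + 1/2)) * (((1 - (c - 2*a)) * a - a^2) * S1) -
       (Complex.Gamma (a + 1/2) / Complex.Gamma a) * (((1 - (c - 2*a)) * c - (a+1/2)^2) * S2)) := by
  have t3 := (h3.tendsto_sum_nat).const_mul (1 - (c - 2*a))
  have t1 := h1.tendsto_sum_nat
  have t2 := h2.tendsto_sum_nat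
  have tb := bdry_tendsto ha h
  have t := (tb.add (((t1.const_mul ((1 - (c - 2*a)) * a - a^2)).const_mul (Complex.Gamma a / Complex.Gamma (a + 1/2))).sub
    ((t2.const_mul ((1 - (c - 2*a)) * c - (a+1/2)^2)).const_mul (Complex.Gamma (a + 1/2) / Complex.Gamma a)))).const_mul (Real.sqrt Real.pi : ℂ)
  rw [zero_add] at t
  refine tendsto_nhds_unique t3 (t.congr (fun N => ?_))
  rw [← Finset.mul_sum, Finset.sum_sub_distrib, ← Finset.mul_sum, ← Finset.mul_sum]
  have e1 := tel1 a c N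
  have e2 := tel2 (a+1/2) c N
  rw [show c + 1 - 2 * (a + 1/2) = c - 2 * a by ring] at e2
  linear_combination (-(Real.sqrt Real.pi : ℂ) * (Complex.Gamma a / Complex.Gamma (a + 1/2))) * e1 +
    ((Real.sqrt Real.pi : ℂ) * (Complex.Gamma (a + 1/2) / Complex.Gamma a)) * e2

lemma II0_val (ν μ : ℂ) (ha : 0 < (ν - μ + 1).re) (hμ : -(1/2) < μ.re) :
    II ν μ 0 0 = 1/2 * (Real.sqrt Real.pi) * (A0 ν μ / A1 ν μ) * (Complex.Gamma (μ + 1/2) * r2 ν μ ^ 2) := by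
  have ha' : 0 < ((ν - μ + 1)/2).re := by
    rw [show (ν - μ + 1)/2 = ((1/2:ℝ):ℂ) * (ν - μ + 1) by push_cast; ring, Complex.re_ofReal_mul]; linarith
  have e1 : ν + 3/2 - 2 * ((ν - μ + 1)/2) = μ + 1/2 := by ring
  have he : 0 < (ν + 3/2 - 2 * ((ν - μ + 1)/2)).re := by rw [e1, Complex.add_re]; norm_num; linarith
  have hb : (ν - μ + 2)/2 = (ν - μ + 1)/2 + 1/2 := by ring
  have h := II0_hasSum ν μ ha hμ
  have h1 := hyp_one_hasSum _ _ he
  rw [gauss_sum _ _ he, e1, show ν + 3/2 - (ν - μ + 1)/2 = (ν + μ + 2)/2 by ring] at h1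
  have h2 := h1.mul_left (1/2 * (Real.sqrt Real.pi) * (A0 ν μ / A1 ν μ))
  refine h.unique (hs_congr h2 (fun n => ?_))
  have := term0 (c := ν + 3/2) ha' n
  unfold A0 A1
  rw [hb, ← this]
  congr 2; ring

lemma II1_val (ν μ : ℂ) (ha : 0 < (ν - μ + 1).re) (hμ : -(1/2) < μ.re) :
    (1/2 - μ) * II ν μ 1 0 = (Real.sqrt Real.pi) * Complex.Gamma (μ + 1/2) * ((A0 ν μ / A1 ν μ) * (-(1/4) * (ν + μ) * (ν - μ + 1)) * r2 ν μ ^ 2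
      + (A1 ν μ / A0 ν μ) * r1 ν μ ^ 2) := by
  have ha' : 0 < ((ν - μ + 1)/2).re := by
    rw [show (ν - μ + 1)/2 = ((1/2:ℝ):ℂ) * (ν - μ + 1) by push_cast; ring, Complex.re_ofReal_mul]; linarith
  have e1 : ν + 3/2 - 2 * ((ν - μ + 1)/2) = μ + 1/2 := by ring
  have e2 : ν + 3/2 + 1 - 2 * ((ν - μ + 1)/2 + 1/2) = μ + 1/2 := by ring
  have hee : 0 < (μ + 1/2).re := by rw [Complex.add_re]; norm_num; linarith
  have he : 0 < (ν + 3/2 - 2 * ((ν - μ + 1)/2)).re := by rw [e1]; exact hee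
  have he2 : 0 < (ν + 3/2 + 1 - 2 * ((ν - μ + 1)/2 + 1/2)).re := by rw [e2]; exact hee
  have hb : (ν - μ + 2)/2 = (ν - μ + 1)/2 + 1/2 := by ring
  have h := II1_hasSum ν μ ha hμ
  have h1 := hyp_one_hasSum _ _ he
  have h2 := hyp_one_hasSum _ _ he2
  rw [gauss_sum _ _ he, e1, show ν + 3/2 - (ν - μ + 1)/2 = (ν + μ + 2)/2 by ring] at h1
  rw [gauss_sum _ _ he2, e2, show ν + 3/2 + 1 - ((ν - μ + 1)/2 + 1/2) = (ν + μ + 1)/2 + 1 by ring] at h2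
  have h3 := lin_sum ha' he h1 h2 (hs_congr h (fun n => (by
    rw [← term1 ha', hb, show 2 * ((ν - μ + 1)/2) = ν - μ + 1 by ring])))
  rw [← hb, e1] at h3
  have hr : (ν + μ + 1)/2 * (Complex.Gamma ((ν + μ + 1)/2 + 1))⁻¹ = r1 ν μ := by
    have := Complex.one_div_Gamma_eq_self_mul_one_div_Gamma_add_one ((ν + μ + 1)/2)
    unfold r1
    rw [this]
  rw [← hr]
  unfold A0 A1 r2
  linear_combination h3

end NF

namespace NF
open Filter Topology MeasureTheory Set

structure Sys (ν μ : ℂ) (f h g : ℝ → ℂ) : Prop where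
  d1 : ∀ x : ℝ, -1 < x → x < 1 → HasDerivAt f (h x) x
  d2 : ∀ x : ℝ, -1 < x → x < 1 → HasDerivAt h (2 * g x + cA x * h x + 2 * cB ν μ x * f x) x
  d3 : ∀ x : ℝ, -1 < x → x < 1 → HasDerivAt g (2 * cA x * g x + cB ν μ x * h x) x

lemma Sys.sub {ν μ : ℂ} {f h g f' h' g' : ℝ → ℂ} (s : Sys ν μ f h g) (s' : Sys ν μ f' h' g') (k : ℂ) :
    Sys ν μ (fun x => f x - k * f' x) (fun x => h x - k * h' x) (fun x => g x - k * g' x) where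
  d1 x h1 h2 := (s.d1 x h1 h2).fun_sub ((s'.d1 x h1 h2).const_mul k)
  d2 x h1 h2 := ((s.d2 x h1 h2).fun_sub ((s'.d2 x h1 h2).const_mul k)).congr_deriv (by ring)
  d3 x h1 h2 := ((s.d3 x h1 h2).fun_sub ((s'.d3 x h1 h2).const_mul k)).congr_deriv (by ring)

lemma Sys.neg {ν μ : ℂ} {f h g : ℝ → ℂ} (s : Sys ν μ f h g) :
    Sys ν μ (fun x => f (-x)) (fun x => - h (-x)) (fun x => g (-x)) where
  d1 x h1 h2 := (deriv_neg_arg (s.d1 (-x) (by linarith) (by linarith)))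
  d2 x h1 h2 := ((deriv_neg_arg (s.d2 (-x) (by linarith) (by linarith))).fun_neg).congr_deriv (by
    unfold cA cB; push_cast; ring)
  d3 x h1 h2 := (deriv_neg_arg (s.d3 (-x) (by linarith) (by linarith))).congr_deriv (by
    unfold cA cB; push_cast; ring)

lemma Sys.zero_pos {ν μ : ℂ} {f h g : ℝ → ℂ} (s : Sys ν μ f h g) (hf : f 0 = 0) (hh : h 0 = 0) (hg : g 0 = 0)
    {x : ℝ} (h0 : 0 ≤ x) (h1 : x < 1) : f x = 0 := by
  have cont : ∀ F : ℝ → ℂ, ContinuousOn F (Icc 0 x) → ∃ M, 0 ≤ M ∧ ∀ t ∈ Icc 0 x, ‖F t‖ ≤ M := by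
    intro F hF
    obtain ⟨M, hM⟩ := isCompact_Icc.exists_bound_of_continuousOn hF
    exact ⟨M, (norm_nonneg _).trans (hM 0 ⟨le_rfl, h0⟩), hM⟩
  have ne : ∀ t ∈ Icc 0 x, (1:ℂ) - (t:ℂ)^2 ≠ 0 := fun t ht => one_sub_sq_ne (by linarith [ht.1]) (by linarith [ht.2])
  have cy : ContinuousOn (fun t : ℝ => (1:ℂ) - (t:ℂ)^2) (Icc 0 x) := by fun_prop
  obtain ⟨M1, hM1, bA⟩ := cont cA (by unfold cA; exact ContinuousOn.div (by fun_prop) cy ne)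
  obtain ⟨M2, hM2, bB⟩ := cont (cB ν μ) (by
    unfold cB
    exact ContinuousOn.div ((continuousOn_const.sub (ContinuousOn.div continuousOn_const cy ne)).neg) cy ne)
  let v : ℝ → ℂ × ℂ × ℂ := fun t => (f t, h t, g t)
  let v' : ℝ → ℂ × ℂ × ℂ := fun t => (h t, 2 * g t + cA t * h t + 2 * cB ν μ t * f t, 2 * cA t * g t + cB ν μ t * h t)
  have hv : ∀ t ∈ Icc 0 x, HasDerivAt v (v' t) t := fun t ht =>
    (s.d1 t (by linarith [ht.1]) (by linarith [ht.2])).prodMk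
      ((s.d2 t (by linarith [ht.1]) (by linarith [ht.2])).prodMk (s.d3 t (by linarith [ht.1]) (by linarith [ht.2])))
  have key := eq_zero_of_abs_deriv_le_mul_abs_self_of_eq_zero_right (f := v) (f' := v') (K := 3 + 2 * M1 + 2 * M2) (a := 0) (b := x)
    (fun t ht => (hv t ht).continuousAt.continuousWithinAt) (fun t ht => (hv t ⟨ht.1, ht.2.le⟩).hasDerivWithinAt)
    (by simp only [v, hf, hh, hg]; rfl) ?_ x ⟨h0, le_rfl⟩
  · exact congrArg Prod.fst key
  · intro t ht
    have ht' : t ∈ Icc 0 x := ⟨ht.1, ht.2.le⟩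
    have n1 : ‖f t‖ ≤ ‖v t‖ := norm_fst_le (v t)
    have n2 : ‖h t‖ ≤ ‖v t‖ := (norm_fst_le (v t).2).trans (norm_snd_le (v t))
    have n3 : ‖g t‖ ≤ ‖v t‖ := (norm_snd_le (v t).2).trans (norm_snd_le (v t))
    have a1 := bA t ht'
    have b1 := bB t ht'
    have two : ‖(2:ℂ)‖ = 2 := by norm_num
    have nv := norm_nonneg (v t)
    have q1 : ‖cA t‖ * ‖h t‖ ≤ M1 * ‖v t‖ := by gcongr
    have q2 : ‖cB ν μ t‖ * ‖f t‖ ≤ M2 * ‖v t‖ := by gcongr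
    have q3 : ‖cA t‖ * ‖g t‖ ≤ M1 * ‖v t‖ := by gcongr
    have q4 : ‖cB ν μ t‖ * ‖h t‖ ≤ M2 * ‖v t‖ := by gcongr
    have r1 := mul_nonneg hM1 nv
    have r2 := mul_nonneg hM2 nv
    have m1 : ‖h t‖ ≤ (3 + 2 * M1 + 2 * M2) * ‖v t‖ := by nlinarith
    have m2 : ‖2 * g t + cA t * h t + 2 * cB ν μ t * f t‖ ≤ (3 + 2 * M1 + 2 * M2) * ‖v t‖ := by
      refine norm_add₃_le.trans ?_
      simp only [norm_mul, two]
      nlinarith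
    have m3 : ‖2 * cA t * g t + cB ν μ t * h t‖ ≤ (3 + 2 * M1 + 2 * M2) * ‖v t‖ := by
      refine (norm_add_le _ _).trans ?_
      simp only [norm_mul, two]
      nlinarith
    exact max_le m1 (max_le m2 m3)

lemma Sys.zero {ν μ : ℂ} {f h g : ℝ → ℂ} (s : Sys ν μ f h g) (hf : f 0 = 0) (hh : h 0 = 0) (hg : g 0 = 0)
    {x : ℝ} (h0 : -1 < x) (h1 : x < 1) : f x = 0 := by
  rcases le_total 0 x with h | h
  · exact s.zero_pos hf hh hg h h1
  · have := s.neg.zero_pos (by simpa using hf) (by simpa using hh) (by simpa using hg) (x := -x) (by linarith) (by linarith)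
    simpa using this

lemma sysQP (ν μ : ℂ) : Sys ν μ
    (fun x => ferrersQ ν μ x ^ 2 + (Real.pi : ℂ) ^ 2 / 4 * ferrersP ν μ x ^ 2)
    (fun x => 2 * (ferrersQ ν μ x * ferQd ν μ x + (Real.pi : ℂ) ^ 2 / 4 * (ferrersP ν μ x * ferPd ν μ x)))
    (fun x => ferQd ν μ x ^ 2 + (Real.pi : ℂ) ^ 2 / 4 * ferPd ν μ x ^ 2) where
  d1 x h1 h2 := (((ferQ_deriv ν μ h1 h2).fun_pow 2).fun_add (((ferP_deriv ν μ h1 h2).fun_pow 2).const_mul _)).congr_deriv (by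
    push_cast; ring)
  d2 x h1 h2 := ((((ferQ_deriv ν μ h1 h2).fun_mul (ferQd_deriv ν μ h1 h2)).fun_add
    (((ferP_deriv ν μ h1 h2).fun_mul (ferPd_deriv ν μ h1 h2)).const_mul _)).const_mul _).congr_deriv (by
    ring)
  d3 x h1 h2 := (((ferQd_deriv ν μ h1 h2).fun_pow 2).fun_add (((ferPd_deriv ν μ h1 h2).fun_pow 2).const_mul _)).congr_deriv (by
    push_cast; ring)

noncomputable def Ew (μ : ℂ) (x : ℝ) : ℂ := ((1 - x^2 : ℝ) : ℂ) ^ (-μ)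
noncomputable def hh (ν μ : ℂ) (j : ℕ) (x : ℝ) : ℂ := II ν μ j (x^2)

lemma Ew_deriv (μ : ℂ) {x : ℝ} (h1 : -1 < x) (h2 : x < 1) :
    HasDerivAt (Ew μ) (2 * μ * x / (1 - (x:ℂ)^2) * Ew μ x) x := by
  have h : HasDerivAt (fun x : ℝ => 1 - x^2) (-(2 * x)) x := by
    have := ((hasDerivAt_id x).fun_pow 2).const_sub 1
    simpa using this
  have := cpow_deriv h (by nlinarith) (-μ)
  refine this.congr_deriv ?_
  unfold Ew; push_cast; ring

lemma hh_deriv (ν μ : ℂ) (j : ℕ) {s0 : ℝ} (h0 : 0 ≤ s0) (hs0 : s0 < 1)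
    (hJ : IntegrableOn (fun w => J ν μ 0 s0 w) (Ioi 1)) {x : ℝ} (h1 : -1 < x) (h2 : x < 1) :
    HasDerivAt (hh ν μ j) (-4 * x * (μ - 1/2 - j) * hh ν μ (j+1) x) x := by
  have h : HasDerivAt (fun x : ℝ => x^2) (2 * x) x := by
    have := ((hasDerivAt_id x).fun_pow 2)
    simpa using this
  have := (II_deriv ν μ j (s := x^2) h0 hs0 (by nlinarith) (by nlinarith) hJ).scomp x h
  refine this.congr_deriv ?_
  unfold hh
  rw [Complex.real_smul]; push_cast; ring

noncomputable def RG (ν μ : ℂ) (x : ℝ) : ℂ := Ew μ x *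
  ((μ^2 / (1 - (x:ℂ)^2)^2 + (μ + ν*(ν+1) - 2*μ^2) / (1 - (x:ℂ)^2)) * hh ν μ 0 x
   + ((4 - 8*μ) * (μ - 1/2) * (x:ℂ)^2 / (1 - (x:ℂ)^2) - 2 * (μ - 1/2)) * hh ν μ 1 x
   + 8 * (x:ℂ)^2 * (μ - 1/2) * (μ - 3/2) * hh ν μ 2 x)

lemma sysR (ν μ : ℂ) {s0 : ℝ} (h0 : 0 ≤ s0) (hs0 : s0 < 1) (ha : 0 < (ν - μ + 1).re) (hμ : -(1/2) < μ.re)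
    (hJ : IntegrableOn (fun w => J ν μ 0 s0 w) (Ioi 1)) : Sys ν μ
    (fun x => Ew μ x * hh ν μ 0 x)
    (fun x => Ew μ x * (2 * μ * x / (1 - (x:ℂ)^2) * hh ν μ 0 x - 4 * x * (μ - 1/2) * hh ν μ 1 x))
    (RG ν μ) := by
  have D0 : ∀ x : ℝ, -1 < x → x < 1 → HasDerivAt (fun x => hh ν μ 0 x) (-4 * x * (μ - 1/2) * hh ν μ 1 x) x := fun x h1 h2 =>
    (hh_deriv ν μ 0 h0 hs0 hJ h1 h2).congr_deriv (by push_cast; ring)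
  have D1 : ∀ x : ℝ, -1 < x → x < 1 → HasDerivAt (fun x => hh ν μ 1 x) (-4 * x * (μ - 3/2) * hh ν μ 2 x) x := fun x h1 h2 =>
    (hh_deriv ν μ 1 h0 hs0 hJ h1 h2).congr_deriv (by push_cast; ring)
  have D2 : ∀ x : ℝ, -1 < x → x < 1 → HasDerivAt (fun x => hh ν μ 2 x) (-4 * x * (μ - 5/2) * hh ν μ 3 x) x := fun x h1 h2 =>
    (hh_deriv ν μ 2 h0 hs0 hJ h1 h2).congr_deriv (by push_cast; ring)
  have DE : ∀ x : ℝ, -1 < x → x < 1 → HasDerivAt (fun x => Ew μ x) (2 * μ * x / (1 - (x:ℂ)^2) * Ew μ x) x := fun x h1 h2 => Ew_deriv μ h1 h2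
  have Dx : ∀ x : ℝ, HasDerivAt (fun x : ℝ => (x:ℂ)) 1 x := fun x => by
    simpa using (hasDerivAt_id x).ofReal_comp
  have Dx2 : ∀ x : ℝ, HasDerivAt (fun x : ℝ => (x:ℂ)^2) (2 * x) x := fun x =>
    ((Dx x).fun_pow 2).congr_deriv (by push_cast; ring)
  have Dy : ∀ x : ℝ, HasDerivAt (fun x : ℝ => 1 - (x:ℂ)^2) (-(2 * (x:ℂ))) x := fun x => (Dx2 x).const_sub 1
  constructor
  · intro x h1 h2
    exact ((DE x h1 h2).fun_mul (D0 x h1 h2)).congr_deriv (by ring)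
  · intro x h1 h2
    have y0 := one_sub_sq_ne h1 h2
    refine ((DE x h1 h2).fun_mul (((((Dx x).const_mul (2*μ)).fun_div (Dy x) y0).fun_mul (D0 x h1 h2)).fun_sub
      ((((Dx x).const_mul 4).mul_const (μ - 1/2)).fun_mul (D1 x h1 h2)))).congr_deriv ?_
    unfold RG cA cB
    generalize Ew μ x = E
    generalize hh ν μ 0 x = H0
    generalize hh ν μ 1 x = H1
    generalize hh ν μ 2 x = H2
    generalize (x:ℂ) = X at *
    obtain ⟨y, hy⟩ : ∃ y, y = 1 - X^2 := ⟨_, rfl⟩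
    rw [← hy] at y0 ⊢
    field_simp
    rw [hy]
    ring
  · intro x h1 h2
    have y0 := one_sub_sq_ne h1 h2
    have C := cert ν μ (s := x^2) h0 hs0 (by nlinarith) (by nlinarith) ha hμ hJ
    unfold al1 al2 al3 at C
    change _ * hh ν μ 0 x + _ * hh ν μ 1 x + _ * hh ν μ 2 x + _ * hh ν μ 3 x = 0 at C
    push_cast at C
    have c0 := (((Dy x).fun_pow 2).fun_inv (pow_ne_zero 2 y0)).const_mul (μ^2)
    have c0' := ((Dy x).fun_inv y0).const_mul (μ + ν*(ν+1) - 2*μ^2)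
    have c1 := ((((Dx2 x).const_mul ((4 - 8*μ) * (μ - 1/2))).fun_div (Dy x) y0).sub_const (2 * (μ - 1/2)))
    have c2 := (((Dx2 x).const_mul 8).mul_const (μ - 1/2)).mul_const (μ - 3/2)
    refine ((DE x h1 h2).fun_mul ((((c0.fun_add c0').fun_mul (D0 x h1 h2)).fun_add (c1.fun_mul (D1 x h1 h2))).fun_add (c2.fun_mul (D2 x h1 h2)))).congr_deriv ?_
    unfold RG cA cB
    generalize Ew μ x = E
    generalize hh ν μ 0 x = H0 at *
    generalize hh ν μ 1 x = H1 at *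
    generalize hh ν μ 2 x = H2 at *
    generalize hh ν μ 3 x = H3 at *
    generalize (x:ℂ) = X at *
    clear c0 c0' c1 c2 D0 D1 D2 DE Dx Dx2 Dy
    obtain ⟨y, hy⟩ : ∃ y, y = 1 - X^2 := ⟨_, rfl⟩
    rw [← hy] at y0 ⊢
    rw [← sub_eq_zero]
    refine Eq.trans ?_ (mul_eq_zero_of_right (E * 4 * X * (μ - 1/2) / y^2) C)
    field_simp
    rw [hy]
    ring

end NF

namespace NF
open Filter Topology MeasureTheory Set

noncomputable def K0 (ν μ : ℂ) : ℂ := (Real.sqrt Real.pi : ℂ) * Complex.Gamma (ν - μ + 1) * (2:ℂ) ^ (-ν - 1)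

lemma K0_eq (ν μ : ℂ) : K0 ν μ = A0 ν μ * A1 ν μ * (2:ℂ) ^ (-μ) / 2 := by
  unfold K0 A0 A1
  have h := dup ((ν - μ + 1)/2)
  rw [show 2 * ((ν - μ + 1)/2) = ν - μ + 1 by ring, show (ν - μ + 1)/2 + 1/2 = (ν - μ + 2)/2 by ring] at h
  have e : (2:ℂ) ^ (ν - μ + 1 - 1) * (2:ℂ) ^ (-ν - 1) = (2:ℂ) ^ (-μ) / 2 := by
    rw [← Complex.cpow_add _ _ two_ne_zero, show ν - μ + 1 - 1 + (-ν - 1) = -μ - 1 by ring,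
      Complex.cpow_sub _ _ two_ne_zero, Complex.cpow_one]
  have s := sqpi_ne
  rw [h]
  calc _ = Complex.Gamma ((ν - μ + 1)/2) * Complex.Gamma ((ν - μ + 2)/2) * ((2:ℂ) ^ (ν - μ + 1 - 1) * (2:ℂ) ^ (-ν - 1)) := by
        field_simp
    _ = _ := by rw [e]; ring

lemma F_eq (ν μ : ℂ) (x : ℝ) {w : ℝ} (hw : 1 < w) :
    legendreQ ν (-μ) w * ((w - 1 : ℝ) : ℂ) ^ ((μ - 1) / 2) *
        ((w + 1 : ℝ) : ℂ) ^ (-μ / 2) * ((1 - 2 * x ^ 2 + w : ℝ) : ℂ) ^ (μ - 1 / 2) =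
    Complex.exp (-((Real.pi : ℂ) * Complex.I * μ)) * (K0 ν μ * J ν μ 0 (x^2) w) := by
  have w1 : ((w - 1 : ℝ) : ℂ) ≠ 0 := by push_cast; exact w1_ne hw
  have w2 : ((w + 1 : ℝ) : ℂ) ≠ 0 := by push_cast; exact w2_ne hw
  have e1 : ((w:ℂ)^2 - 1) ^ (-μ/2) = ((w - 1 : ℝ) : ℂ) ^ (-μ/2) * ((w + 1 : ℝ) : ℂ) ^ (-μ/2) := by
    rw [← Complex.mul_cpow_ofReal_nonneg (by linarith) (by linarith)]
    congr 1; push_cast; ring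
  have e2 : ((w - 1 : ℝ) : ℂ) ^ (-(1/2) : ℂ) = ((w - 1 : ℝ) : ℂ) ^ (-μ/2) * ((w - 1 : ℝ) : ℂ) ^ ((μ - 1) / 2) := by
    rw [← Complex.cpow_add _ _ w1]; congr 1; ring
  have e3 : ((w + 1 : ℝ) : ℂ) ^ (-μ) = ((w + 1 : ℝ) : ℂ) ^ (-μ/2) * ((w + 1 : ℝ) : ℂ) ^ (-μ/2) := by
    rw [← Complex.cpow_add _ _ w2]; congr 1; ring
  unfold legendreQ J Y U V K0
  rw [e1, e2, e3, pow_zero, div_one, show (1 - 2 * x^2 + w : ℝ) = w + 1 - 2 * x^2 by ring,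
    show (-ν - -μ - 1) = -(ν - μ + 1) by ring, ← sub_eq_add_neg, add_zero, mul_neg]
  ring

end NF

/-- Nicholson-type formula for Ferrers functions. -/
theorem nicholson_ferrers
    (ν μ : ℂ) (hμ : ∀ n : ℤ, μ ≠ (n : ℂ)) (hνμ : -1 < (ν - μ).re)
    (h : ∀ n : ℕ, ν - μ + 1 ≠ -(n : ℂ))
    (x : ℝ) (hx : -1 < x) (hx' : x < 1)
    (F : ℝ → ℂ)
    (hF : ∀ w, F w = legendreQ ν (-μ) w * ((w - 1 : ℝ) : ℂ) ^ ((μ - 1) / 2) *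
        ((w + 1 : ℝ) : ℂ) ^ (-μ / 2) * ((1 - 2 * x ^ 2 + w : ℝ) : ℂ) ^ (μ - 1 / 2))
    (hint : IntegrableOn F (Ioi (1 : ℝ))) :
    ferrersQ ν μ x ^ 2 + (Real.pi : ℂ) ^ 2 / 4 * ferrersP ν μ x ^ 2 =
      (Real.sqrt Real.pi : ℂ) * Complex.exp ((Real.pi : ℂ) * Complex.I * μ) /
        ((2 : ℂ) ^ μ * Complex.Gamma (μ + 1 / 2) * ((1 - x ^ 2 : ℝ) : ℂ) ^ μ) *
        ∫ w in Ioi (1 : ℝ), F w := by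

  have hEq : ∀ w ∈ Ioi (1:ℝ), F w = Complex.exp (-((Real.pi : ℂ) * Complex.I * μ)) * (NF.K0 ν μ * NF.J ν μ 0 (x^2) w) :=
    fun w hw => (hF w).trans (NF.F_eq ν μ x hw)
  have ha : 0 < (ν - μ + 1).re := by rw [Complex.add_re, Complex.one_re]; linarith
  have hA0 : NF.A0 ν μ ≠ 0 := by
    apply Complex.Gamma_ne_zero_of_re_pos
    rw [show (ν - μ + 1)/2 = ((1/2:ℝ):ℂ) * (ν - μ + 1) by push_cast; ring, Complex.re_ofReal_mul]; linarith
  have hA1 : NF.A1 ν μ ≠ 0 := by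
    apply Complex.Gamma_ne_zero_of_re_pos
    rw [show (ν - μ + 2)/2 = ((1/2:ℝ):ℂ) * (ν - μ + 1) + ((1/2:ℝ):ℂ) by push_cast; ring, Complex.add_re,
      Complex.re_ofReal_mul, Complex.ofReal_re]; linarith
  have h2 : (2:ℂ) ^ (-μ) ≠ 0 := by simp [Complex.cpow_eq_zero_iff]
  have hK : NF.K0 ν μ ≠ 0 := by
    rw [NF.K0_eq]
    exact div_ne_zero (mul_ne_zero (mul_ne_zero hA0 hA1) h2) two_ne_zero
  have hsin : Complex.sin (Real.pi * μ) ≠ 0 := by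
    rw [Ne, Complex.sin_eq_zero_iff]
    rintro ⟨k, hk⟩
    exact hμ k (mul_left_cancel₀ NF.pi_ne (by rw [hk]; ring))
  have hJ : IntegrableOn (fun w => NF.J ν μ 0 (x^2) w) (Ioi 1) := by
    refine IntegrableOn.congr_fun (hint.const_mul ((NF.K0 ν μ)⁻¹ * Complex.exp ((Real.pi : ℂ) * Complex.I * μ))) (fun w hw => ?_) measurableSet_Ioi
    rw [hEq w hw, Complex.exp_neg]
    have := Complex.exp_ne_zero ((Real.pi : ℂ) * Complex.I * μ)
    field_simp
  have x0 : 0 ≤ x^2 := sq_nonneg x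
  have x1 : x^2 < 1 := by nlinarith
  have hre := NF.re_mu ν μ ha x1 hJ
  have hG : Complex.Gamma (μ + 1/2) ≠ 0 := by
    apply Complex.Gamma_ne_zero_of_re_pos
    rw [Complex.add_re]; norm_num; linarith
  have hint2 : ∫ w in Ioi (1:ℝ), F w = Complex.exp (-((Real.pi : ℂ) * Complex.I * μ)) * (NF.K0 ν μ * NF.II ν μ 0 (x^2)) := by
    rw [setIntegral_congr_fun measurableSet_Ioi hEq, integral_const_mul, integral_const_mul]
    rfl
  set κ : ℂ := (Real.sqrt Real.pi : ℂ) * NF.A0 ν μ * NF.A1 ν μ * ((2:ℂ)^(-μ))^2 / (2 * Complex.Gamma (μ + 1/2)) with hκ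
  have sy := (NF.sysQP ν μ).sub (NF.sysR ν μ x0 x1 ha hre hJ) κ
  have E0 : NF.Ew μ 0 = 1 := by simp [NF.Ew]
  have I0 := NF.II0_val ν μ ha hre
  have I1 := NF.II1_val ν μ ha hre
  have hh0 : ∀ j, NF.hh ν μ j 0 = NF.II ν μ j 0 := fun j => by simp [NF.hh]
  have sp := NF.sqpi_sq
  have key := sy.zero ?_ ?_ ?_ hx hx'
  · have e := sub_eq_zero.1 key
    rw [e, hint2, NF.K0_eq, Complex.exp_neg]
    have := Complex.exp_ne_zero ((Real.pi : ℂ) * Complex.I * μ)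
    have y0 : ((1 - x^2 : ℝ) : ℂ) ^ μ ≠ 0 := by
      rw [Ne, Complex.cpow_eq_zero_iff, Complex.ofReal_eq_zero]
      rintro ⟨h, -⟩; linarith
    have t0 : (2:ℂ) ^ μ ≠ 0 := by simp [Complex.cpow_eq_zero_iff]
    rw [hκ]
    unfold NF.Ew NF.hh
    rw [Complex.cpow_neg, Complex.cpow_neg]
    field_simp
  · simp only [E0, hh0]
    rw [NF.f0_val ν μ hA0 hA1 hsin, I0, hκ, ← sp]
    clear_value κ
    generalize Complex.Gamma (μ + 1/2) = G at hG ⊢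
    field_simp
    ring
  · simp only [E0, hh0]
    rw [NF.h0_val ν μ hA0 hA1 hsin]
    simp
  · unfold NF.RG
    simp only [E0, hh0]
    rw [NF.g0_val ν μ hA0 hA1 hsin, ← sp]
    have e : ((1:ℂ) * ((μ^2 / (1 - ((0:ℝ):ℂ)^2)^2 + (μ + ν*(ν+1) - 2*μ^2) / (1 - ((0:ℝ):ℂ)^2)) * NF.II ν μ 0 0
        + ((4 - 8*μ) * (μ - 1/2) * ((0:ℝ):ℂ)^2 / (1 - ((0:ℝ):ℂ)^2) - 2 * (μ - 1/2)) * NF.II ν μ 1 0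
        + 8 * ((0:ℝ):ℂ)^2 * (μ - 1/2) * (μ - 3/2) * NF.II ν μ 2 0))
        = (μ + ν*(ν+1) - μ^2) * NF.II ν μ 0 0 + 2 * ((1/2 - μ) * NF.II ν μ 1 0) := by
      simp; ring
    rw [e, I0, I1, hκ]
    clear_value κ
    generalize Complex.Gamma (μ + 1/2) = G at hG ⊢
    field_simp
    ring
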